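/- arXiv:1309.5336 — 2 statements merged into one kernel-verified Lean document; each statement's English description precedes it below -/
import Mathlib

section
/- A 3-connected graph is non-planar if and only if it is isomorphic to K_5 or it has a subgraph isomorphic to a subdivision of K_{3,3}. -/
open SimpleGraph

universe u

variable {V : Type u}

/-- A planar embedding of a simple graph: vertices go to distinct points of the plane and
edges to arcs (injective topological paths) that meet only at common endpoints. -/
structure PlanarEmbedding (G : SimpleGraph V) where
  vmap : V → ℝ × ℝ
  vmap_inj : Function.Injective vmap
  arc : ∀ ⦃x y : V⦄, G.Adj x y → _root_.Path (vmap x) (vmap y)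
  arc_inj : ∀ ⦃x y : V⦄ (h : G.Adj x y), Function.Injective ⇑(arc h)
  arc_symm : ∀ ⦃x y : V⦄ (h : G.Adj x y), Set.range ⇑(arc h) = Set.range ⇑(arc h.symm)
  arc_vertex : ∀ ⦃x y : V⦄ (h : G.Adj x y) (w : V), vmap w ∈ Set.range ⇑(arc h) → w = x ∨ w = y
  arc_disjoint : ∀ ⦃x y x' y' : V⦄ (h : G.Adj x y) (h' : G.Adj x' y'),
      s(x, y) ≠ s(x', y') →
      Set.range ⇑(arc h) ∩ Set.range ⇑(arc h') ⊆
        ({vmap x, vmap y} ∩ {vmap x', vmap y'} : Set (ℝ × ℝ))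

/-- A graph is planar if it admits a planar embedding. -/
def SimpleGraph.IsPlanar (G : SimpleGraph V) : Prop := Nonempty (PlanarEmbedding G)

/-- `(A, B)` is a bipartition of `G`. -/
def SimpleGraph.IsBipartition (G : SimpleGraph V) (A B : Set V) : Prop :=
  Disjoint A B ∧ A ∪ B = Set.univ ∧
    ∀ ⦃x y : V⦄, G.Adj x y → (x ∈ A ∧ y ∈ B) ∨ (x ∈ B ∧ y ∈ A)

/-- A finite graph is 3-connected: more than 3 vertices and removing at most 2 vertices
leaves a connected graph. -/
def SimpleGraph.ThreeConnected [Fintype V] (G : SimpleGraph V) : Prop :=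
  4 ≤ Fintype.card V ∧ ∀ S : Set V, S.ncard ≤ 2 → (G.induce Sᶜ).Connected

/-- Internally 4-connected: 3-connected, at least five vertices, and no partition
`(A, B, C)` of the vertices with `|A|, |B| ≥ 2`, `|C| = 3` and no edge between `A` and `B`. -/
def SimpleGraph.InternallyFourConnected [Fintype V] (G : SimpleGraph V) : Prop :=
  G.ThreeConnected ∧ 5 ≤ Fintype.card V ∧
    ¬ ∃ A B C : Set V, A ∪ B ∪ C = Set.univ ∧ Disjoint A B ∧ Disjoint A C ∧ Disjoint B C ∧
      2 ≤ A.ncard ∧ 2 ≤ B.ncard ∧ C.ncard = 3 ∧ ∀ x ∈ A, ∀ y ∈ B, ¬ G.Adj x y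

/-- A hex in `G`: a subdivision of `K_{3,3}` with feet `fA 0, fA 1, fA 2` on one side and
`fB 0, fB 1, fB 2` on the other, and nine internally disjoint segments `seg i j`. -/
structure SimpleGraph.Hex (G : SimpleGraph V) where
  fA : Fin 3 → V
  fB : Fin 3 → V
  injA : Function.Injective fA
  injB : Function.Injective fB
  disjAB : ∀ i j, fA i ≠ fB j
  seg : (i j : Fin 3) → G.Walk (fA i) (fB j)
  seg_path : ∀ i j, (seg i j).IsPath
  seg_meet : ∀ i j i' j', (i, j) ≠ (i', j') → ∀ x : V, x ∈ (seg i j).support →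
      x ∈ (seg i' j').support → (x = fA i ∧ i = i') ∨ (x = fB j ∧ j = j')

/-- The number of odd segments of a hex. -/
noncomputable def SimpleGraph.Hex.oddCount {G : SimpleGraph V} (H : G.Hex) : ℕ :=
  (Finset.univ.filter fun p : Fin 3 × Fin 3 => Odd (H.seg p.1 p.2).length).card

/-- A hex is odd if all nine segments have odd length. -/
def SimpleGraph.Hex.IsOdd {G : SimpleGraph V} (H : G.Hex) : Prop :=
  ∀ i j, Odd (H.seg i j).length

/-- A hex is optimal if no hex of `G` has strictly more odd segments. -/
def SimpleGraph.Hex.Optimal {G : SimpleGraph V} (H : G.Hex) : Prop :=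
  ∀ H' : G.Hex, H'.oddCount ≤ H.oddCount

/-- The vertex set of a walk, as a set. -/
def SimpleGraph.Walk.supp {G : SimpleGraph V} {x y : V} (w : G.Walk x y) : Set V :=
  {z | z ∈ w.support}

/-- The vertex set of a hex. -/
def SimpleGraph.Hex.suppSet {G : SimpleGraph V} (H : G.Hex) : Set V :=
  ⋃ (i : Fin 3) (j : Fin 3), (H.seg i j).supp

/-- The edge set of a hex. -/
def SimpleGraph.Hex.edgeSetH {G : SimpleGraph V} (H : G.Hex) : Set (Sym2 V) :=
  ⋃ (i : Fin 3) (j : Fin 3), {e | e ∈ (H.seg i j).edges}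

section VanKampen

/-! ### Continuous logarithms and the van Kampen parity argument -/

open unitInterval

theorem exists_continuous_log {A : Type*} [TopologicalSpace A] [SimplyConnectedSpace A]
    [LocallyPathConnectedSpace A] (f : C(A, ℂ)) (h0 : ∀ a, f a ≠ 0) (a₀ : A) (e₀ : ℂ)
    (he : Complex.exp e₀ = f a₀) :
    ∃! L : C(A, ℂ), L a₀ = e₀ ∧ Complex.exp ∘ L = f :=
  Complex.isCoveringMapOn_exp.existsUnique_continuousMap_lifts f he (fun a => by simpa using h0 a)

theorem simplyConnectedSpace_unitInterval : SimplyConnectedSpace I :=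
  have := (convex_Icc (0 : ℝ) 1).contractibleSpace ⟨0, by simp⟩
  inferInstance

theorem locallyPathConnectedSpace_unitInterval : LocallyPathConnectedSpace I :=
  (convex_Icc (0 : ℝ) 1).locallyPathConnectedSpace

attribute [local instance] simplyConnectedSpace_unitInterval locallyPathConnectedSpace_unitInterval

/-- The total change of a continuous logarithm along a path that avoids `0`. -/
noncomputable def logChange (f : C(I, ℂ)) : ℂ :=
  Classical.epsilon fun w => ∃ L : C(I, ℂ), (∀ t, Complex.exp (L t) = f t) ∧ w = L 1 - L 0

theorem logChange_eq {f L : C(I, ℂ)} (hL : ∀ t, Complex.exp (L t) = f t) :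
    logChange f = L 1 - L 0 := by
  obtain ⟨L', hL', hw⟩ := Classical.epsilon_spec
    (p := fun w => ∃ L : C(I, ℂ), (∀ t, Complex.exp (L t) = f t) ∧ w = L 1 - L 0) ⟨_, L, hL, rfl⟩
  change logChange f = _ at hw
  have h0 : ∀ t, f t ≠ 0 := fun t => by rw [← hL]; exact Complex.exp_ne_zero _
  obtain ⟨M, -, hM⟩ := exists_continuous_log f h0 0 (L 0) (hL 0)
  have h1 := hM L ⟨rfl, funext hL⟩
  have h2 := hM (L' + ContinuousMap.const _ (L 0 - L' 0)) ⟨by simp, funext fun t => by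
    simp [Complex.exp_add, Complex.exp_sub, hL, hL', h0]⟩
  have h3 : L 1 = L' 1 + (L 0 - L' 0) := by
    have := DFunLike.congr_fun (h1.trans h2.symm) 1
    simpa using this
  rw [hw, h3]; ring

theorem exists_log_path (f : C(I, ℂ)) (h0 : ∀ a, f a ≠ 0) :
    ∃ L : C(I, ℂ), ∀ t, Complex.exp (L t) = f t := by
  obtain ⟨L, ⟨-, hL⟩, -⟩ := exists_continuous_log f h0 0 _ (Complex.exp_log (h0 0))
  exact ⟨L, congrFun hL⟩

theorem exp_logChange (f : C(I, ℂ)) (h0 : ∀ a, f a ≠ 0) :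
    Complex.exp (logChange f) = f 1 / f 0 := by
  obtain ⟨L, hL⟩ := exists_log_path f h0
  rw [logChange_eq hL, Complex.exp_sub, hL, hL]

theorem logChange_square (γ δ : C(I, ℂ)) (h : ∀ s t, γ s ≠ δ t) :
    logChange (γ - ContinuousMap.const _ (δ 0)) - logChange (γ - ContinuousMap.const _ (δ 1))
      + logChange (δ - ContinuousMap.const _ (γ 1))
      - logChange (δ - ContinuousMap.const _ (γ 0)) = 0 := by
  let r : ℝ → I := Set.projIcc 0 1 zero_le_one
  have hr : ∀ s : I, r s = s := fun s => Set.projIcc_val _ s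
  have hrc : Continuous r := continuous_projIcc
  have h0 : ∀ a : ℝ × ℝ, (⟨fun a => γ (r a.1) - δ (r a.2), by fun_prop⟩ : C(ℝ × ℝ, ℂ)) a ≠ 0 :=
    fun a => sub_ne_zero.2 (h _ _)
  obtain ⟨L, ⟨-, hL⟩, -⟩ := exists_continuous_log _ h0 (0, 0) _ (Complex.exp_log (h0 (0, 0)))
  have hL' : ∀ s t : I, Complex.exp (L (s, t)) = γ s - δ t := fun s t => by
    simpa [hr] using congrFun hL ((s : ℝ), (t : ℝ))
  have e1 : ∀ t, logChange (γ - ContinuousMap.const _ (δ t)) =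
      L (1, (t : ℝ)) - L (0, (t : ℝ)) := fun t =>
    logChange_eq (L := ⟨fun s : I => L ((s : ℝ), (t : ℝ)), by fun_prop⟩) fun s => by simp [hL']
  have e2 : ∀ s, logChange (δ - ContinuousMap.const _ (γ s)) =
      L ((s : ℝ), 1) - L ((s : ℝ), 0) := fun s => by
    rw [logChange_eq (L := ⟨fun t : I => L ((s : ℝ), (t : ℝ)) + Real.pi * Complex.I, by fun_prop⟩)
      fun t => by simp [hL', Complex.exp_add]]
    simp
  rw [e1, e1, e2, e2]; simp only [Set.Icc.coe_zero, Set.Icc.coe_one]; ring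

/-- Integer turning numbers of pairwise disjoint curves, and the relation between them that
holds for each pair of disjoint curves. -/
theorem exists_turning_numbers {N : ℕ} (z : Fin N → ℂ) (hz : Function.Injective z)
    (E : Fin N → Fin N → Prop) (F : Fin N → Fin N → Set ℂ)
    (hF : ∀ a b, E a b → JoinedIn (F a b) (z a) (z b)) :
    ∃ n : Fin N → Fin N → Fin N → ℤ, ∀ a b c d, E a b → E c d → a ≠ c → a ≠ d → b ≠ c → b ≠ d →
      Disjoint (F a b) (F c d) →
      2 * (n a b c - n a b d + n c d b - n c d a) + (if b < c then 1 else -1)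
        - (if a < c then 1 else -1) - (if b < d then 1 else -1)
        + (if a < d then 1 else -1) = 0 := by
  classical
  have hF' : ∀ a b, ∃ γ : _root_.Path (z a) (z b), E a b → ∀ t, γ t ∈ F a b := fun a b => by
    by_cases h : E a b
    · exact ⟨(hF a b h).somePath, fun _ => (hF a b h).somePath_mem⟩
    · exact ⟨(PathConnectedSpace.joined _ _).somePath, fun h' => (h h').elim⟩
  choose γ hγ using hF'
  have hlog : ∀ p q, p ≠ q → z q - z p ≠ 0 := fun p q h => sub_ne_zero.2 fun e => h (hz e.symm)
  let Lg : Fin N → Fin N → ℂ := fun p q =>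
    if p < q then Complex.log (z q - z p) else Complex.log (z p - z q) + Real.pi * Complex.I
  have hLg : ∀ p q, p ≠ q → Complex.exp (Lg p q) = z q - z p := by
    intro p q h
    simp only [Lg]
    split_ifs
    · exact Complex.exp_log (hlog _ _ h)
    · rw [Complex.exp_add, Complex.exp_log (hlog _ _ h.symm)]; simp
  have hLs : ∀ p q, p ≠ q →
      Lg p q - Lg q p = Real.pi * Complex.I * ((if q < p then 1 else -1 : ℤ) : ℂ) := by
    intro p q h
    rcases lt_or_gt_of_ne h with h' | h'
    · simp [Lg, h', h'.not_gt]
    · simp [Lg, h', h'.not_gt]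
  let C : (a b c : Fin N) → ℂ := fun a b c =>
    logChange ((γ a b : C(I, ℂ)) - ContinuousMap.const _ (z c))
  have key : ∀ a b c, ∃ n : ℤ, a ≠ c → b ≠ c → (∀ t, γ a b t ≠ z c) →
      C a b c = Lg c b - Lg c a + n * (2 * Real.pi * Complex.I) := by
    intro a b c
    by_cases hc : a ≠ c ∧ b ≠ c ∧ ∀ t, γ a b t ≠ z c
    · obtain ⟨h1, h2, h3⟩ := hc
      have := exp_logChange ((γ a b : C(I, ℂ)) - ContinuousMap.const _ (z c))
        (fun t => sub_ne_zero.2 (h3 t))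
      have h4 : Complex.exp (C a b c) = Complex.exp (Lg c b - Lg c a) := by
        rw [Complex.exp_sub, hLg _ _ h1.symm, hLg _ _ h2.symm]
        simpa using this
      obtain ⟨n, hn⟩ := Complex.exp_eq_exp_iff_exists_int.1 h4
      exact ⟨n, fun _ _ _ => hn⟩
    · exact ⟨0, fun h1 h2 h3 => (hc ⟨h1, h2, h3⟩).elim⟩
  choose n hn using key
  refine ⟨n, fun a b c d hab hcd hac had hbc hbd hdis => ?_⟩
  have hne : ∀ s t, γ a b s ≠ γ c d t := fun s t e =>
    Set.disjoint_left.1 hdis (hγ a b hab s) (e ▸ hγ c d hcd t)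
  have sq := logChange_square (γ a b : C(I, ℂ)) (γ c d : C(I, ℂ)) hne
  simp only [ContinuousMap.coe_coe, Path.source, Path.target] at sq
  change C a b c - C a b d + C c d b - C c d a = 0 at sq
  rw [hn a b c hac hbc fun t => by simpa using hne t 0,
    hn a b d had hbd fun t => by simpa using hne t 1,
    hn c d b hbc.symm hbd.symm fun t => by simpa using (hne 1 t).symm,
    hn c d a hac.symm had.symm fun t => by simpa using (hne 0 t).symm] at sq
  have e1 := hLs c b hbc.symm
  have e2 := hLs c a hac.symm
  have e3 := hLs d b hbd.symm
  have e4 := hLs d a had.symm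
  have hpi : (Real.pi * Complex.I : ℂ) ≠ 0 := by simp [Real.pi_ne_zero]
  generalize (if b < c then 1 else -1 : ℤ) = s1 at *
  generalize (if a < c then 1 else -1 : ℤ) = s2 at *
  generalize (if b < d then 1 else -1 : ℤ) = s3 at *
  generalize (if a < d then 1 else -1 : ℤ) = s4 at *
  have : (Real.pi * Complex.I : ℂ) *
      ((2 * (n a b c - n a b d + n c d b - n c d a) + s1 - s2 - s3 + s4 : ℤ) : ℂ) = 0 := by
    push_cast
    linear_combination sq - e1 + e2 + e3 - e4
  exact_mod_cast (mul_eq_zero.1 this).resolve_left hpi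

/-- Five points of the plane cannot be joined pairwise by curves such that curves without
common ends are disjoint. -/
theorem false_of_planar_K5 (z : Fin 5 → ℂ) (hz : Function.Injective z)
    (F : Fin 5 → Fin 5 → Set ℂ) (hF : ∀ a b, a < b → JoinedIn (F a b) (z a) (z b))
    (hd : ∀ a b c d, a < b → c < d → a ≠ c → a ≠ d → b ≠ c → b ≠ d →
      Disjoint (F a b) (F c d)) : False := by
  obtain ⟨n, hn⟩ := exists_turning_numbers z hz (· < ·) F hF
  have key : ∀ a b c d : Fin 5, (a < b ∧ c < d ∧ a ≠ c ∧ a ≠ d ∧ b ≠ c ∧ b ≠ d) → _ :=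
    fun a b c d ⟨h1, h2, h3, h4, h5, h6⟩ =>
      hn a b c d h1 h2 h3 h4 h5 h6 (hd a b c d h1 h2 h3 h4 h5 h6)
  have k1 := key 0 1 2 3 (by decide)
  have k2 := key 0 1 2 4 (by decide)
  have k3 := key 0 1 3 4 (by decide)
  have k4 := key 0 2 1 3 (by decide)
  have k5 := key 0 2 1 4 (by decide)
  have k6 := key 0 2 3 4 (by decide)
  have k7 := key 0 3 1 2 (by decide)
  have k8 := key 0 3 1 4 (by decide)
  have k9 := key 0 3 2 4 (by decide)
  have k10 := key 0 4 1 2 (by decide)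
  have k11 := key 0 4 1 3 (by decide)
  have k12 := key 0 4 2 3 (by decide)
  have k13 := key 1 2 3 4 (by decide)
  have k14 := key 1 3 2 4 (by decide)
  have k15 := key 1 4 2 3 (by decide)
  simp +decide only [if_true, if_false] at k1 k2 k3 k4 k5 k6 k7 k8 k9 k10 k11 k12 k13 k14 k15
  omega

/-- `K_{3,3}` cannot be drawn in the plane such that edges without common ends are disjoint. -/
theorem false_of_planar_K33 (p q : Fin 3 → ℂ) (hp : Function.Injective p)
    (hq : Function.Injective q) (hpq : ∀ i j, p i ≠ q j) (F : Fin 3 → Fin 3 → Set ℂ)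
    (hF : ∀ i j, JoinedIn (F i j) (p i) (q j))
    (hd : ∀ i j i' j', i ≠ i' → j ≠ j' → Disjoint (F i j) (F i' j')) : False := by
  let z : Fin 6 → ℂ := Fin.append p q
  have hz : Function.Injective z := by
    rw [Fin.append_injective_iff]
    exact ⟨hp, hq, hpq⟩
  let r : Fin 6 → Fin 3 := fun a => ⟨a % 3, Nat.mod_lt _ (by norm_num)⟩
  have hr1 : ∀ a : Fin 6, a < 3 → z a = p (r a) := by
    intro a ha; fin_cases a <;> first | rfl | simp at ha
  have hr2 : ∀ a : Fin 6, 3 ≤ a → z a = q (r a) := by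
    intro a ha; fin_cases a <;> first | rfl | simp at ha
  have hr3 : ∀ a b : Fin 6, a < 3 → b < 3 → a ≠ b → r a ≠ r b := by decide
  have hr4 : ∀ a b : Fin 6, 3 ≤ a → 3 ≤ b → a ≠ b → r a ≠ r b := by decide
  obtain ⟨n, hn⟩ := exists_turning_numbers z hz (fun a b => a < 3 ∧ 3 ≤ b)
    (fun a b => F (r a) (r b)) (by
      rintro a b ⟨ha, hb⟩
      rw [hr1 a ha, hr2 b hb]
      exact hF _ _)
  have key : ∀ a b c d : Fin 6, (a < 3 ∧ 3 ≤ b ∧ c < 3 ∧ 3 ≤ d ∧ a ≠ c ∧ b ≠ d) → _ :=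
    fun a b c d ⟨ha, hb, hc, hd', hac, hbd⟩ => hn a b c d ⟨ha, hb⟩ ⟨hc, hd'⟩ hac
      (ha.trans_le hd').ne (hc.trans_le hb).ne' hbd
      (hd _ _ _ _ (hr3 _ _ ha hc hac) (hr4 _ _ hb hd' hbd))
  have k1 := key 0 3 1 4 (by decide)
  have k2 := key 0 3 1 5 (by decide)
  have k3 := key 0 4 1 3 (by decide)
  have k4 := key 0 4 1 5 (by decide)
  have k5 := key 0 5 1 3 (by decide)
  have k6 := key 0 5 1 4 (by decide)
  have k7 := key 0 3 2 4 (by decide)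
  have k8 := key 0 3 2 5 (by decide)
  have k9 := key 0 4 2 3 (by decide)
  have k10 := key 0 4 2 5 (by decide)
  have k11 := key 0 5 2 3 (by decide)
  have k12 := key 0 5 2 4 (by decide)
  have k13 := key 1 3 2 4 (by decide)
  have k14 := key 1 3 2 5 (by decide)
  have k15 := key 1 4 2 3 (by decide)
  have k16 := key 1 4 2 5 (by decide)
  have k17 := key 1 5 2 3 (by decide)
  have k18 := key 1 5 2 4 (by decide)
  simp +decide only [if_true, if_false] at k1 k2 k3 k4 k5 k6 k7 k8 k9
  simp +decide only [if_true, if_false] at k10 k11 k12 k13 k14 k15 k16 k17 k18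
  omega

end VanKampen

/-- `S` spans a (possibly empty) connected subgraph of `G`. -/
def SimpleGraph.ConnOn (G : SimpleGraph V) (S : Set V) : Prop :=
  ∀ T ⊆ S, T.Nonempty → (∀ a ∈ T, ∀ b ∈ S, G.Adj a b → b ∈ T) → S ⊆ T

namespace SimpleGraph

variable {G : SimpleGraph V} {S T U : Set V} {a b c : V}

theorem connOn_singleton (a : V) : G.ConnOn {a} := by
  rintro T hT ⟨b, hb⟩ - c rfl
  obtain rfl : b = c := hT hb
  exact hb

theorem ConnOn.union (hS : G.ConnOn S) (hT : G.ConnOn T) (ha : a ∈ S) (hb : b ∈ T)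
    (hab : a = b ∨ G.Adj a b) : G.ConnOn (S ∪ T) := by
  have key : ∀ {S T : Set V} {a b : V}, G.ConnOn S → G.ConnOn T → a ∈ S → b ∈ T →
      (a = b ∨ G.Adj a b) → ∀ R : Set V, (∀ x ∈ R, ∀ y ∈ S ∪ T, G.Adj x y → y ∈ R) →
      (R ∩ S).Nonempty → S ∪ T ⊆ R := by
    intro S T a b hS hT ha hb hab R hR hne
    have h1 : S ⊆ R ∩ S := hS _ Set.inter_subset_right hne
      fun x hx y hy h => ⟨hR x hx.1 y (Or.inl hy) h, hy⟩
    have hbR : b ∈ R := by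
      rcases hab with rfl | hab
      · exact (h1 ha).1
      · exact hR a (h1 ha).1 b (Or.inr hb) hab
    have h2 : T ⊆ R ∩ T := hT _ Set.inter_subset_right ⟨b, hbR, hb⟩
      fun x hx y hy h => ⟨hR x hx.1 y (Or.inr hy) h, hy⟩
    exact Set.union_subset (fun x hx => (h1 hx).1) fun x hx => (h2 hx).1
  rintro R hRS ⟨x, hx⟩ hR
  rcases hRS hx with h | h
  · exact key hS hT ha hb hab R hR ⟨x, hx, h⟩
  · rw [Set.union_comm] at hR ⊢
    exact key hT hS hb ha (hab.imp Eq.symm fun h => h.symm) R hR ⟨x, hx, h⟩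

theorem connOn_support {u v : V} (w : G.Walk u v) : G.ConnOn {x | x ∈ w.support} := by
  induction w with
  | nil => simpa using connOn_singleton _
  | @cons u v' v h w ih =>
    have := (connOn_singleton u).union ih (a := u) (b := v') rfl (by simp) (Or.inr h)
    convert this using 1
    ext x
    simp

/-- The component of `a` in the subgraph spanned by `S`. -/
def comp (G : SimpleGraph V) (S : Set V) (a : V) : Set V :=
  {b | ∃ w : G.Walk a b, ∀ x ∈ w.support, x ∈ S}

theorem comp_subset : G.comp S a ⊆ S := fun _ ⟨w, hw⟩ => hw _ w.end_mem_support

theorem mem_comp_self (ha : a ∈ S) : a ∈ G.comp S a := ⟨.nil, by simpa using ha⟩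

theorem comp_closed (hb : b ∈ G.comp S a) (hc : c ∈ S) (h : G.Adj b c) : c ∈ G.comp S a := by
  obtain ⟨w, hw⟩ := hb
  refine ⟨w.concat h, fun x hx => ?_⟩
  rw [Walk.support_concat, List.mem_append] at hx
  rcases hx with hx | hx
  · exact hw x hx
  · simp at hx; exact hx ▸ hc

theorem connOn_comp : G.ConnOn (G.comp S a) := by
  rintro T hT ⟨b, hb⟩ hcl c ⟨w, hw⟩
  obtain ⟨wb, hwb⟩ := hT hb
  have key : ∀ {x y : V} (p : G.Walk x y), (∀ z ∈ p.support, z ∈ G.comp S a) → x ∈ T → y ∈ T := by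
    intro x y p hp hx
    induction p with
    | nil => exact hx
    | cons h p ih =>
      exact ih (fun z hz => hp z (by simp [hz])) (hcl _ hx _ (hp _ (by simp)) h)
  have pre : ∀ {d : V} (p : G.Walk a d), (∀ z ∈ p.support, z ∈ S) →
      ∀ z ∈ p.support, z ∈ G.comp S a := by
    classical
    intro d p hp z hz
    exact ⟨p.takeUntil z hz, fun x hx => hp x (p.support_takeUntil_subset_support hz hx)⟩
  have haT : a ∈ T := key wb.reverse (fun z hz => pre wb hwb z (by simpa using hz)) hb
  exact key w (pre w hw) haT

theorem ConnOn.subset_comp (hT : G.ConnOn T) (hTS : T ⊆ S) (ha : a ∈ T) : T ⊆ G.comp S a := by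
  have := hT (T ∩ G.comp S a) Set.inter_subset_left ⟨a, ha, mem_comp_self (hTS ha)⟩
    fun x hx y hy h => ⟨hy, comp_closed hx.2 (hTS hy) h⟩
  exact fun x hx => (this hx).2

theorem ConnOn.exists_path (hS : G.ConnOn S) (ha : a ∈ S) (hb : b ∈ S) :
    ∃ w : G.Walk a b, w.IsPath ∧ ∀ x ∈ w.support, x ∈ S := by
  classical
  obtain ⟨w, hw⟩ := hS.subset_comp subset_rfl ha hb
  exact ⟨w.bypass, w.bypass_isPath, fun x hx => hw x (w.support_bypass_subset_support hx)⟩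

/-- The part of a drawing of `G` that belongs to the vertices in `S`. -/
def region (G : SimpleGraph V) (z : V → ℂ) (R : V → V → Set ℂ) (S : Set V) : Set ℂ :=
  {w | ∃ a ∈ S, ∃ b ∈ S, (a = b ∧ w = z a) ∨ (G.Adj a b ∧ w ∈ R a b)}

theorem ConnOn.joinedIn_region (hS : G.ConnOn S) {z : V → ℂ} {R : V → V → Set ℂ}
    (hR : ∀ a ∈ S, ∀ b ∈ S, G.Adj a b → JoinedIn (R a b) (z a) (z b)) (ha : a ∈ S) (hb : b ∈ S) :
    JoinedIn (G.region z R S) (z a) (z b) := by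
  have := hS {b | b ∈ S ∧ JoinedIn (G.region z R S) (z a) (z b)} (fun x hx => hx.1)
    ⟨a, ha, JoinedIn.refl ⟨a, ha, a, ha, Or.inl ⟨rfl, rfl⟩⟩⟩ (fun x hx y hy h => ⟨hy, hx.2.trans
      ((hR x hx.1 y hy h).mono fun w hw => ⟨x, hx.1, y, hy, Or.inr ⟨h, hw⟩⟩)⟩)
  exact (this hb).2

theorem disjoint_region {z : V → ℂ} {R : V → V → Set ℂ}
    (h1 : ∀ a ∈ S, ∀ b ∈ T, z a ≠ z b)
    (h2 : ∀ a ∈ S, ∀ b ∈ S, ∀ c ∈ T, G.Adj a b → z c ∉ R a b)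
    (h3 : ∀ a ∈ T, ∀ b ∈ T, ∀ c ∈ S, G.Adj a b → z c ∉ R a b)
    (h4 : ∀ a ∈ S, ∀ b ∈ S, ∀ c ∈ T, ∀ d ∈ T, G.Adj a b → G.Adj c d →
      Disjoint (R a b) (R c d)) : Disjoint (G.region z R S) (G.region z R T) := by
  rw [Set.disjoint_left]
  rintro w ⟨a, ha, b, hb, ⟨rfl, rfl⟩ | ⟨hab, hw⟩⟩ ⟨c, hc, d, hd, ⟨rfl, h⟩ | ⟨hcd, hw'⟩⟩
  · exact h1 a ha c hc h
  · exact h3 c hc d hd a ha hcd hw'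
  · exact h2 a ha b hb c hc hab (h ▸ hw)
  · exact Set.disjoint_left.1 (h4 a ha b hb c hc d hd hab hcd) hw hw'

end SimpleGraph

namespace PlanarEmbedding

variable {G : SimpleGraph V} (E : PlanarEmbedding G)

/-- The position of a vertex, as a complex number. -/
noncomputable def pos (v : V) : ℂ := Complex.equivRealProdCLM.symm (E.vmap v)

/-- The curve of an edge, in the complex plane. -/
def curve (a b : V) : Set ℂ :=
  {w | ∃ h : G.Adj a b, w ∈ Complex.equivRealProdCLM.symm '' Set.range (E.arc h)}

theorem pos_injective : Function.Injective E.pos :=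
  Complex.equivRealProdCLM.symm.injective.comp E.vmap_inj

theorem joinedIn_curve {a b : V} (h : G.Adj a b) : JoinedIn (E.curve a b) (E.pos a) (E.pos b) := by
  refine ⟨(E.arc h).map Complex.equivRealProdCLM.symm.continuous, fun t => ⟨h, ?_⟩⟩
  exact ⟨E.arc h t, ⟨t, rfl⟩, rfl⟩

theorem pos_notMem_curve {a b c : V} (ha : c ≠ a) (hb : c ≠ b) : E.pos c ∉ E.curve a b := by
  rintro ⟨h, w, hw, e⟩
  obtain rfl := Complex.equivRealProdCLM.symm.injective e
  exact (E.arc_vertex h c hw).elim ha hb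

theorem disjoint_curve {a b c d : V} (hac : a ≠ c) (had : a ≠ d) (hbc : b ≠ c) (hbd : b ≠ d) :
    Disjoint (E.curve a b) (E.curve c d) := by
  rw [Set.disjoint_left]
  rintro _ ⟨h, w, hw, rfl⟩ ⟨h', w', hw', e⟩
  obtain rfl := Complex.equivRealProdCLM.symm.injective e
  have hne : s(a, b) ≠ s(c, d) := by
    intro e
    rcases Sym2.eq_iff.1 e with ⟨h, -⟩ | ⟨h, -⟩
    exacts [hac h, had h]
  obtain ⟨h1, h2⟩ := E.arc_disjoint h h' hne ⟨hw, hw'⟩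
  rcases h1 with rfl | h1
  · rcases h2 with h2 | h2
    exacts [hac (E.vmap_inj h2), had (E.vmap_inj h2)]
  · rw [Set.mem_singleton_iff] at h1
    subst h1
    rcases h2 with h2 | h2
    exacts [hbc (E.vmap_inj h2), hbd (E.vmap_inj h2)]

theorem disjoint_region {S T : Set V} (h : Disjoint S T) :
    Disjoint (G.region E.pos E.curve S) (G.region E.pos E.curve T) := by
  have hne : ∀ a ∈ S, ∀ b ∈ T, a ≠ b := fun a ha b hb e =>
    Set.disjoint_left.1 h ha (e ▸ hb)
  refine SimpleGraph.disjoint_region (fun a ha b hb e => hne a ha b hb (E.pos_injective e))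
    (fun a ha b hb c hc _ => E.pos_notMem_curve (hne a ha c hc).symm (hne b hb c hc).symm)
    (fun a ha b hb c hc _ => E.pos_notMem_curve (hne c hc a ha) (hne c hc b hb))
    (fun a ha b hb c hc d hd _ _ => E.disjoint_curve (hne a ha c hc) (hne a ha d hd)
      (hne b hb c hc) (hne b hb d hd))

end PlanarEmbedding

namespace SimpleGraph

variable {G : SimpleGraph V}

theorem Hex.not_isPlanar (H : G.Hex) : ¬ G.IsPlanar := by
  rintro ⟨E⟩
  refine false_of_planar_K33 (E.pos ∘ H.fA) (E.pos ∘ H.fB) (E.pos_injective.comp H.injA)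
    (E.pos_injective.comp H.injB) (fun i j e => H.disjAB i j (E.pos_injective e))
    (fun i j => G.region E.pos E.curve {x | x ∈ (H.seg i j).support})
    (fun i j => (connOn_support _).joinedIn_region (fun a _ b _ h => E.joinedIn_curve h)
      (Walk.start_mem_support _) (Walk.end_mem_support _)) ?_
  intro i j i' j' hi hj
  apply E.disjoint_region
  rw [Set.disjoint_left]
  intro x hx hx'
  rcases H.seg_meet i j i' j' (fun e => hi (congrArg Prod.fst e)) x hx hx' with h | h
  exacts [hi h.2, hj h.2]

theorem not_isPlanar_of_iso_top (f : G ≃g (⊤ : SimpleGraph (Fin 5))) : ¬ G.IsPlanar := by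
  rintro ⟨E⟩
  refine false_of_planar_K5 (E.pos ∘ f.symm) (E.pos_injective.comp f.symm.injective)
    (fun i j => E.curve (f.symm i) (f.symm j))
    (fun i j hij => E.joinedIn_curve (f.symm.map_rel_iff.2 hij.ne)) ?_
  intro a b c d _ _ hac had hbc hbd
  exact E.disjoint_curve (f.symm.injective.ne hac) (f.symm.injective.ne had)
    (f.symm.injective.ne hbc) (f.symm.injective.ne hbd)

/-- Three vertices of a connected set are joined to a common vertex by walks that meet nowhere
else. -/
theorem ConnOn.exists_tripod {S : Set V} (hS : G.ConnOn S) (t : Fin 3 → V) (ht : ∀ i, t i ∈ S) :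
    ∃ (m : V) (w : ∀ i, G.Walk m (t i)), (∀ i, ∀ x ∈ (w i).support, x ∈ S) ∧
      ∀ i j, i ≠ j → ∀ x ∈ (w i).support, x ∈ (w j).support → x = m := by
  classical
  obtain ⟨P, hP, hPS⟩ := hS.exists_path (ht 0) (ht 1)
  obtain ⟨Q, -, hQS⟩ := hS.exists_path (ht 2) (ht 0)
  obtain ⟨m, hmP, hmQ, hm⟩ := Q.exists_mem_support_forall_mem_support_imp_eq P.support.toFinset
    ⟨t 0, by simp⟩
  simp only [List.mem_toFinset] at hmP hm
  have h01 : ∀ x ∈ (P.takeUntil m hmP).support, x ∈ (P.dropUntil m hmP).support → x = m := by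
    intro x hx hx'
    by_contra hne
    have hP' : ((P.takeUntil m hmP).append (P.dropUntil m hmP)).IsPath := by
      rw [Walk.take_spec]; exact hP
    exact hP'.ne_of_mem_support_of_append hne hx hx' rfl
  have s0 : ∀ x ∈ (P.takeUntil m hmP).support, x ∈ P.support :=
    fun x hx => P.support_takeUntil_subset_support hmP hx
  have s1 : ∀ x ∈ (P.dropUntil m hmP).support, x ∈ P.support :=
    fun x hx => P.support_dropUntil_subset_support hmP hx
  have s2 : ∀ x ∈ (Q.takeUntil m hmQ).support, x ∈ Q.support :=
    fun x hx => Q.support_takeUntil_subset_support hmQ hx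
  refine ⟨m, Fin.cons (P.takeUntil m hmP).reverse (Fin.cons (P.dropUntil m hmP)
    (Fin.cons (Q.takeUntil m hmQ).reverse (fun i => i.elim0))), ?_, ?_⟩
  · intro i x
    fin_cases i
    · exact fun hx => hPS x (s0 x (by simpa using hx))
    · exact fun hx => hPS x (s1 x (by simpa using hx))
    · intro hx
      replace hx : x ∈ (Q.takeUntil m hmQ).reverse.support := hx
      exact hQS x (s2 x (by simpa using hx))
  · have key : ∀ i j : Fin 3, i < j → i = 0 ∧ j = 1 ∨ i = 0 ∧ j = 2 ∨ i = 1 ∧ j = 2 := by decide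
    intro i j hij x hi hj
    wlog hlt : i < j generalizing i j
    · exact this j i hij.symm hj hi (lt_of_le_of_ne (not_lt.1 hlt) hij.symm)
    rcases key i j hlt with ⟨rfl, rfl⟩ | ⟨rfl, rfl⟩ | ⟨rfl, rfl⟩
    · exact h01 x (by simpa using hi) (by simpa using hj)
    · replace hj : x ∈ (Q.takeUntil m hmQ).reverse.support := hj
      exact hm x (s0 x (by simpa using hi)) (by simpa using hj)
    · replace hj : x ∈ (Q.takeUntil m hmQ).reverse.support := hj
      exact hm x (s1 x (by simpa using hi)) (by simpa using hj)

/-- `G` has a `K_{3,3}` minor whose branch sets are contained in `U`. -/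
def HasK33Minor (G : SimpleGraph V) (U : Set V) : Prop :=
  ∃ A B : Fin 3 → Set V, (∀ i, A i ⊆ U ∧ G.ConnOn (A i)) ∧ (∀ i, B i ⊆ U ∧ G.ConnOn (B i)) ∧
    (∀ i j, i ≠ j → Disjoint (A i) (A j)) ∧ (∀ i j, i ≠ j → Disjoint (B i) (B j)) ∧
    (∀ i j, Disjoint (A i) (B j)) ∧ ∀ i j, ∃ a ∈ A i, ∃ b ∈ B j, G.Adj a b

theorem HasK33Minor.nonempty_hex {U : Set V} (h : G.HasK33Minor U) : Nonempty G.Hex := by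
  classical
  obtain ⟨A, B, hA, hB, hAA, hBB, hAB, hadj⟩ := h
  choose a ha b hb hab using hadj
  choose cA wA hwA hA' using fun i => (hA i).2.exists_tripod (a i) (ha i)
  choose cB wB hwB hB' using fun j => (hB j).2.exists_tripod (fun i => b i j) (fun i => hb i j)
  have hcA : ∀ i, cA i ∈ A i := fun i => hwA i 0 _ (Walk.start_mem_support _)
  have hcB : ∀ i, cB i ∈ B i := fun i => hwB i 0 _ (Walk.start_mem_support _)
  have hdisj : ∀ {S T : Set V} {x : V}, Disjoint S T → x ∈ S → x ∈ T → False :=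
    fun h h1 h2 => Set.disjoint_left.1 h h1 h2
  let W : ∀ i j, G.Walk (cA i) (cB j) := fun i j =>
    (wA i j).append (Walk.cons (hab i j) (wB j i).reverse)
  have hW : ∀ i j x, x ∈ (W i j).bypass.support → x ∈ (wA i j).support ∨ x ∈ (wB j i).support := by
    intro i j x hx
    have := (W i j).support_bypass_subset_support hx
    simp only [W, Walk.mem_support_append_iff, Walk.support_cons, List.mem_cons,
      Walk.support_reverse, List.mem_reverse] at this
    rcases this with h | rfl | h
    exacts [Or.inl h, Or.inl (Walk.end_mem_support _), Or.inr h]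
  refine ⟨⟨cA, cB, ?_, ?_, ?_, fun i j => (W i j).bypass, fun i j => Walk.bypass_isPath _, ?_⟩⟩
  · intro i j e
    by_contra hne
    exact hdisj (hAA i j hne) (hcA i) (e ▸ hcA j)
  · intro i j e
    by_contra hne
    exact hdisj (hBB i j hne) (hcB i) (e ▸ hcB j)
  · intro i j e
    exact hdisj (hAB i j) (hcA i) (e ▸ hcB j)
  · intro i j i' j' hne x hx hx'
    rcases hW i j x hx with h | h <;> rcases hW i' j' x hx' with h' | h'
    · by_cases hi : i = i'
      · subst hi
        exact Or.inl ⟨hA' i j j' (fun e => hne (by rw [e])) x h h', rfl⟩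
      · exact (hdisj (hAA _ _ hi) (hwA _ _ x h) (hwA _ _ x h')).elim
    · exact (hdisj (hAB _ _) (hwA _ _ x h) (hwB _ _ x h')).elim
    · exact (hdisj (hAB _ _) (hwA _ _ x h') (hwB _ _ x h)).elim
    · by_cases hj : j = j'
      · subst hj
        exact Or.inr ⟨hB' j i i' (fun e => hne (by rw [e])) x h h', rfl⟩
      · exact (hdisj (hBB _ _ hj) (hwB _ _ x h) (hwB _ _ x h')).elim

/-- `T` is a proper nonempty part of `R` without edges to the rest of `R`. -/
def Separates (G : SimpleGraph V) (R T : Set V) : Prop :=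
  T ⊆ R ∧ T.Nonempty ∧ (R \ T).Nonempty ∧ ∀ a ∈ T, ∀ b ∈ R, b ∉ T → ¬ G.Adj a b

theorem Separates.compl {R T : Set V} (h : G.Separates R T) : G.Separates R (R \ T) := by
  obtain ⟨h1, h2, h3, h4⟩ := h
  refine ⟨Set.sdiff_subset, h3, ?_, ?_⟩
  · rwa [Set.sdiff_sdiff_cancel_left h1]
  · intro a ha b hb hbT hab
    have : b ∈ T := by
      by_contra hc
      exact hbT ⟨hb, hc⟩
    exact h4 b this a ha.1 ha.2 hab.symm

theorem exists_separates_of_not_connOn {R : Set V} (h : ¬ G.ConnOn R) :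
    ∃ T, G.Separates R T := by
  unfold ConnOn at h
  push Not at h
  obtain ⟨T, hT, hne, hcl, hn⟩ := h
  refine ⟨T, hT, hne, ?_, fun a ha b hb hbT hab => hbT (hcl a ha b hb hab)⟩
  obtain ⟨x, hx, hxT⟩ := Set.not_subset.1 hn
  exact ⟨x, hx, hxT⟩

theorem Separates.not_connOn {R T : Set V} (h : G.Separates R T) : ¬ G.ConnOn R := by
  obtain ⟨h1, h2, ⟨x, hx, hxT⟩, h4⟩ := h
  intro hR
  exact hxT (hR T h1 h2 (fun a ha b hb hab => by_contra fun hbT => h4 a ha b hb hbT hab) hx)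

theorem ConnOn.subset_or_subset_of_separates {R T M : Set V} (hM : G.ConnOn M)
    (h : G.Separates R T) (hMR : M ⊆ R) : M ⊆ T ∨ M ⊆ R \ T := by
  by_cases hne : (M ∩ T).Nonempty
  · left
    have := hM (M ∩ T) Set.inter_subset_left hne fun a ha b hb hab =>
      ⟨hb, by_contra fun hbT => h.2.2.2 a ha.2 b (hMR hb) hbT hab⟩
    exact fun x hx => (this hx).2
  · right
    exact fun x hx => ⟨hMR hx, fun hxT => hne ⟨x, hx, hxT⟩⟩

/-- The subgraph spanned by `U` is 3-connected. -/
def ThreeConnOn (G : SimpleGraph V) (U : Set V) : Prop :=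
  4 ≤ U.ncard ∧ ∀ s t, G.ConnOn (U \ {s, t})

/-- A 3-connected graph with at least five vertices has an edge whose contraction leaves it
3-connected. -/
theorem ThreeConnOn.exists_contractible [Finite V] {U : Set V} (h : G.ThreeConnOn U)
    (hU : 5 ≤ U.ncard) : ∃ x ∈ U, ∃ y ∈ U, G.Adj x y ∧ ∀ z, G.ConnOn (U \ {x, y, z}) := by
  by_contra hcon
  push Not at hcon
  let P : Set V → Prop := fun F => ∃ x ∈ U, ∃ y ∈ U, ∃ z, G.Adj x y ∧ G.Separates (U \ {x, y, z}) F
  have hex : ∃ F, P F := by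
    have hne : ∃ x ∈ U, ∃ y ∈ U, G.Adj x y := by
      by_contra hno
      push Not at hno
      obtain ⟨a, b, c, ha, hb, hc, hab, hac, hbc⟩ := (Set.two_lt_ncard_iff U.toFinite).1 (by omega)
      have := h.2 c c {a} (by simp [ha, hac]) ⟨a, rfl⟩ (by
        rintro _ rfl y hy hay
        exact (hno _ ha y hy.1 hay).elim)
      have hba : b ∈ ({a} : Set V) := this ⟨hb, by simp [hbc]⟩
      exact hab hba.symm
    obtain ⟨x, hx, y, hy, hxy⟩ := hne
    obtain ⟨z, hz⟩ := hcon x hx y hy hxy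
    obtain ⟨F, hF⟩ := exists_separates_of_not_connOn hz
    exact ⟨F, x, hx, y, hy, z, hxy, hF⟩
  obtain ⟨F, ⟨x, hx, y, hy, z, hxy, hF⟩, hmax⟩ :=
    (Set.toFinite {F | P F}).exists_maximalFor Set.ncard _ hex
  replace hmax : ∀ F', P F' → F'.ncard ≤ F.ncard := fun F' hF' => by
    rcases le_total F'.ncard F.ncard with h | h
    exacts [h, hmax hF' h]
  obtain ⟨hF1, ⟨f, hf⟩, ⟨d, hd, hdF⟩, hF4⟩ := id hF
  have hz : z ∈ U ∧ z ≠ x ∧ z ≠ y := by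
    by_contra hc
    apply hF.not_connOn
    convert h.2 x y using 1
    ext w
    simp only [Set.mem_sdiff, Set.mem_insert_iff, Set.mem_singleton_iff]
    grind
  obtain ⟨hzU, hzx, hzy⟩ := hz
  have hu : ∃ u ∈ U \ {x, y, z}, u ∉ F ∧ G.Adj z u := by
    by_contra hno
    push Not at hno
    have hsep : G.Separates (U \ {x, y}) ((U \ {x, y, z}) \ F) := by
      refine ⟨?_, ⟨d, hd, hdF⟩, ⟨z, by simp [hzU, hzx, hzy], by simp⟩, ?_⟩
      · rintro w ⟨⟨hw, hw'⟩, -⟩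
        simp only [Set.mem_insert_iff, Set.mem_singleton_iff] at hw'
        exact ⟨hw, by simp; tauto⟩
      · intro a ha b hb hbn hab
        by_cases hbz : b = z
        · subst hbz
          exact hno a ha.1 ha.2 hab.symm
        · have hbm : b ∈ U \ {x, y, z} := by
            simp only [Set.mem_sdiff, Set.mem_insert_iff, Set.mem_singleton_iff] at hb ⊢
            tauto
          have hbF : b ∈ F := by
            by_contra hc
            exact hbn ⟨hbm, hc⟩
          exact hF4 b hbF a ha.1 ha.2 hab.symm
    exact hsep.not_connOn (h.2 x y)
  obtain ⟨u, huU, huF, hzu⟩ := hu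
  obtain ⟨v, hv⟩ := hcon z hzU u huU.1 hzu
  obtain ⟨T, hT⟩ := exists_separates_of_not_connOn hv
  have hT1 := hmax T ⟨z, hzU, u, huU.1, v, hzu, hT⟩
  have hT2 := hmax _ ⟨z, hzU, u, huU.1, v, hzu, hT.compl⟩
  have hFU : ∀ w ∈ F, w ∈ U ∧ w ≠ x ∧ w ≠ y ∧ w ≠ z := by
    intro w hw
    have := hF1 hw
    simp only [Set.mem_sdiff, Set.mem_insert_iff, Set.mem_singleton_iff] at this
    tauto
  simp only [Set.mem_sdiff, Set.mem_insert_iff, Set.mem_singleton_iff, not_or] at huU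
  set M : Set V := (F ∪ {x, y}) \ {v} with hM
  have hMmem : ∀ w, w ∈ M ↔ (w ∈ F ∨ w = x ∨ w = y) ∧ w ≠ v := by
    intro w; simp [hM]; tauto
  have hMR : M ⊆ U \ {z, u, v} := by
    intro w hw
    rw [hMmem] at hw
    have hwu : w ≠ u := by
      rintro rfl
      tauto
    have hwz : w ∈ U ∧ w ≠ z := by
      rcases hw.1 with h1 | rfl | rfl
      · exact ⟨(hFU w h1).1, (hFU w h1).2.2.2⟩
      · exact ⟨hx, hzx.symm⟩
      · exact ⟨hy, hzy.symm⟩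
    simp only [Set.mem_sdiff, Set.mem_insert_iff, Set.mem_singleton_iff]
    tauto
  have hends : ∀ T₀, G.Separates M T₀ → (x ∈ M → x ∈ T₀) ∧ (y ∈ M → y ∈ T₀) := by
    intro T₀ hT₀
    have hmeet : x ∈ T₀ ∨ y ∈ T₀ := by
      by_contra hno
      push Not at hno
      have hsep : G.Separates (U \ {v, z}) T₀ := by
        refine ⟨?_, hT₀.2.1, ?_, ?_⟩
        · intro w hw
          have h1 := hMR (hT₀.1 hw)
          simp only [Set.mem_sdiff, Set.mem_insert_iff, Set.mem_singleton_iff] at h1 ⊢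
          tauto
        · by_cases hvx : x = v
          · exact ⟨y, by simp [hy, hzy.symm, ← hvx, hxy.ne'], hno.2⟩
          · exact ⟨x, by simp [hx, hzx.symm, hvx], hno.1⟩
        · intro a ha b hb hbT hab
          simp only [Set.mem_sdiff, Set.mem_insert_iff, Set.mem_singleton_iff, not_or] at hb
          have haF : a ∈ F := by
            have := (hMmem a).1 (hT₀.1 ha)
            rcases this.1 with h1 | rfl | rfl
            exacts [h1, (hno.1 ha).elim, (hno.2 ha).elim]
          have hbM : b ∈ M := by
            rw [hMmem]
            refine ⟨?_, hb.2.1⟩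
            by_contra hc
            push Not at hc
            exact hF4 a haF b (by simp [hb, hc]) hc.1 hab
          exact hT₀.2.2.2 a ha b hbM hbT hab
      exact hsep.not_connOn (h.2 v z)
    constructor
    · intro hxM
      rcases hmeet with h1 | h1
      · exact h1
      · by_contra hc
        exact hT₀.2.2.2 y h1 x hxM hc hxy.symm
    · intro hyM
      rcases hmeet with h1 | h1
      · by_contra hc
        exact hT₀.2.2.2 x h1 y hyM hc hxy
      · exact h1
  have hMc : G.ConnOn M := by
    by_contra hc
    obtain ⟨T₀, hT₀⟩ := exists_separates_of_not_connOn hc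
    have h1 := hends T₀ hT₀
    have h2 := hends _ hT₀.compl
    by_cases hvx : x = v
    · have : y ∈ M := by rw [hMmem]; exact ⟨by simp, by rw [← hvx]; exact hxy.ne'⟩
      exact (h2.2 this).2 (h1.2 this)
    · have : x ∈ M := by rw [hMmem]; exact ⟨by simp, hvx⟩
      exact (h2.1 this).2 (h1.1 this)
  have hcard : F.ncard < M.ncard := by
    have e1 : (F ∪ {x, y}).ncard = F.ncard + 2 := by
      rw [Set.ncard_union_eq _ F.toFinite (Set.toFinite _), Set.ncard_pair hxy.ne]
      rw [Set.disjoint_left]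
      rintro w hw (rfl | rfl)
      · exact (hFU _ hw).2.1 rfl
      · exact (hFU _ hw).2.2.1 rfl
    have e2 := Set.pred_ncard_le_ncard_sdiff_singleton (F ∪ {x, y}) v
    rw [← hM] at e2
    omega
  rcases hMc.subset_or_subset_of_separates hT hMR with h1 | h1
  · have := Set.ncard_le_ncard h1 (Set.toFinite _)
    omega
  · have := Set.ncard_le_ncard h1 (Set.toFinite _)
    omega

/-- `f 0, …, f n` are the vertices of a path of `G` from `a` to `c` inside `W`. -/
structure IsPathIn (G : SimpleGraph V) (W : Set V) (a c : V) (f : ℕ → V) (n : ℕ) : Prop where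
  zero : f 0 = a
  last : f n = c
  adj : ∀ i < n, G.Adj (f i) (f (i + 1))
  inj : Set.InjOn f (Set.Iic n)
  mem : ∀ i ≤ n, f i ∈ W

theorem ConnOn.exists_isPathIn {W : Set V} {a c : V} (hW : G.ConnOn W) (ha : a ∈ W) (hc : c ∈ W) :
    ∃ f n, G.IsPathIn W a c f n := by
  obtain ⟨w, hw, hwW⟩ := hW.exists_path ha hc
  exact ⟨w.getVert, w.length, w.getVert_zero, w.getVert_length, fun i hi => w.adj_getVert_succ hi,
    hw.getVert_injOn, fun i _ => hwW _ (w.getVert_mem_support i)⟩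

theorem IsPathIn.connOn_image {W : Set V} {a c : V} {f : ℕ → V} {n : ℕ}
    (h : G.IsPathIn W a c f n) {i j : ℕ} (hij : i ≤ j) (hj : j ≤ n) :
    G.ConnOn (f '' Set.Icc i j) := by
  induction j, hij using Nat.le_induction with
  | base => simpa using connOn_singleton _
  | succ j hij ih =>
    have := (ih (by omega)).union (connOn_singleton (f (j + 1))) (a := f j)
      ⟨j, ⟨hij, le_rfl⟩, rfl⟩ rfl (Or.inr (h.adj j (by omega)))
    convert this using 1
    ext x
    simp only [Set.mem_image, Set.mem_Icc, Set.union_singleton, Set.mem_insert_iff]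
    constructor
    · rintro ⟨k, hk, rfl⟩
      by_cases e : k = j + 1
      · exact Or.inl (by rw [e])
      · exact Or.inr ⟨k, ⟨hk.1, by omega⟩, rfl⟩
    · rintro (rfl | ⟨k, hk, rfl⟩)
      · exact ⟨j + 1, ⟨by omega, le_rfl⟩, rfl⟩
      · exact ⟨k, ⟨hk.1, by omega⟩, rfl⟩

/-- The components of `b` and `d` outside of a path can be enlarged if all neighbours on the path
of the former component precede those of the latter one. -/
theorem IsPathIn.exists_reroute {W : Set V} {a b c d : V} {f : ℕ → V} {n : ℕ}
    (hW : ∀ w, G.ConnOn (W \ {w})) (hb : b ∈ W) (hd : d ∈ W)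
    (h : G.IsPathIn (W \ {b, d}) a c f n) {B D : Set V}
    (hB : B = G.comp (W \ f '' Set.Iic n) b) (hD : D = G.comp (W \ f '' Set.Iic n) d)
    {q : ℕ} (hq0 : 0 < q) (hqn : q < n)
    (hqB : ∃ y ∈ B, G.Adj y (f q)) (hIq : ∀ i ≤ n, (∃ y ∈ B, G.Adj y (f i)) → i ≤ q)
    (hJq : ∀ j ≤ n, (∃ y ∈ D, G.Adj y (f j)) → q ≤ j) :
    ∃ f' n', G.IsPathIn (W \ {b, d}) a c f' n' ∧ B ⊂ G.comp (W \ f' '' Set.Iic n') b ∧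
      D ⊆ G.comp (W \ f' '' Set.Iic n') d := by
  set P := f '' Set.Iic n with hP
  have hfP : ∀ i ≤ n, f i ∈ P := fun i hi => ⟨i, hi, rfl⟩
  have hbP : b ∉ P := by
    rintro ⟨i, hi, e⟩
    have := h.mem i hi
    simp [e] at this
  have hdP : d ∉ P := by
    rintro ⟨i, hi, e⟩
    have := h.mem i hi
    simp [e] at this
  have hbB : b ∈ B := hB ▸ mem_comp_self ⟨hb, hbP⟩
  have hdD : d ∈ D := hD ▸ mem_comp_self ⟨hd, hdP⟩
  have hBsub : B ⊆ W \ P := hB ▸ comp_subset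
  have hDsub : D ⊆ W \ P := hD ▸ comp_subset
  have hinj : ∀ i ≤ n, ∀ j ≤ n, f i = f j → i = j := fun i hi j hj e => h.inj hi hj e
  set R : Set V := {x | x ∈ W ∧ x ∉ B ∧ ∀ i, q ≤ i → i ≤ n → x ≠ f i} with hR
  set E := G.comp R a with hE
  have hER : E ⊆ R := comp_subset
  have hpre : ∀ i < q, f i ∈ E := by
    have hc := h.connOn_image (Nat.zero_le (q - 1)) (by omega)
    have hsub : f '' Set.Icc 0 (q - 1) ⊆ R := by
      rintro _ ⟨i, ⟨-, hi⟩, rfl⟩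
      refine ⟨(h.mem i (by omega)).1, fun hiB => (hBsub hiB).2 (hfP i (by omega)), ?_⟩
      intro j hj hjn e
      have := hinj i (by omega) j hjn e
      omega
    intro i hi
    exact hc.subset_comp hsub ⟨0, by simp, h.zero⟩ ⟨i, by simp; omega, rfl⟩
  have haE : a ∈ E := h.zero ▸ hpre 0 hq0
  obtain ⟨e, heE, k, hqk, hkn, hek⟩ : ∃ e ∈ E, ∃ k, q < k ∧ k ≤ n ∧ G.Adj e (f k) := by
    by_contra hno
    push Not at hno
    have hc := hW (f q) (E ∪ B) ?_ ⟨a, Or.inl haE⟩ ?_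
    · have hcm : c ∈ E ∪ B := hc ⟨h.last ▸ (h.mem n le_rfl).1, by
        simp only [Set.mem_singleton_iff, ← h.last]
        intro e
        have := hinj _ le_rfl _ hqn.le e
        omega⟩
      rcases hcm with hcm | hcm
      · exact (hER hcm).2.2 n hqn.le le_rfl h.last.symm
      · exact (hBsub hcm).2 (h.last ▸ hfP n le_rfl)
    · rintro x (hx | hx)
      · exact ⟨(hER hx).1, (hER hx).2.2 q le_rfl hqn.le⟩
      · exact ⟨(hBsub hx).1, fun e => (hBsub hx).2 (by rw [e]; exact hfP q hqn.le)⟩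
    · rintro x (hx | hx) y ⟨hyW, hyq⟩ hxy
      · by_cases hyB : y ∈ B
        · exact Or.inr hyB
        · refine Or.inl (comp_closed hx ⟨hyW, hyB, ?_⟩ hxy)
          rintro i hqi hin rfl
          rcases hqi.eq_or_lt with rfl | hlt
          · exact hyq rfl
          · exact hno x hx i hlt hin hxy
      · by_cases hyP : y ∈ P
        · obtain ⟨i, hi, rfl⟩ := hyP
          have h1 := hIq i hi ⟨x, hx, hxy⟩
          have h2 : i ≠ q := fun e => hyq (by rw [e]; rfl)
          exact Or.inl (hpre i (by omega))
        · right
          rw [hB] at hx ⊢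
          exact comp_closed hx ⟨hyW, hyP⟩ hxy
  have hED : ∀ x ∈ E, x ∉ D := by
    intro x hxE hxD
    have := connOn_comp (G := G) (S := R) (a := a) (E ∩ D) Set.inter_subset_left ⟨x, hxE, hxD⟩ ?_
    · have haD := (this haE).2
      exact (hDsub haD).2 (h.zero ▸ hfP 0 (Nat.zero_le _))
    · rintro u ⟨huE, huD⟩ v hv huv
      refine ⟨hv, ?_⟩
      by_cases hvP : v ∈ P
      · obtain ⟨i, hi, rfl⟩ := hvP
        exact ((hER hv).2.2 i (hJq i hi ⟨u, huD, huv⟩) hi rfl).elim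
      · rw [hD] at huD ⊢
        exact comp_closed huD ⟨(hER hv).1, hvP⟩ huv
  set S : Set V := E ∪ f '' Set.Icc k n with hS
  have hSc : G.ConnOn S := connOn_comp.union (h.connOn_image hkn le_rfl) heE
    ⟨k, ⟨le_rfl, hkn⟩, rfl⟩ (Or.inr hek)
  obtain ⟨f', n', h'⟩ := hSc.exists_isPathIn (a := a) (c := c) (Or.inl haE)
    (Or.inr ⟨n, ⟨hkn, le_rfl⟩, h.last⟩)
  have hP' : f' '' Set.Iic n' ⊆ S := by
    rintro _ ⟨i, hi, rfl⟩
    exact h'.mem i hi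
  have hSB : ∀ x ∈ S, x ∉ B := by
    rintro x (hx | ⟨i, hi, rfl⟩) hxB
    · exact (hER hx).2.1 hxB
    · exact (hBsub hxB).2 (hfP i hi.2)
  have hSD : ∀ x ∈ S, x ∉ D := by
    rintro x (hx | ⟨i, hi, rfl⟩) hxD
    · exact hED x hx hxD
    · exact (hDsub hxD).2 (hfP i hi.2)
  have hqS : f q ∉ S := by
    rintro (hx | ⟨i, hi, e⟩)
    · exact (hER hx).2.2 q le_rfl hqn.le rfl
    · have := hinj i hi.2 q hqn.le e
      have := hi.1
      omega
  refine ⟨f', n', ⟨h'.zero, h'.last, h'.adj, h'.inj, fun i hi => ?_⟩, ?_, ?_⟩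
  · have hm := h'.mem i hi
    refine ⟨?_, ?_⟩
    · rcases hm with hm | ⟨j, hj, e⟩
      · exact (hER hm).1
      · exact e ▸ (h.mem j hj.2).1
    · rintro (e | e)
      · exact hSB _ hm (e ▸ hbB)
      · exact hSD _ hm (e ▸ hdD)
  · obtain ⟨y, hyB, hyq⟩ := hqB
    have hc : G.ConnOn (B ∪ {f q}) :=
      ConnOn.union (hB ▸ connOn_comp) (connOn_singleton _) hyB rfl (Or.inr hyq)
    have hsub := hc.subset_comp (S := W \ f' '' Set.Iic n') (a := b) ?_ (Or.inl hbB)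
    · refine ⟨fun x hx => hsub (Or.inl hx), fun hx => ?_⟩
      exact (hBsub (hx (hsub (Or.inr rfl)))).2 (hfP q hqn.le)
    · rintro x (hx | rfl)
      · exact ⟨(hBsub hx).1, fun hx' => hSB _ (hP' hx') hx⟩
      · exact ⟨(h.mem q hqn.le).1, fun hx' => hqS (hP' hx')⟩
  · have hc : G.ConnOn D := hD ▸ connOn_comp
    exact hc.subset_comp (fun x hx => ⟨(hDsub hx).1, fun hx' => hSD _ (hP' hx') hx⟩) hdD

/-- In a 2-connected graph, every component outside of a path that is not everything has two
extreme neighbours on the path. -/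
theorem exists_extreme_neighbors {W : Set V} {b d : V} {f : ℕ → V} {n : ℕ}
    (hW : ∀ w, G.ConnOn (W \ {w}))
    (hb : b ∈ W \ f '' Set.Iic n) (hd : d ∈ W \ f '' Set.Iic n)
    {B : Set V} (hB : B = G.comp (W \ f '' Set.Iic n) b) (hdB : d ∉ B) :
    ∃ i j, i < j ∧ j ≤ n ∧ (∃ y ∈ B, G.Adj y (f i)) ∧ (∃ y ∈ B, G.Adj y (f j)) ∧
      ∀ k ≤ n, (∃ y ∈ B, G.Adj y (f k)) → i ≤ k ∧ k ≤ j := by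
  have hbB : b ∈ B := hB ▸ mem_comp_self hb
  have hBsub : B ⊆ W \ f '' Set.Iic n := hB ▸ comp_subset
  have key : ∀ i ≤ n, ∃ j ≤ n, j ≠ i ∧ ∃ y ∈ B, G.Adj y (f j) := by
    intro i hi
    by_contra hno
    push Not at hno
    refine hdB (hW (f i) B (fun x hx => ⟨(hBsub hx).1, ?_⟩) ⟨b, hbB⟩ ?_ ⟨hd.1, ?_⟩)
    · rintro rfl
      exact (hBsub hx).2 ⟨i, hi, rfl⟩
    · rintro x hx y ⟨hyW, hyi⟩ hxy
      by_cases hyP : y ∈ f '' Set.Iic n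
      · obtain ⟨j, hj, rfl⟩ := hyP
        exact (hno j hj (fun e => hyi (by rw [e]; rfl)) x hx hxy).elim
      · rw [hB] at hx ⊢
        exact comp_closed hx ⟨hyW, hyP⟩ hxy
    · rintro rfl
      exact hd.2 ⟨i, hi, rfl⟩
  set I : Set ℕ := {k | k ≤ n ∧ ∃ y ∈ B, G.Adj y (f k)} with hI
  have hfin : I.Finite := (Set.finite_Iic n).subset fun k hk => hk.1
  have hne : I.Nonempty := by
    obtain ⟨j, hj, -, hy⟩ := key 0 (Nat.zero_le _)
    exact ⟨j, hj, hy⟩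
  obtain ⟨i, hi, himin⟩ := Set.exists_min_image I id hfin hne
  obtain ⟨j, hj, hjmax⟩ := Set.exists_max_image I id hfin hne
  obtain ⟨k, hk, hki, hky⟩ := key i hi.1
  have h1 := himin k ⟨hk, hky⟩
  have h2 := hjmax k ⟨hk, hky⟩
  simp only [id] at h1 h2
  exact ⟨i, j, by omega, hj.1, hi.2, hj.2, fun k hk hy => ⟨himin k ⟨hk, hy⟩, hjmax k ⟨hk, hy⟩⟩⟩

/-- In a 2-connected graph in which the pairs `a, c` and `b, d` are not linked, there is a cycle
minor rooted at `a, b, c, d`. -/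
theorem exists_rooted_cycle [Finite V] {W : Set V} {a b c d : V}
    (hW : ∀ w, G.ConnOn (W \ {w})) (ha : a ∈ W) (hb : b ∈ W) (hc : c ∈ W) (hd : d ∈ W)
    (hab : a ≠ b) (had : a ≠ d) (hcb : c ≠ b) (hcd : c ≠ d)
    (hno : ∀ S T : Set V, S ⊆ W → T ⊆ W → G.ConnOn S → G.ConnOn T → a ∈ S → c ∈ S → b ∈ T → d ∈ T →
      ¬ Disjoint S T) :
    ∃ A B C D : Set V, A ⊆ W ∧ B ⊆ W ∧ C ⊆ W ∧ D ⊆ W ∧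
      G.ConnOn A ∧ G.ConnOn B ∧ G.ConnOn C ∧ G.ConnOn D ∧ a ∈ A ∧ b ∈ B ∧ c ∈ C ∧ d ∈ D ∧
      Disjoint A B ∧ Disjoint A C ∧ Disjoint A D ∧ Disjoint B C ∧ Disjoint B D ∧ Disjoint C D ∧
      (∃ x ∈ A, ∃ y ∈ B, G.Adj x y) ∧ (∃ x ∈ B, ∃ y ∈ C, G.Adj x y) ∧
      (∃ x ∈ C, ∃ y ∈ D, G.Adj x y) ∧ (∃ x ∈ D, ∃ y ∈ A, G.Adj x y) := by
  have hbd : b ≠ d := by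
    rintro rfl
    refine hno (W \ {b}) {b} Set.sdiff_subset (by simpa using hb) (hW b) (connOn_singleton b)
      ⟨ha, hab⟩ ⟨hc, hcb⟩ rfl rfl ?_
    exact Set.disjoint_sdiff_left
  have hbd' : ∀ {x}, x ∈ W → x ≠ b → x ≠ d → x ∈ W \ {b, d} := by
    intro x h1 h2 h3
    exact ⟨h1, by simp [h2, h3]⟩
  by_cases hconn : c ∈ G.comp (W \ {b, d}) a
  swap
  · have hdisj : Disjoint (G.comp (W \ {b, d}) a) (G.comp (W \ {b, d}) c) := by
      rw [Set.disjoint_left]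
      rintro x ⟨w, hw⟩ ⟨w', hw'⟩
      refine hconn ⟨w.append w'.reverse, fun y hy => ?_⟩
      rw [Walk.mem_support_append_iff] at hy
      rcases hy with hy | hy
      · exact hw y hy
      · exact hw' y (by simpa using hy)
    have key : ∀ {u v x y : V}, x ∈ W → x ∈ W \ {b, d} → y ∈ W \ {b, d} →
        y ∉ G.comp (W \ {b, d}) x → ({u, v} : Set V) = {b, d} → u ≠ v →
        ∃ z ∈ G.comp (W \ {b, d}) x, G.Adj z u := by
      intro u v x y hx hx' hy hyx huv huv'
      by_contra hcon
      push Not at hcon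
      refine hyx (hW v _ ?_ ⟨x, mem_comp_self hx'⟩ ?_ ⟨hy.1, ?_⟩)
      · intro z hz
        have := comp_subset hz
        rw [← huv] at this
        exact ⟨this.1, fun e => this.2 (Or.inr e)⟩
      · rintro z hz w ⟨hw, hwv⟩ hzw
        refine comp_closed hz ⟨hw, ?_⟩ hzw
        rw [← huv]
        rintro (rfl | e)
        · exact hcon z hz hzw
        · exact hwv e
      · intro e
        have := hy.2
        rw [← huv] at this
        exact this (Or.inr e)
    have hca : a ∉ G.comp (W \ {b, d}) c := fun h =>
      Set.disjoint_left.1 hdisj (mem_comp_self (hbd' ha hab had)) h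
    have ha' := hbd' ha hab had
    have hc' := hbd' hc hcb hcd
    obtain ⟨x1, hx1, e1⟩ := key (u := b) (v := d) ha ha' hc' hconn rfl hbd
    obtain ⟨x2, hx2, e2⟩ := key (u := d) (v := b) ha ha' hc' hconn (Set.pair_comm _ _) hbd.symm
    obtain ⟨x3, hx3, e3⟩ := key (u := b) (v := d) hc hc' ha' hca rfl hbd
    obtain ⟨x4, hx4, e4⟩ := key (u := d) (v := b) hc hc' ha' hca (Set.pair_comm _ _) hbd.symm
    have hsub : ∀ x, G.comp (W \ {b, d}) x ⊆ W := fun x => comp_subset.trans Set.sdiff_subset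
    have hb' : ∀ x, b ∉ G.comp (W \ {b, d}) x := fun x h => (comp_subset h).2 (by simp)
    have hd' : ∀ x, d ∉ G.comp (W \ {b, d}) x := fun x h => (comp_subset h).2 (by simp)
    refine ⟨_, {b}, _, {d}, hsub a, by simpa using hb, hsub c, by simpa using hd, connOn_comp,
      connOn_singleton b, connOn_comp, connOn_singleton d, mem_comp_self ha', rfl,
      mem_comp_self hc', rfl, ?_, hdisj, ?_, ?_, ?_, ?_, ⟨x1, hx1, b, rfl, e1⟩,
      ⟨b, rfl, x3, hx3, e3.symm⟩, ⟨x4, hx4, d, rfl, e4⟩, ⟨d, rfl, x2, hx2, e2.symm⟩⟩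
    · simpa using hb' a
    · simpa using hd' a
    · simpa using hb' c
    · simpa using hbd
    · simpa using hd' c
  · let Q : Set V → Prop := fun P => ∃ f n, G.IsPathIn (W \ {b, d}) a c f n ∧ P = f '' Set.Iic n
    have hQ : ∃ P, Q P := by
      obtain ⟨f, n, h⟩ := (connOn_comp (G := G) (S := W \ {b, d}) (a := a)).exists_isPathIn
        (mem_comp_self (hbd' ha hab had)) hconn
      exact ⟨_, f, n, ⟨h.zero, h.last, h.adj, h.inj, fun i hi => comp_subset (h.mem i hi)⟩, rfl⟩
    obtain ⟨P, ⟨f, n, h, hP⟩, hmax⟩ := (Set.toFinite {P | Q P}).exists_maximalFor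
      (fun P => (G.comp (W \ P) b).ncard + (G.comp (W \ P) d).ncard) _ hQ
    have hfP : ∀ i ≤ n, f i ∈ P := fun i hi => hP ▸ ⟨i, hi, rfl⟩
    have hbP : b ∉ P := by
      rw [hP]
      rintro ⟨i, hi, e⟩
      have := h.mem i hi
      simp [e] at this
    have hdP : d ∉ P := by
      rw [hP]
      rintro ⟨i, hi, e⟩
      have := h.mem i hi
      simp [e] at this
    have hinj : ∀ i ≤ n, ∀ j ≤ n, f i = f j → i = j := fun i hi j hj e => h.inj hi hj e
    have hPc : G.ConnOn P := by
      have := h.connOn_image (Nat.zero_le n) le_rfl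
      rw [hP]
      convert this using 2
      ext; simp
    have hPW : P ⊆ W := by
      rw [hP]
      rintro _ ⟨i, hi, rfl⟩
      exact (h.mem i hi).1
    set B := G.comp (W \ P) b with hB
    set D := G.comp (W \ P) d with hD
    have hBsub : B ⊆ W \ P := comp_subset
    have hDsub : D ⊆ W \ P := comp_subset
    have hbB : b ∈ B := mem_comp_self ⟨hb, hbP⟩
    have hdD : d ∈ D := mem_comp_self ⟨hd, hdP⟩
    have haP : a ∈ P := h.zero ▸ hfP 0 (Nat.zero_le _)
    have hcP : c ∈ P := h.last ▸ hfP n le_rfl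
    have hlink : ∀ X, G.ConnOn X → X ⊆ W \ P → b ∈ X → d ∈ X → False := fun X hX hXs h1 h2 =>
      hno P X hPW (hXs.trans Set.sdiff_subset) hPc hX haP hcP h1 h2
        (Set.disjoint_left.2 fun x hx hx' => (hXs hx').2 hx)
    have hdB : d ∉ B := fun hdB => hlink B connOn_comp hBsub hbB hdB
    have hbD : b ∉ D := fun hbD => hlink D connOn_comp hDsub hbD hdD
    have hBD : Disjoint B D := by
      rw [Set.disjoint_left]
      intro x hxB hxD
      exact hlink (B ∪ D) (connOn_comp.union connOn_comp hxB hxD (Or.inl rfl))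
        (Set.union_subset hBsub hDsub) (Or.inl hbB) (Or.inr hdD)
    obtain ⟨i1, i2, hi, hi2, ⟨y1, hy1, e1⟩, ⟨y2, hy2, e2⟩, hI⟩ :=
      exists_extreme_neighbors hW (hP ▸ ⟨hb, hbP⟩) (hP ▸ ⟨hd, hdP⟩) (hP ▸ hB) hdB
    obtain ⟨j1, j2, hj, hj2, ⟨z1, hz1, g1⟩, ⟨z2, hz2, g2⟩, hJ⟩ :=
      exists_extreme_neighbors hW (hP ▸ ⟨hd, hdP⟩) (hP ▸ ⟨hb, hbP⟩) (hP ▸ hD) hbD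
    have hmax' : ∀ f' n', G.IsPathIn (W \ {b, d}) a c f' n' →
        ¬ (B.ncard + D.ncard < (G.comp (W \ f' '' Set.Iic n') b).ncard +
          (G.comp (W \ f' '' Set.Iic n') d).ncard) := by
      intro f' n' h' hlt
      exact hlt.not_ge (hmax (j := f' '' Set.Iic n') ⟨f', n', h', rfl⟩ hlt.le)
    have c1 : ¬ i2 ≤ j1 := by
      intro hle
      obtain ⟨f', n', h', hB', hD'⟩ := h.exists_reroute hW hb hd (hP ▸ hB) (hP ▸ hD)
        (q := i2) (by omega) (by omega) ⟨y2, hy2, e2⟩ (fun i hi hy => (hI i hi hy).2)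
        (fun j hj hy => hle.trans (hJ j hj hy).1)
      have := Set.ncard_lt_ncard hB' (Set.toFinite _)
      have := Set.ncard_le_ncard hD' (Set.toFinite _)
      exact hmax' f' n' h' (by omega)
    have c2 : ¬ j2 ≤ i1 := by
      intro hle
      obtain ⟨f', n', h', hD', hB'⟩ := (Set.pair_comm b d ▸ h).exists_reroute hW hd hb
        (hP ▸ hD) (hP ▸ hB)
        (q := j2) (by omega) (by omega) ⟨z2, hz2, g2⟩ (fun i hi hy => (hJ i hi hy).2)
        (fun j hj hy => hle.trans (hI j hj hy).1)
      have := Set.ncard_lt_ncard hD' (Set.toFinite _)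
      have := Set.ncard_le_ncard hB' (Set.toFinite _)
      exact hmax' f' n' (Set.pair_comm b d ▸ h') (by omega)
    obtain ⟨m, hm1, hm2, hm3, hm4⟩ : ∃ m, i1 ≤ m ∧ j1 ≤ m ∧ m < i2 ∧ m < j2 :=
      ⟨max i1 j1, by omega, by omega, by omega, by omega⟩
    have hAP : f '' Set.Icc 0 m ⊆ P := by
      rintro _ ⟨i, hi, rfl⟩
      exact hfP i (hi.2.trans (by omega))
    have hCP : f '' Set.Icc (m + 1) n ⊆ P := by
      rintro _ ⟨i, hi, rfl⟩
      exact hfP i hi.2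
    have hd1 : ∀ {X Y : Set V}, X ⊆ P → Y ⊆ W \ P → Disjoint X Y := fun h1 h2 =>
      Set.disjoint_left.2 fun x hx hx' => (h2 hx').2 (h1 hx)
    refine ⟨f '' Set.Icc 0 m, B, f '' Set.Icc (m + 1) n, D, hAP.trans hPW,
      hBsub.trans Set.sdiff_subset, hCP.trans hPW, hDsub.trans Set.sdiff_subset,
      h.connOn_image (Nat.zero_le _) (by omega), connOn_comp, h.connOn_image (by omega) le_rfl,
      connOn_comp, ⟨0, by simp, h.zero⟩, hbB, ⟨n, by simp; omega, h.last⟩, hdD,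
      hd1 hAP hBsub, ?_, hd1 hAP hDsub, (hd1 hCP hBsub).symm, hBD, hd1 hCP hDsub,
      ⟨f i1, ⟨i1, by simp; omega, rfl⟩, y1, hy1, e1.symm⟩,
      ⟨y2, hy2, f i2, ⟨i2, by simp; omega, rfl⟩, e2⟩,
      ⟨f j2, ⟨j2, by simp; omega, rfl⟩, z2, hz2, g2.symm⟩,
      ⟨z1, hz1, f j1, ⟨j1, by simp; omega, rfl⟩, g1⟩⟩
    rw [Set.disjoint_left]
    rintro _ ⟨i, hi, rfl⟩ ⟨j, hj, e⟩
    have hi' := hi.2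
    have hj' := hj.1
    have := hinj j hj.2 i (by omega) e
    omega

end SimpleGraph

theorem mem_segment_or_mem_segment {E : Type*} [AddCommGroup E] [Module ℝ E] {a b c z : E}
    (hb : z ∈ segment ℝ a b) (hc : z ∈ segment ℝ a c) (hz : z ≠ a) :
    b ∈ segment ℝ a c ∨ c ∈ segment ℝ a b := by
  rw [segment_eq_image'] at *
  obtain ⟨s, ⟨hs0, hs1⟩, hs⟩ := hb
  obtain ⟨t, ⟨ht0, ht1⟩, ht⟩ := hc
  simp only at hs ht
  have hs' : s ≠ 0 := by
    rintro rfl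
    exact hz (by simpa using hs.symm)
  have ht' : t ≠ 0 := by
    rintro rfl
    exact hz (by simpa using ht.symm)
  have e : s • (b - a) = t • (c - a) := add_left_cancel (hs.trans ht.symm)
  rw [segment_eq_image']
  rcases le_total t s with h | h
  · left
    refine ⟨t / s, ⟨by positivity, div_le_one_of_le₀ h hs0⟩, ?_⟩
    have : b - a = (t / s) • (c - a) := by
      rw [div_eq_inv_mul, mul_smul, ← e, smul_smul, inv_mul_cancel₀ hs', one_smul]
    simp only [← this]
    abel
  · right
    refine ⟨s / t, ⟨by positivity, div_le_one_of_le₀ h ht0⟩, ?_⟩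
    have : c - a = (s / t) • (b - a) := by
      rw [div_eq_inv_mul, mul_smul, e, smul_smul, inv_mul_cancel₀ ht', one_smul]
    simp only [← this]
    abel

namespace SimpleGraph

variable {G : SimpleGraph V}

/-- `p` is a drawing with straight edges of the subgraph spanned by `U`. -/
structure StraightDrawing (G : SimpleGraph V) (U : Set V) (p : V → ℂ) : Prop where
  inj : Set.InjOn p U
  vertex : ∀ a ∈ U, ∀ b ∈ U, ∀ c ∈ U, G.Adj a b → c ≠ a → c ≠ b → p c ∉ segment ℝ (p a) (p b)
  edge : ∀ a ∈ U, ∀ b ∈ U, ∀ c ∈ U, ∀ d ∈ U, G.Adj a b → G.Adj c d → a ≠ c → a ≠ d → b ≠ c →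
    b ≠ d → Disjoint (segment ℝ (p a) (p b)) (segment ℝ (p c) (p d))

theorem StraightDrawing.inter_subset {U : Set V} {p : V → ℂ} (h : G.StraightDrawing U p)
    {a b c : V} (ha : a ∈ U) (hb : b ∈ U) (hc : c ∈ U) (hab : G.Adj a b) (hac : G.Adj a c)
    (hbc : b ≠ c) {z : ℂ} (hz : z ∈ segment ℝ (p a) (p b)) (hz' : z ∈ segment ℝ (p a) (p c)) :
    z = p a := by
  by_contra hne
  rcases mem_segment_or_mem_segment hz hz' hne with h1 | h1
  · exact h.vertex a ha c hc b hb hac hab.ne' hbc h1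
  · exact h.vertex a ha b hb c hc hab hac.ne' hbc.symm h1

theorem StraightDrawing.isPlanar {p : V → ℂ} (h : G.StraightDrawing Set.univ p) :
    G.IsPlanar := by
  let e := Complex.equivRealProdCLM
  have hrange : ∀ x y : V, Set.range (_root_.Path.segment (e (p x)) (e (p y))) =
      e '' segment ℝ (p x) (p y) := by
    intro x y
    rw [_root_.Path.range_segment]
    exact (image_segment ℝ (e : ℂ →L[ℝ] ℝ × ℝ).toLinearMap.toAffineMap (p x) (p y)).symm
  refine ⟨⟨fun v => e (p v), fun x y hxy => h.inj trivial trivial (e.injective hxy),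
    fun x y _ => _root_.Path.segment _ _, ?_, ?_, ?_, ?_⟩⟩
  · intro x y hxy
    exact _root_.Path.segment_injective_of_ne fun h' =>
      hxy.ne (h.inj trivial trivial (e.injective h'))
  · intro x y hxy
    rw [hrange, hrange, segment_symm]
  · intro x y hxy w hw
    rw [hrange] at hw
    obtain ⟨z, hz, hze⟩ := hw
    obtain rfl := e.injective hze
    by_contra hc
    push Not at hc
    exact h.vertex x trivial y trivial w trivial hxy hc.1 hc.2 hz
  · intro x y x' y' hxy hxy' hne z hz
    rw [hrange, hrange] at hz
    obtain ⟨⟨z, hz, rfl⟩, z', hz', hze⟩ := hz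
    obtain rfl := e.injective hze
    by_cases h1 : x = x'
    · subst h1
      have hyy : y ≠ y' := fun e => hne (by rw [e])
      rw [h.inter_subset trivial trivial trivial hxy hxy' hyy hz hz']
      simp
    by_cases h2 : x = y'
    · subst h2
      have hyy : y ≠ x' := fun e => hne (by rw [e, Sym2.eq_swap])
      rw [segment_symm] at hz'
      rw [h.inter_subset trivial trivial trivial hxy hxy'.symm hyy hz hz']
      simp
    by_cases h3 : y = x'
    · subst h3
      rw [segment_symm] at hz
      rw [h.inter_subset trivial trivial trivial hxy.symm hxy' h2 hz hz']
      simp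
    by_cases h4 : y = y'
    · subst h4
      rw [segment_symm] at hz hz'
      rw [h.inter_subset trivial trivial trivial hxy.symm hxy'.symm h1 hz hz']
      simp
    exact (Set.disjoint_left.1 (h.edge x trivial y trivial x' trivial y' trivial hxy hxy'
      h1 h2 h3 h4) hz hz').elim

end SimpleGraph

/-- The open sector with apex `v` between the angles `α` and `β`. -/
def angularSector (v : ℂ) (α β : ℝ) : Set ℂ :=
  (fun x => v + Complex.exp x) '' {x | α ≤ x.im ∧ x.im ≤ β}

theorem joinedIn_angularSector {v : ℂ} {α β : ℝ} {x y : ℂ} (hx : x.im ∈ Set.Icc α β)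
    (hy : y.im ∈ Set.Icc α β) :
    JoinedIn (angularSector v α β) (v + Complex.exp x) (v + Complex.exp y) := by
  have hconv : Convex ℝ {x : ℂ | α ≤ x.im ∧ x.im ≤ β} :=
    (convex_halfSpace_im_ge α).inter (convex_halfSpace_im_le β)
  have h := (hconv.isPathConnected ⟨x, hx⟩).image (f := fun x => v + Complex.exp x) (by fun_prop)
  exact h.joinedIn _ ⟨x, hx, rfl⟩ _ ⟨y, hy, rfl⟩

theorem disjoint_angularSector {v : ℂ} {α β γ δ : ℝ} (h1 : β < γ) (h2 : δ < α + 2 * Real.pi) :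
    Disjoint (angularSector v α β) (angularSector v γ δ) := by
  rw [Set.disjoint_left]
  rintro _ ⟨x, ⟨hx1, hx2⟩, rfl⟩ ⟨y, ⟨hy1, hy2⟩, e⟩
  obtain ⟨n, hn⟩ := Complex.exp_eq_exp_iff_exists_int.1 (add_left_cancel e)
  have him : y.im = x.im + n * (2 * Real.pi) := by
    rw [hn]; simp
  have hpi := Real.pi_pos
  have p1 : (0 : ℝ) < n := by
    by_contra hc
    push Not at hc
    nlinarith
  have p2 : (n : ℝ) < 1 := by
    by_contra hc
    push Not at hc
    nlinarith
  norm_cast at p1 p2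
  omega

theorem segment_subset_insert_angularSector {v c : ℂ} (hc : c ≠ v) :
    segment ℝ v c ⊆ insert v (angularSector v (c - v).arg (c - v).arg) := by
  rw [segment_eq_image']
  rintro _ ⟨t, ⟨ht0, ht1⟩, rfl⟩
  rcases ht0.eq_or_lt with rfl | ht
  · simp
  · right
    refine ⟨(Real.log t : ℝ) + Complex.log (c - v), ?_, ?_⟩
    · simp [Complex.log_im]
    · simp only [Complex.exp_add, Complex.exp_log (sub_ne_zero.2 hc), ← Complex.ofReal_exp,
        Real.exp_log ht]
      simp

theorem disjoint_segment_angularSector {v c : ℂ} (hc : c ≠ v) {α β : ℝ}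
    (h : Disjoint (angularSector v (c - v).arg (c - v).arg) (angularSector v α β)) :
    Disjoint (segment ℝ v c) (angularSector v α β) := by
  refine Set.disjoint_of_subset_left (segment_subset_insert_angularSector hc) ?_
  rw [Set.disjoint_insert_left]
  refine ⟨?_, h⟩
  rintro ⟨x, -, hx⟩
  simp at hx

namespace SimpleGraph

variable {G : SimpleGraph V}

theorem StraightDrawing.disjoint_region {U S T : Set V} {p : V → ℂ} (h : G.StraightDrawing U p)
    (hS : S ⊆ U) (hT : T ⊆ U) (hST : Disjoint S T) :
    Disjoint (G.region p (fun a b => segment ℝ (p a) (p b)) S)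
      (G.region p (fun a b => segment ℝ (p a) (p b)) T) := by
  have hne : ∀ a ∈ S, ∀ b ∈ T, a ≠ b := fun a ha b hb e =>
    Set.disjoint_left.1 hST ha (e ▸ hb)
  refine SimpleGraph.disjoint_region
    (fun a ha b hb e => hne a ha b hb (h.inj (hS ha) (hT hb) e))
    (fun a ha b hb c hc hab => h.vertex a (hS ha) b (hS hb) c (hT hc) hab (hne a ha c hc).symm
      (hne b hb c hc).symm)
    (fun a ha b hb c hc hab => h.vertex a (hT ha) b (hT hb) c (hS hc) hab (hne c hc a ha)
      (hne c hc b hb))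
    (fun a ha b hb c hc d hd hab hcd => h.edge a (hS ha) b (hS hb) c (hT hc) d (hT hd) hab hcd
      (hne a ha c hc) (hne a ha d hd) (hne b hb c hc) (hne b hb d hd))

/-- Alternating neighbours of a vertex of a plane graph are not linked outside of that vertex. -/
theorem StraightDrawing.not_linked {U S T : Set V} {p : V → ℂ} (h : G.StraightDrawing U p)
    {v a b c d : V} (hv : v ∈ U) (hS : S ⊆ U) (hT : T ⊆ U) (hST : Disjoint S T) (hvS : v ∉ S)
    (hvT : v ∉ T) (hSc : G.ConnOn S) (hTc : G.ConnOn T) (ha : a ∈ S) (hb : b ∈ T) (hc : c ∈ S)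
    (hd : d ∈ T) (hva : G.Adj v a) (hvb : G.Adj v b) (hvc : G.Adj v c) (hvd : G.Adj v d)
    (hab : (p a - p v).arg < (p b - p v).arg) (hbc : (p b - p v).arg < (p c - p v).arg)
    (hcd : (p c - p v).arg < (p d - p v).arg) : False := by
  have hne : ∀ {w}, w ∈ U → G.Adj v w → p w ≠ p v := fun hw hvw e => hvw.ne' (h.inj hw hv e)
  have na := hne (hS ha) hva
  have nb := hne (hT hb) hvb
  have nc := hne (hS hc) hvc
  have nd := hne (hT hd) hvd
  have hpi := Real.pi_pos
  have hα := Complex.neg_pi_lt_arg (p a - p v)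
  have hδ := Complex.arg_le_pi (p d - p v)
  have hexp : ∀ {w}, p w ≠ p v → p w = p v + Complex.exp (Complex.log (p w - p v)) := by
    intro w hw
    rw [Complex.exp_log (sub_ne_zero.2 hw)]
    ring
  have hexp' : p a = p v + Complex.exp (Complex.log (p a - p v) + 2 * Real.pi * Complex.I) := by
    rw [Complex.exp_add, Complex.exp_two_pi_mul_I, mul_one]
    exact hexp na
  have him : ∀ w, (Complex.log (p w - p v)).im = (p w - p v).arg := fun w => Complex.log_im _
  generalize hα' : (p a - p v).arg = α at *
  generalize hβ' : (p b - p v).arg = β at *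
  generalize hγ' : (p c - p v).arg = γ at *
  generalize hδ' : (p d - p v).arg = δ at *
  let R : V → V → Set ℂ := fun a b => segment ℝ (p a) (p b)
  have hRj : ∀ a b, JoinedIn (R a b) (p a) (p b) := fun a b =>
    JoinedIn.of_segment_subset subset_rfl
  have hspoke : ∀ {w}, G.Adj v w → R v w ⊆ G.region p R {v, w} := fun hvw z hz =>
    ⟨v, by simp, _, by simp, Or.inr ⟨hvw, hz⟩⟩
  have hspS : ∀ {w}, w ∈ T → G.Adj v w → Disjoint (R v w) (G.region p R S) := fun {w} hw hvw =>
    Set.disjoint_of_subset_left (hspoke hvw) (h.disjoint_region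
      (by rintro _ (rfl | rfl); exacts [hv, hT hw]) hS (by
        rw [Set.disjoint_left]
        rintro _ (rfl | rfl) hx
        exacts [hvS hx, Set.disjoint_left.1 hST hx hw]))
  have hspT : ∀ {w}, w ∈ S → G.Adj v w → Disjoint (R v w) (G.region p R T) := fun {w} hw hvw =>
    Set.disjoint_of_subset_left (hspoke hvw) (h.disjoint_region
      (by rintro _ (rfl | rfl); exacts [hv, hS hw]) hT (by
        rw [Set.disjoint_left]
        rintro _ (rfl | rfl) hx
        exacts [hvT hx, Set.disjoint_left.1 hST hw hx]))
  have hST' := h.disjoint_region hS hT hST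
  have hseg : ∀ {w} {θ φ ψ : ℝ}, p w ≠ p v → (p w - p v).arg = θ →
      Disjoint (angularSector (p v) θ θ) (angularSector (p v) φ ψ) →
      Disjoint (R v w) (angularSector (p v) φ ψ) := by
    rintro w θ φ ψ hw rfl hd
    exact disjoint_segment_angularSector hw hd
  let F : Fin 5 → Fin 5 → Set ℂ :=
    ![![∅, R v a, R v b, R v c, R v d],
      ![∅, ∅, angularSector (p v) α β, G.region p R S, angularSector (p v) δ (α + 2 * Real.pi)],
      ![∅, ∅, ∅, angularSector (p v) β γ, G.region p R T],
      ![∅, ∅, ∅, ∅, angularSector (p v) γ δ],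
      ![∅, ∅, ∅, ∅, ∅]]
  have hlt : ∀ i j : Fin 5, i < j → i = 0 ∧ j = 1 ∨ i = 0 ∧ j = 2 ∨ i = 0 ∧ j = 3 ∨ i = 0 ∧ j = 4 ∨
      i = 1 ∧ j = 2 ∨ i = 1 ∧ j = 3 ∨ i = 1 ∧ j = 4 ∨ i = 2 ∧ j = 3 ∨ i = 2 ∧ j = 4 ∨
      i = 3 ∧ j = 4 := by decide
  have hpairs : ∀ i j k l : Fin 5, i < j → k < l → i < k → j ≠ k → j ≠ l →
      (i, j, k, l) ∈ ([(0, 1, 2, 3), (0, 1, 2, 4), (0, 1, 3, 4), (0, 2, 1, 3), (0, 2, 1, 4),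
        (0, 2, 3, 4), (0, 3, 1, 2), (0, 3, 1, 4), (0, 3, 2, 4), (0, 4, 1, 2), (0, 4, 1, 3),
        (0, 4, 2, 3), (1, 2, 3, 4), (1, 3, 2, 4), (1, 4, 2, 3)] :
        List (Fin 5 × Fin 5 × Fin 5 × Fin 5)) := by decide
  refine false_of_planar_K5 ![p v, p a, p b, p c, p d] ?_ F ?_ ?_
  · have nn : ∀ {x y}, (p x - p v).arg ≠ (p y - p v).arg → p x ≠ p y := fun h e => h (by rw [e])
    have nab : p a ≠ p b := nn (by rw [hα', hβ']; exact hab.ne)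
    have nac : p a ≠ p c := nn (by rw [hα', hγ']; linarith)
    have nad : p a ≠ p d := nn (by rw [hα', hδ']; linarith)
    have nbc : p b ≠ p c := nn (by rw [hβ', hγ']; linarith)
    have nbd : p b ≠ p d := nn (by rw [hβ', hδ']; linarith)
    have ncd : p c ≠ p d := nn (by rw [hγ', hδ']; linarith)
    intro i j hij
    by_contra hne'
    wlog hij' : i < j generalizing i j
    · exact this hij.symm (Ne.symm hne') (lt_of_le_of_ne (not_lt.1 hij') (Ne.symm hne'))
    rcases hlt i j hij' with ⟨rfl, rfl⟩ | ⟨rfl, rfl⟩ | ⟨rfl, rfl⟩ | ⟨rfl, rfl⟩ | ⟨rfl, rfl⟩ |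
      ⟨rfl, rfl⟩ | ⟨rfl, rfl⟩ | ⟨rfl, rfl⟩ | ⟨rfl, rfl⟩ | ⟨rfl, rfl⟩
    exacts [na hij.symm, nb hij.symm, nc hij.symm, nd hij.symm, nab hij, nac hij, nad hij, nbc hij,
      nbd hij, ncd hij]
  · have hsec : ∀ {x y : V} {θ φ : ℝ}, p x ≠ p v → p y ≠ p v → (p x - p v).arg = θ →
        (p y - p v).arg = φ → θ < φ → JoinedIn (angularSector (p v) θ φ) (p x) (p y) := by
      intro x y θ φ hx hy hθ hφ hlt
      rw [hexp hx, hexp hy]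
      exact joinedIn_angularSector (by rw [him, hθ]; exact ⟨le_rfl, hlt.le⟩)
        (by rw [him, hφ]; exact ⟨hlt.le, le_rfl⟩)
    intro i j hij
    rcases hlt i j hij with ⟨rfl, rfl⟩ | ⟨rfl, rfl⟩ | ⟨rfl, rfl⟩ | ⟨rfl, rfl⟩ | ⟨rfl, rfl⟩ |
      ⟨rfl, rfl⟩ | ⟨rfl, rfl⟩ | ⟨rfl, rfl⟩ | ⟨rfl, rfl⟩ | ⟨rfl, rfl⟩
    · exact hRj v a
    · exact hRj v b
    · exact hRj v c
    · exact hRj v d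
    · exact hsec na nb hα' hβ' hab
    · exact hSc.joinedIn_region (fun a _ b _ _ => hRj a b) ha hc
    · change JoinedIn (angularSector (p v) δ (α + 2 * Real.pi)) (p a) (p d)
      rw [hexp', hexp nd]
      refine joinedIn_angularSector ?_ ?_
      · have e : (Complex.log (p a - p v) + 2 * Real.pi * Complex.I).im = α + 2 * Real.pi := by
          simp [him, hα']
        rw [e]
        exact ⟨by linarith, le_rfl⟩
      · rw [him, hδ']
        exact ⟨le_rfl, by linarith⟩
    · exact hsec nb nc hβ' hγ' hbc
    · exact hTc.joinedIn_region (fun a _ b _ _ => hRj a b) hb hd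
    · exact hsec nc nd hγ' hδ' hcd
  · intro i j k l hij hkl hik hil hjk hjl
    wlog hik' : i < k generalizing i j k l
    · exact (this k l i j hkl hij hik.symm hjk.symm hil.symm hjl.symm
        (lt_of_le_of_ne (not_lt.1 hik') hik.symm)).symm
    have hmem := hpairs i j k l hij hkl hik' hjk hjl
    simp only [List.mem_cons, Prod.mk.injEq, List.not_mem_nil, or_false] at hmem
    rcases hmem with ⟨rfl, rfl, rfl, rfl⟩ | ⟨rfl, rfl, rfl, rfl⟩ | ⟨rfl, rfl, rfl, rfl⟩ |
      ⟨rfl, rfl, rfl, rfl⟩ | ⟨rfl, rfl, rfl, rfl⟩ | ⟨rfl, rfl, rfl, rfl⟩ | ⟨rfl, rfl, rfl, rfl⟩ |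
      ⟨rfl, rfl, rfl, rfl⟩ | ⟨rfl, rfl, rfl, rfl⟩ | ⟨rfl, rfl, rfl, rfl⟩ | ⟨rfl, rfl, rfl, rfl⟩ |
      ⟨rfl, rfl, rfl, rfl⟩ | ⟨rfl, rfl, rfl, rfl⟩ | ⟨rfl, rfl, rfl, rfl⟩ | ⟨rfl, rfl, rfl, rfl⟩
    · exact hseg na hα' (disjoint_angularSector (by linarith) (by linarith))
    · exact hspT ha hva
    · exact hseg na hα' (disjoint_angularSector (by linarith) (by linarith))
    · exact hspS hb hvb
    · exact hseg nb hβ' (disjoint_angularSector (by linarith) (by linarith))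
    · exact hseg nb hβ' (disjoint_angularSector (by linarith) (by linarith))
    · exact hseg nc hγ' (disjoint_angularSector (by linarith) (by linarith)).symm
    · exact hseg nc hγ' (disjoint_angularSector (by linarith) (by linarith))
    · exact hspT hc hvc
    · exact hseg nd hδ' (disjoint_angularSector (by linarith) (by linarith)).symm
    · exact hspS hd hvd
    · exact hseg nd hδ' (disjoint_angularSector (by linarith) (by linarith)).symm
    · exact disjoint_angularSector (by linarith) (by linarith)
    · exact hST'
    · exact (disjoint_angularSector (by linarith) (by linarith)).symm

end SimpleGraph

section Geometry

variable {E : Type*} [NormedAddCommGroup E] [InnerProductSpace ℝ E]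

open Topology in
theorem eventually_disjoint_segment {x q u : E} {K : Set E} (hK : IsClosed K)
    (h : Disjoint (segment ℝ x q) K) :
    ∀ᶠ ε : ℝ in 𝓝 0, Disjoint (segment ℝ (x + ε • u) q) K := by
  have hc : Continuous fun z : ℝ × ℝ => (x + z.1 • u) + z.2 • (q - (x + z.1 • u)) := by fun_prop
  have key : ∀ᶠ ε : ℝ in 𝓝 0, ∀ s ∈ Set.Icc (0 : ℝ) 1,
      (x + ε • u) + s • (q - (x + ε • u)) ∉ K := by
    refine isCompact_Icc.eventually_forall_of_forall_eventually fun s hs => ?_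
    refine hc.continuousAt.eventually (hK.isOpen_compl.mem_nhds ?_)
    rw [segment_eq_image'] at h
    exact Set.disjoint_left.1 h ⟨s, hs, by simp⟩
  filter_upwards [key] with ε hε
  rw [segment_eq_image', Set.disjoint_left]
  rintro _ ⟨s, hs, rfl⟩
  exact hε s hs

theorem lt_inner_of_mem_segment {x u w z : E} {k ε : ℝ} (hu : ‖u‖ = 1) (hk : -1 < k) (hk' : k < 1)
    (hε : 0 < ε) (hw : k * ‖w - x‖ ≤ inner ℝ u (w - x)) (hz : z ∈ segment ℝ (x + ε • u) w)
    (hzw : z ≠ w) : k * ‖z - x‖ < inner ℝ u (z - x) := by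
  obtain ⟨r, s, hr, hs, hrs, rfl⟩ := hz
  have hr' : 0 < r := by
    rcases hr.eq_or_lt with rfl | h
    · exact (hzw (by simp [show s = 1 by linarith])).elim
    · exact h
  have e : r • (x + ε • u) + s • w - x = (r * ε) • u + s • (w - x) := by
    obtain rfl : s = 1 - r := by linarith
    module
  rw [e, inner_add_right, inner_smul_right, inner_smul_right, real_inner_self_eq_norm_sq, hu]
  have h1 : ‖(r * ε) • u‖ = r * ε := by
    rw [norm_smul, hu, Real.norm_of_nonneg (by positivity)]; ring
  have h2 : ‖s • (w - x)‖ = s * ‖w - x‖ := by rw [norm_smul, Real.norm_of_nonneg hs]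
  have hpos : 0 < r * ε := by positivity
  have h3 := mul_le_mul_of_nonneg_left hw hs
  rcases le_total 0 k with h0 | h0
  · have := norm_add_le ((r * ε) • u) (s • (w - x))
    rw [h1, h2] at this
    nlinarith [mul_le_mul_of_nonneg_left this h0]
  · have : s * ‖w - x‖ - r * ε ≤ ‖(r * ε) • u + s • (w - x)‖ := by
      have h4 := norm_sub_le ((r * ε) • u + s • (w - x)) ((r * ε) • u)
      rw [add_sub_cancel_left, h1, h2] at h4
      linarith
    nlinarith [mul_le_mul_of_nonpos_left this h0]

theorem inner_le_of_mem_segment {x u w z : E} {k : ℝ} (hw : inner ℝ u (w - x) ≤ k * ‖w - x‖)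
    (hz : z ∈ segment ℝ x w) : inner ℝ u (z - x) ≤ k * ‖z - x‖ := by
  rw [segment_eq_image'] at hz
  obtain ⟨s, ⟨hs, -⟩, rfl⟩ := hz
  simp only [add_sub_cancel_left, inner_smul_right, norm_smul, Real.norm_of_nonneg hs]
  nlinarith [mul_le_mul_of_nonneg_left hw hs]

end Geometry

namespace SimpleGraph

variable {G : SimpleGraph V}

open Topology in
/-- A vertex `x` of a straight drawing can be split into `x` and `y` if the neighbours of `y` and
those of `x` are separated by a cone with apex `x`. -/
theorem StraightDrawing.exists_split [Finite V] {H : SimpleGraph V} {U : Set V} {p : V → ℂ}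
    {x y : V} (h : H.StraightDrawing (U \ {y}) p) (hx : x ∈ U) (hxy : x ≠ y)
    (hGH : ∀ a b, a ≠ y → b ≠ y → G.Adj a b → H.Adj a b)
    (hyH : ∀ w, w ≠ x → G.Adj y w → H.Adj x w) {u : ℂ} {k : ℝ} (hu : ‖u‖ = 1) (hk : -1 < k)
    (hk' : k < 1) (hY : ∀ w ∈ U, w ≠ x → G.Adj y w → k * ‖p w - p x‖ ≤ inner ℝ u (p w - p x))
    (hX : ∀ w ∈ U, w ≠ y → G.Adj x w → inner ℝ u (p w - p x) ≤ k * ‖p w - p x‖) :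
    ∃ p', G.StraightDrawing U p' := by
  classical
  have hxU : x ∈ U \ {y} := ⟨hx, hxy⟩
  have ev1 : ∀ᶠ ε : ℝ in 𝓝 0, ∀ b c : V, b ∈ U → b ≠ y → (b = x ∨ H.Adj x b) → c ∈ U → c ≠ y →
      c ≠ x → c ≠ b → Disjoint (segment ℝ (p x + ε • u) (p b)) {p c} := by
    simp only [Filter.eventually_all]
    intro b c hb hby hbx hc hcy hcx hcb
    apply eventually_disjoint_segment isClosed_singleton
    rw [Set.disjoint_singleton_right]
    rcases hbx with rfl | hbx
    · rw [segment_same]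
      exact fun e => hcx (h.inj ⟨hc, hcy⟩ hxU e)
    · exact h.vertex x hxU b ⟨hb, hby⟩ c ⟨hc, hcy⟩ hbx hcx hcb
  have ev2 : ∀ᶠ ε : ℝ in 𝓝 0, ∀ b c d : V, b ∈ U → b ≠ y → (b = x ∨ H.Adj x b) → c ∈ U → c ≠ y →
      d ∈ U → d ≠ y → H.Adj c d → c ≠ x → d ≠ x → c ≠ b → d ≠ b →
      Disjoint (segment ℝ (p x + ε • u) (p b)) (segment ℝ (p c) (p d)) := by
    simp only [Filter.eventually_all]
    intro b c d hb hby hbx hc hcy hd hdy hcd hcx hdx hcb hdb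
    apply eventually_disjoint_segment
      (by rw [← convexHull_pair]; exact (Set.toFinite _).isClosed_convexHull (𝕜 := ℝ) )
    rcases hbx with rfl | hbx
    · rw [segment_same, Set.disjoint_singleton_left]
      exact h.vertex c ⟨hc, hcy⟩ d ⟨hd, hdy⟩ b hxU hcd hcx.symm hdx.symm
    · exact h.edge x hxU b ⟨hb, hby⟩ c ⟨hc, hcy⟩ d ⟨hd, hdy⟩ hbx hcd hcx.symm hdx.symm hcb.symm
        hdb.symm
  obtain ⟨ε, ⟨h1, h2⟩, hε⟩ : ∃ ε : ℝ, (_ ∧ _) ∧ 0 < ε :=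
    (((ev1.and ev2).filter_mono nhdsWithin_le_nhds).and self_mem_nhdsWithin).exists (f := 𝓝[>] 0)
  clear ev1 ev2
  set z := p x + ε • u with hz
  have hzseg : ∀ w, z ∈ segment ℝ z w := fun w => left_mem_segment ℝ z w
  have hmem : ∀ {a}, a ∈ U → a ≠ y → a ∈ U \ {y} := fun ha hay => ⟨ha, hay⟩
  have hfz : ∀ {w z'}, w ∈ U → w ≠ y → G.Adj x w → z' ∈ segment ℝ (p x) (p w) →
      ¬ k * ‖z' - p x‖ < inner ℝ u (z' - p x) := fun hw hwy hxw hz' =>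
    (inner_le_of_mem_segment (hX _ hw hwy hxw) hz').not_gt
  have hzx : z ≠ p x := by
    intro e
    have hu0 : u ≠ 0 := by rintro rfl; simp at hu
    simp [hz, hε.ne', hu0] at e
  have hzf : k * ‖z - p x‖ < inner ℝ u (z - p x) :=
    lt_inner_of_mem_segment (w := p x) hu hk hk' hε (by simp) (hzseg _) hzx
  have I1 : ∀ a ∈ U, a ≠ y → z ≠ p a := by
    intro a ha hay e
    by_cases hax : a = x
    · exact hzx (hax ▸ e)
    · exact Set.disjoint_left.1 (h1 x a hx hxy (Or.inl rfl) ha hay hax hax) (hzseg _) e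
  have hbH : ∀ {b}, G.Adj y b → b = x ∨ H.Adj x b := fun {b} hb => by
    by_cases hbx : b = x
    exacts [Or.inl hbx, Or.inr (hyH b hbx hb)]
  have I2 : ∀ b ∈ U, ∀ c ∈ U, G.Adj y b → c ≠ y → c ≠ b → p c ∉ segment ℝ z (p b) := by
    intro b hb c hc hyb hcy hcb hmem'
    by_cases hcx : c = x
    · subst hcx
      have hne : p c ≠ p b := fun e => hcb (h.inj hxU ⟨hb, hyb.ne'⟩ e)
      have := lt_inner_of_mem_segment hu hk hk' hε (hY b hb hcb.symm hyb) hmem' hne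
      simp at this
    · exact Set.disjoint_left.1 (h1 b c hb hyb.ne' (hbH hyb) hc hcy hcx hcb) hmem' rfl
  have I3 : ∀ a ∈ U, ∀ b ∈ U, G.Adj a b → a ≠ y → b ≠ y → z ∉ segment ℝ (p a) (p b) := by
    intro a ha b hb hab hay hby hmem'
    by_cases hax : a = x
    · subst hax
      exact hfz hb hby hab hmem' hzf
    by_cases hbx : b = x
    · subst hbx
      rw [segment_symm] at hmem'
      exact hfz ha hay hab.symm hmem' hzf
    exact Set.disjoint_left.1 (h2 x a b hx hxy (Or.inl rfl) ha hay hb hby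
      (hGH a b hay hby hab) hax hbx hax hbx) (hzseg _) hmem'
  have I4' : ∀ b ∈ U, ∀ d ∈ U, G.Adj y b → G.Adj x d → d ≠ y → b ≠ x → b ≠ d →
      Disjoint (segment ℝ z (p b)) (segment ℝ (p x) (p d)) := by
    intro b hb d hd hyb hxd hdy hbx hbd
    rw [Set.disjoint_left]
    intro z' hz1 hz2
    by_cases hzb : z' = p b
    · subst hzb
      exact h.vertex x hxU d ⟨hd, hdy⟩ b ⟨hb, hyb.ne'⟩ (hGH x d hxy hdy hxd) hbx hbd hz2
    · exact hfz hd hdy hxd hz2 (lt_inner_of_mem_segment hu hk hk' hε (hY b hb hbx hyb) hz1 hzb)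
  have I4 : ∀ b ∈ U, ∀ c ∈ U, ∀ d ∈ U, G.Adj y b → G.Adj c d → c ≠ y → d ≠ y → b ≠ c → b ≠ d →
      Disjoint (segment ℝ z (p b)) (segment ℝ (p c) (p d)) := by
    intro b hb c hc d hd hyb hcd hcy hdy hbc hbd
    by_cases hcx : c = x
    · subst hcx
      exact I4' b hb d hd hyb hcd hdy hbc hbd
    by_cases hdx : d = x
    · subst hdx
      rw [segment_symm ℝ (p c)]
      exact I4' b hb c hc hyb hcd.symm hcy hbd hbc
    exact h2 b c d hb hyb.ne' (hbH hyb) hc hcy hd hdy (hGH c d hcy hdy hcd) hcx hdx hbc.symm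
      hbd.symm
  clear_value z
  refine ⟨Function.update p y z, ?_, ?_, ?_⟩
  · intro a ha b hb e
    by_cases hay : a = y <;> by_cases hby : b = y
    · rw [hay, hby]
    · subst hay
      rw [Function.update_self, Function.update_of_ne hby] at e
      exact (I1 b hb hby e).elim
    · subst hby
      rw [Function.update_self, Function.update_of_ne hay] at e
      exact (I1 a ha hay e.symm).elim
    · rw [Function.update_of_ne hby, Function.update_of_ne hay] at e
      exact h.inj ⟨ha, hay⟩ ⟨hb, hby⟩ e
  · intro a ha b hb c hc hab hca hcb
    by_cases hay : a = y
    · subst hay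
      rw [Function.update_self, Function.update_of_ne hca, Function.update_of_ne hab.ne']
      exact I2 b hb c hc hab hca hcb
    by_cases hby : b = y
    · subst hby
      rw [Function.update_self, Function.update_of_ne hcb, Function.update_of_ne hab.ne,
        segment_symm]
      exact I2 a ha c hc hab.symm hcb hca
    rw [Function.update_of_ne hay, Function.update_of_ne hby]
    by_cases hcy : c = y
    · subst hcy
      rw [Function.update_self]
      exact I3 a ha b hb hab hay hby
    · rw [Function.update_of_ne hcy]
      exact h.vertex a ⟨ha, hay⟩ b ⟨hb, hby⟩ c ⟨hc, hcy⟩ (hGH a b hay hby hab) hca hcb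
  · intro a ha b hb c hc d hd hab hcd hac had hbc hbd
    by_cases hay : a = y
    · subst hay
      rw [Function.update_self, Function.update_of_ne hab.ne', Function.update_of_ne hac.symm,
        Function.update_of_ne had.symm]
      exact I4 b hb c hc d hd hab hcd hac.symm had.symm hbc hbd
    by_cases hby : b = y
    · subst hby
      rw [Function.update_self, Function.update_of_ne hab.ne, Function.update_of_ne hbc.symm,
        Function.update_of_ne hbd.symm, segment_symm]
      exact I4 a ha c hc d hd hab.symm hcd hbc.symm hbd.symm hac had
    rw [Function.update_of_ne hay, Function.update_of_ne hby]
    by_cases hcy : c = y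
    · subst hcy
      rw [Function.update_self, Function.update_of_ne hcd.ne']
      exact (I4 d hd a ha b hb hcd hab hac hbc had.symm hbd.symm).symm
    by_cases hdy : d = y
    · subst hdy
      rw [Function.update_self, Function.update_of_ne hcd.ne, segment_symm ℝ (p c)]
      exact (I4 c hc a ha b hb hcd.symm hab had hbd hac.symm hbc.symm).symm
    rw [Function.update_of_ne hcy, Function.update_of_ne hdy]
    exact h.edge a ⟨ha, hay⟩ b ⟨hb, hby⟩ c ⟨hc, hcy⟩ d ⟨hd, hdy⟩ (hGH a b hay hby hab)
      (hGH c d hcy hdy hcd) hac had hbc hbd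

end SimpleGraph

theorem eq_triple_or_gap_of_not_alternating {X Y : Set V} {θ : V → ℝ} (hX : X.Finite)
    (hY : Y.Finite) (hX' : X.Nonempty) (hY' : Y.Nonempty) (hθ : Set.InjOn θ (X ∪ Y))
    (hXY : ∀ a ∈ X, ∀ b ∈ Y, ∀ c ∈ X, ∀ d ∈ Y, θ a < θ b → θ b < θ c → θ c < θ d → False)
    (hYX : ∀ a ∈ Y, ∀ b ∈ X, ∀ c ∈ Y, ∀ d ∈ X, θ a < θ b → θ b < θ c → θ c < θ d → False) :
    (∃ a b c, a ≠ b ∧ a ≠ c ∧ b ≠ c ∧ X = {a, b, c} ∧ Y = {a, b, c}) ∨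
    (∃ l ∈ Y, ∃ m ∈ Y, (∀ w ∈ Y, θ l ≤ θ w ∧ θ w ≤ θ m) ∧ ∀ w ∈ X, θ w ≤ θ l ∨ θ m ≤ θ w) ∨
    (∃ l ∈ X, ∃ m ∈ X, (∀ w ∈ X, θ l ≤ θ w ∧ θ w ≤ θ m) ∧ ∀ w ∈ Y, θ w ≤ θ l ∨ θ m ≤ θ w) := by
  obtain ⟨x₁, hx₁, hx₁'⟩ := Set.exists_min_image X θ hX hX'
  obtain ⟨x₂, hx₂, hx₂'⟩ := Set.exists_max_image X θ hX hX'
  obtain ⟨y₁, hy₁, hy₁'⟩ := Set.exists_min_image Y θ hY hY'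
  obtain ⟨y₂, hy₂, hy₂'⟩ := Set.exists_max_image Y θ hY hY'
  by_contra! hcon
  obtain ⟨h₁, h₂, h₃⟩ := hcon
  obtain ⟨x₀, hx₀, hx₀l, hx₀m⟩ := h₂ y₁ hy₁ y₂ hy₂ fun w hw => ⟨hy₁' w hw, hy₂' w hw⟩
  obtain ⟨y₀, hy₀, hy₀l, hy₀m⟩ := h₃ x₁ hx₁ x₂ hx₂ fun w hw => ⟨hx₁' w hw, hx₂' w hw⟩
  have inj : ∀ x ∈ X, ∀ y ∈ Y, θ x = θ y → x = y := fun x hx y hy e =>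
    hθ (Or.inl hx) (Or.inr hy) e
  have e₁ : x₁ = y₁ := inj _ hx₁ _ hy₁ <| by
    rcases lt_trichotomy (θ x₁) (θ y₁) with h | h | h
    · exact (hXY _ hx₁ _ hy₁ _ hx₀ _ hy₂ h hx₀l hx₀m).elim
    · exact h
    · exact (hYX _ hy₁ _ hx₁ _ hy₀ _ hx₂ h hy₀l hy₀m).elim
  have e₂ : x₂ = y₂ := inj _ hx₂ _ hy₂ <| by
    rcases lt_trichotomy (θ x₂) (θ y₂) with h | h | h
    · exact (hXY _ hx₁ _ hy₀ _ hx₂ _ hy₂ hy₀l hy₀m h).elim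
    · exact h
    · exact (hYX _ hy₁ _ hx₀ _ hy₂ _ hx₂ hx₀l hx₀m h).elim
  subst e₁ e₂
  have mid : ∀ x ∈ X, ∀ y ∈ Y, θ x₁ < θ x → θ x < θ x₂ → θ x₁ < θ y → θ y < θ x₂ → x = y := by
    intro x hx y hy h1 h2 h3 h4
    refine inj x hx y hy ?_
    rcases lt_trichotomy (θ x) (θ y) with h | h | h
    · exact (hYX _ hy₁ _ hx _ hy _ hx₂ h1 h h4).elim
    · exact h
    · exact (hXY _ hx₁ _ hy _ hx _ hy₂ h3 h h2).elim
  have e₀ := mid x₀ hx₀ y₀ hy₀ hx₀l hx₀m hy₀l hy₀m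
  subst e₀
  refine h₁ x₁ x₀ x₂ (by rintro rfl; exact lt_irrefl _ hx₀l)
    (by rintro rfl; exact lt_asymm hx₀l hx₀m) (by rintro rfl; exact lt_irrefl _ hx₀m) ?_ ?_
  · ext w
    constructor
    · intro hw
      rcases (hx₁' w hw).eq_or_lt with h | h
      · exact Or.inl (inj w hw _ hy₁ h.symm)
      rcases (hx₂' w hw).eq_or_lt with h' | h'
      · exact Or.inr (Or.inr (inj w hw _ hy₂ h'))
      exact Or.inr (Or.inl (mid w hw _ hy₀ h h' hx₀l hx₀m))
    · rintro (rfl | rfl | rfl) <;> assumption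
  · ext w
    constructor
    · intro hw
      rcases (hy₁' w hw).eq_or_lt with h | h
      · exact Or.inl (inj _ hx₁ w hw h).symm
      rcases (hy₂' w hw).eq_or_lt with h' | h'
      · exact Or.inr (Or.inr (inj _ hx₂ w hw h'.symm).symm)
      exact Or.inr (Or.inl (mid _ hx₀ w hw hx₀l hx₀m h h').symm)
    · rintro (rfl | rfl | rfl) <;> assumption

theorem Complex.inner_exp_mul_I (φ : ℝ) (z : ℂ) :
    inner ℝ (Complex.exp (φ * Complex.I)) z = Real.cos (z.arg - φ) * ‖z‖ := by
  rw [Complex.inner, Real.cos_sub]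
  simp only [Complex.mul_re, Complex.conj_re, Complex.conj_im, Complex.exp_ofReal_mul_I_re,
    Complex.exp_ofReal_mul_I_im]
  linear_combination -Real.cos φ * Complex.norm_mul_cos_arg z -
    Real.sin φ * Complex.norm_mul_sin_arg z

/-- An interval of arguments cuts out a cone given by one inequality. -/
theorem exists_cone {α β : ℝ} (hα : -Real.pi < α) (hβ : β ≤ Real.pi) (hαβ : α < β) :
    ∃ (u : ℂ) (k : ℝ), ‖u‖ = 1 ∧ -1 < k ∧ k < 1 ∧
      (∀ z : ℂ, α ≤ z.arg → z.arg ≤ β → k * ‖z‖ ≤ inner ℝ u z) ∧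
      ∀ z : ℂ, z.arg ≤ α ∨ β ≤ z.arg → inner ℝ u z ≤ k * ‖z‖ := by
  have hpi := Real.pi_pos
  refine ⟨Complex.exp (((α + β) / 2 : ℝ) * Complex.I), Real.cos ((β - α) / 2),
    Complex.norm_exp_ofReal_mul_I _, ?_, ?_, ?_, ?_⟩
  · rw [← Real.cos_pi]
    exact Real.cos_lt_cos_of_nonneg_of_le_pi (by linarith) le_rfl (by linarith)
  · rw [← Real.cos_zero]
    exact Real.cos_lt_cos_of_nonneg_of_le_pi le_rfl (by linarith) (by linarith)
  · intro z h1 h2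
    rw [Complex.inner_exp_mul_I]
    refine mul_le_mul_of_nonneg_right ?_ (norm_nonneg z)
    rw [← Real.cos_abs (z.arg - _)]
    refine Real.cos_le_cos_of_nonneg_of_le_pi (abs_nonneg _) (by linarith) ?_
    rw [abs_le]
    constructor <;> linarith
  · intro z h
    rw [Complex.inner_exp_mul_I]
    refine mul_le_mul_of_nonneg_right ?_ (norm_nonneg z)
    have h3 := Complex.neg_pi_lt_arg z
    have h4 := Complex.arg_le_pi z
    rw [← Real.cos_abs (z.arg - _)]
    rcases le_total |z.arg - (α + β) / 2| Real.pi with h5 | h5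
    · refine Real.cos_le_cos_of_nonneg_of_le_pi (by linarith) h5 ?_
      rw [le_abs]
      rcases h with h | h
      · right; linarith
      · left; linarith
    · rw [← Real.cos_two_pi_sub]
      have h6 : |z.arg - (α + β) / 2| ≤ 2 * Real.pi - (β - α) / 2 := by
        rw [abs_le]
        constructor <;> linarith
      exact Real.cos_le_cos_of_nonneg_of_le_pi (by linarith) (by linarith) (by linarith)

namespace SimpleGraph
variable {G : SimpleGraph V}

theorem StraightDrawing.injOn_arg {U : Set V} {p : V → ℂ} (h : G.StraightDrawing U p) {v : V}
    (hv : v ∈ U) : Set.InjOn (fun w => (p w - p v).arg) {w ∈ U | G.Adj v w} := by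
  rintro a ⟨ha, hva⟩ b ⟨hb, hvb⟩ e
  by_contra hab
  have ha0 : p a - p v ≠ 0 := sub_ne_zero.2 fun e => hva.ne (h.inj ha hv e).symm
  have hb0 : p b - p v ≠ 0 := sub_ne_zero.2 fun e => hvb.ne (h.inj hb hv e).symm
  have key : ∀ a ∈ U, ∀ b ∈ U, a ≠ b → G.Adj v a → G.Adj v b → p b - p v ≠ 0 →
      SameRay ℝ (p a - p v) (p b - p v) → ‖p a - p v‖ ≤ ‖p b - p v‖ → False := by
    intro a ha b hb hab hva hvb hb0 hs hn
    refine h.vertex v hv b hb a ha hvb hva.ne' hab ?_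
    obtain ⟨r, hr, hr'⟩ := hs.exists_nonneg_right hb0
    have hr1 : r ≤ 1 := by
      rw [hr', norm_smul, Real.norm_of_nonneg hr] at hn
      exact le_of_mul_le_mul_right (by simpa using hn) (norm_pos_iff.2 hb0)
    rw [segment_eq_image']
    exact ⟨r, ⟨hr, hr1⟩, by simp only [← hr']; ring⟩
  have hs : SameRay ℝ (p a - p v) (p b - p v) := Complex.sameRay_iff.2 (Or.inr (Or.inr e))
  rcases le_total ‖p a - p v‖ ‖p b - p v‖ with hn | hn
  · exact key a ha b hb hab hva hvb hb0 hs hn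
  · exact key b hb a ha (Ne.symm hab) hvb hva ha0 hs.symm hn

theorem ConnOn.mono {H : SimpleGraph V} {S : Set V} (h : G.ConnOn S)
    (hGH : ∀ a ∈ S, ∀ b ∈ S, G.Adj a b → H.Adj a b) : H.ConnOn S :=
  fun T hT hT' hc => h T hT hT' fun a ha b hb hab => hc a ha b hb (hGH a (hT ha) b hb hab)

/-- The graph in which `x` takes over the neighbours of `y`. -/
def absorb (G : SimpleGraph V) (x y : V) : SimpleGraph V :=
  fromRel fun a b => G.Adj a b ∨ (a = x ∧ G.Adj y b)

theorem absorb_adj {x y a b : V} : (G.absorb x y).Adj a b ↔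
    a ≠ b ∧ (G.Adj a b ∨ (a = x ∧ G.Adj y b) ∨ (b = x ∧ G.Adj y a)) := by
  rw [absorb, fromRel_adj, G.adj_comm b a]
  tauto

theorem Adj.absorb {x y a b : V} (h : G.Adj a b) : (G.absorb x y).Adj a b :=
  absorb_adj.2 ⟨h.ne, Or.inl h⟩

/-- The branch set in `G` of a branch set of `G.absorb x y`. -/
def unabsorb (x y : V) (S : Set V) : Set V := {w | w ∈ S ∨ (w = y ∧ x ∈ S)}

theorem unabsorb_subset {x y : V} {S U : Set V} (hy : y ∈ U) (hS : S ⊆ U \ {y}) :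
    unabsorb x y S ⊆ U := by
  rintro w (hw | ⟨rfl, -⟩)
  · exact (hS hw).1
  · exact hy

theorem disjoint_unabsorb {x y : V} {S T : Set V} (hS : y ∉ S) (hT : y ∉ T) (h : Disjoint S T) :
    Disjoint (unabsorb x y S) (unabsorb x y T) := by
  rw [Set.disjoint_left] at h ⊢
  rintro w (hw | ⟨rfl, hw⟩) (hw' | ⟨hw1, hw'⟩)
  · exact h hw hw'
  · exact hS (hw1 ▸ hw)
  · exact hT hw'
  · exact h hw hw'

theorem ConnOn.unabsorb {x y : V} {S : Set V} (hxy : G.Adj x y) (hS : (G.absorb x y).ConnOn S) :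
    G.ConnOn (unabsorb x y S) := by
  intro T hT hT' hc
  have hyT : x ∈ S → (x ∈ T ↔ y ∈ T) := fun hx =>
    ⟨fun h => hc x h y (Or.inr ⟨rfl, hx⟩) hxy, fun h => hc y h x (Or.inl hx) hxy.symm⟩
  have key : S ⊆ S ∩ T := by
    refine hS _ Set.inter_subset_left ?_ ?_
    · obtain ⟨w, hw⟩ := hT'
      rcases hT hw with h | ⟨rfl, h⟩
      · exact ⟨w, h, hw⟩
      · exact ⟨x, h, (hyT h).2 hw⟩
    · rintro a ⟨ha, haT⟩ b hb hab
      refine ⟨hb, ?_⟩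
      rcases (absorb_adj.1 hab).2 with h | ⟨rfl, h⟩ | ⟨rfl, h⟩
      · exact hc a haT b (Or.inl hb) h
      · exact hc y ((hyT ha).1 haT) b (Or.inl hb) h
      · exact (hyT hb).2 (hc a haT y (Or.inr ⟨rfl, hb⟩) h.symm)
  rintro w (hw | ⟨rfl, hw⟩)
  · exact (key hw).2
  · exact (hyT hw).1 (key hw).2

theorem HasK33Minor.of_absorb {x y : V} {U : Set V} (hxy : G.Adj x y) (hy : y ∈ U)
    (h : (G.absorb x y).HasK33Minor (U \ {y})) : G.HasK33Minor U := by
  obtain ⟨A, B, hA, hB, hAA, hBB, hAB, hadj⟩ := h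
  have hyA : ∀ i, y ∉ A i := fun i hi => ((hA i).1 hi).2 rfl
  have hyB : ∀ i, y ∉ B i := fun i hi => ((hB i).1 hi).2 rfl
  refine ⟨fun i => unabsorb x y (A i), fun i => unabsorb x y (B i),
    fun i => ⟨unabsorb_subset hy (hA i).1, (hA i).2.unabsorb hxy⟩,
    fun i => ⟨unabsorb_subset hy (hB i).1, (hB i).2.unabsorb hxy⟩,
    fun i j hij => disjoint_unabsorb (hyA i) (hyA j) (hAA i j hij),
    fun i j hij => disjoint_unabsorb (hyB i) (hyB j) (hBB i j hij),
    fun i j => disjoint_unabsorb (hyA i) (hyB j) (hAB i j), fun i j => ?_⟩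
  obtain ⟨a, ha, b, hb, hab⟩ := hadj i j
  rcases (absorb_adj.1 hab).2 with h | ⟨rfl, h⟩ | ⟨rfl, h⟩
  · exact ⟨a, Or.inl ha, b, Or.inl hb, h⟩
  · exact ⟨y, Or.inr ⟨rfl, ha⟩, b, Or.inl hb, h⟩
  · exact ⟨a, Or.inl ha, y, Or.inr ⟨rfl, hb⟩, h.symm⟩

/-- Contracting an edge preserves connectedness of a set that contains both ends. -/
theorem ConnOn.absorb {x y : V} {S : Set V} (hxy : x ≠ y) (hx : x ∈ S) (hS : G.ConnOn S) :
    (G.absorb x y).ConnOn (S \ {y}) := by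
  intro T hT hT' hc
  have key : S ⊆ {w | w ∈ T ∨ (w = y ∧ x ∈ T ∧ y ∈ S)} := by
    refine hS _ ?_ ?_ ?_
    · rintro w (hw | ⟨rfl, -, hw⟩)
      · exact (hT hw).1
      · exact hw
    · obtain ⟨w, hw⟩ := hT'
      exact ⟨w, Or.inl hw⟩
    · rintro a ha b hb hab
      by_cases hby : b = y
      · subst hby
        rcases ha with ha | ⟨rfl, -, -⟩
        · refine Or.inr ⟨rfl, ?_, hb⟩
          by_cases hax : a = x
          · exact hax ▸ ha
          · exact hc a ha x ⟨hx, hxy⟩ (absorb_adj.2 ⟨hax, Or.inr (Or.inr ⟨rfl, hab.symm⟩)⟩)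
        · exact (hab.ne rfl).elim
      · left
        rcases ha with ha | ⟨rfl, ha, -⟩
        · exact hc a ha b ⟨hb, hby⟩ hab.absorb
        · by_cases hbx : b = x
          · exact hbx ▸ ha
          · exact hc x ha b ⟨hb, hby⟩ (absorb_adj.2 ⟨Ne.symm hbx, Or.inr (Or.inl ⟨rfl, hab⟩)⟩)
  rintro w ⟨hw, hwy⟩
  exact (key hw).resolve_right fun h => hwy h.1

theorem ThreeConnOn.absorb [Finite V] {x y : V} {U : Set V} (h : G.ThreeConnOn U)
    (hU : 5 ≤ U.ncard) (hx : x ∈ U) (hy : y ∈ U) (hxy : x ≠ y)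
    (hz : ∀ z, G.ConnOn (U \ {x, y, z})) : (G.absorb x y).ThreeConnOn (U \ {y}) := by
  refine ⟨by rw [Set.ncard_sdiff_singleton_of_mem hy]; omega, fun s t => ?_⟩
  by_cases hst : s = x ∨ t = x
  · obtain ⟨z, e⟩ : ∃ z, (U \ {y}) \ {s, t} = U \ {x, y, z} := by
      rcases hst with rfl | rfl
      · exact ⟨t, by ext; simp; tauto⟩
      · exact ⟨s, by ext; simp; tauto⟩
    rw [e]
    exact (hz z).mono fun _ _ _ _ => Adj.absorb
  · push Not at hst
    have e : (U \ {y}) \ {s, t} = (U \ {s, t}) \ {y} := by ext; simp; tauto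
    rw [e]
    exact (h.2 s t).absorb hxy ⟨hx, by simp [hst.1.symm, hst.2.symm]⟩

theorem ThreeConnOn.nontrivial_neighbors [Finite V] {x : V} {U : Set V} (h : G.ThreeConnOn U)
    (hx : x ∈ U) {y : V} (hxy : x ≠ y) : {w ∈ U | w ≠ y ∧ G.Adj x w}.Nontrivial := by
  by_contra hcon
  rw [Set.not_nontrivial_iff] at hcon
  obtain ⟨s, hs, hs'⟩ : ∃ s, s ≠ x ∧ ∀ w ∈ U, w ≠ y → G.Adj x w → w = s := by
    rcases hcon.eq_empty_or_singleton with e | ⟨s, e⟩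
    · exact ⟨y, hxy.symm, fun w hw h1 h2 =>
        (Set.eq_empty_iff_forall_notMem.1 e w ⟨hw, h1, h2⟩).elim⟩
    · have hs : s ∈ {w ∈ U | w ≠ y ∧ G.Adj x w} := e ▸ rfl
      exact ⟨s, hs.2.2.ne', fun w hw h1 h2 => by
        have : w ∈ {w ∈ U | w ≠ y ∧ G.Adj x w} := ⟨hw, h1, h2⟩
        rwa [e] at this⟩
  have key := h.2 y s {x} (by simpa using ⟨hx, hxy, hs.symm⟩) ⟨x, rfl⟩ (by
    rintro a rfl b ⟨hb, hb'⟩ hab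
    simp only [Set.mem_insert_iff, Set.mem_singleton_iff, not_or] at hb'
    exact (hb'.2 (hs' b hb hb'.1 hab)).elim)
  have hsub : U ⊆ {x, y, s} := fun w hw => by
    by_cases hw' : w ∈ ({y, s} : Set V)
    · exact Or.inr hw'
    · exact Or.inl (key ⟨hw, hw'⟩)
  have h1 := Set.ncard_le_ncard hsub
  have h2 := Set.ncard_insert_le x {y, s}
  have h3 := Set.ncard_insert_le y {s}
  have h4 := Set.ncard_singleton s
  have := h.1
  omega

/-- A wheel-like configuration: a cycle of branch sets whose members alternately see the ends of an
edge. -/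
theorem hasK33Minor_of_cycle {U A B C D : Set V} {x y a b c d : V} (hx : x ∈ U) (hy : y ∈ U)
    (hxy : G.Adj x y) (hA : A ⊆ U \ {x, y}) (hB : B ⊆ U \ {x, y}) (hC : C ⊆ U \ {x, y})
    (hD : D ⊆ U \ {x, y}) (cA : G.ConnOn A) (cB : G.ConnOn B) (cC : G.ConnOn C) (cD : G.ConnOn D)
    (ha : a ∈ A) (hb : b ∈ B) (hc : c ∈ C) (hd : d ∈ D)
    (hAB : Disjoint A B) (hAC : Disjoint A C) (hAD : Disjoint A D) (hBC : Disjoint B C)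
    (hBD : Disjoint B D) (hCD : Disjoint C D)
    (eAB : ∃ x ∈ A, ∃ y ∈ B, G.Adj x y) (eBC : ∃ x ∈ B, ∃ y ∈ C, G.Adj x y)
    (eCD : ∃ x ∈ C, ∃ y ∈ D, G.Adj x y) (eDA : ∃ x ∈ D, ∃ y ∈ A, G.Adj x y)
    (hxa : G.Adj x a) (hyb : G.Adj y b) (hxc : G.Adj x c) (hyd : G.Adj y d) :
    G.HasK33Minor U := by
  have flip : ∀ {S T : Set V}, (∃ x ∈ S, ∃ y ∈ T, G.Adj x y) → ∃ x ∈ T, ∃ y ∈ S, G.Adj x y :=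
    fun ⟨s, hs, t, ht, h⟩ => ⟨t, ht, s, hs, h.symm⟩
  have out : ∀ {S : Set V}, S ⊆ U \ {x, y} → S ⊆ U ∧ x ∉ S ∧ y ∉ S := fun h =>
    ⟨fun w hw => (h hw).1, fun hw => (h hw).2 (Or.inl rfl), fun hw => (h hw).2 (Or.inr rfl)⟩
  obtain ⟨A1, A2, A3⟩ := out hA
  obtain ⟨B1, B2, B3⟩ := out hB
  obtain ⟨C1, C2, C3⟩ := out hC
  obtain ⟨D1, D2, D3⟩ := out hD
  refine ⟨![{x}, B, D], ![{y}, A, C], ?_, ?_, ?_, ?_, ?_, ?_⟩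
  · simp [Fin.forall_fin_succ, *, connOn_singleton]
  · simp [Fin.forall_fin_succ, *, connOn_singleton]
  · simp [Fin.forall_fin_succ, *, hBD.symm]
  · simp [Fin.forall_fin_succ, *, hAC.symm]
  · simp [Fin.forall_fin_succ, *, hxy.ne', hAB.symm, hAD.symm, hCD.symm]
  · have e1 : ∃ b ∈ A, G.Adj x b := ⟨a, ha, hxa⟩
    have e2 : ∃ b ∈ C, G.Adj x b := ⟨c, hc, hxc⟩
    have e3 : ∃ a ∈ B, G.Adj a y := ⟨b, hb, hyb.symm⟩
    have e4 : ∃ a ∈ D, G.Adj a y := ⟨d, hd, hyd.symm⟩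
    simp [Fin.forall_fin_succ, hxy, e1, e2, e3, e4, flip eAB, eBC, eDA, flip eCD]

/-- If `x` and `y` have the same three further neighbours, the rest of a 3-connected graph either is
empty or provides the third branch set of a `K₃,₃` minor. -/
theorem ThreeConnOn.hasK33Minor_of_triple {U : Set V} {x y p q r w : V} (h : G.ThreeConnOn U)
    (hx : x ∈ U) (hy : y ∈ U) (hxy : x ≠ y) (hp : p ∈ U) (hq : q ∈ U) (hr : r ∈ U)
    (hpq : p ≠ q) (hpr : p ≠ r) (hqr : q ≠ r)
    (hX : ∀ z ∈ U, z ≠ y → (G.Adj x z ↔ z = p ∨ z = q ∨ z = r))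
    (hY : ∀ z ∈ U, z ≠ x → (G.Adj y z ↔ z = p ∨ z = q ∨ z = r))
    (hpy : p ≠ y) (hqy : q ≠ y) (hry : r ≠ y) (hpx : p ≠ x) (hqx : q ≠ x) (hrx : r ≠ x)
    (hw : w ∈ U \ {x, y, p, q, r}) : G.HasK33Minor U := by
  set R := U \ {x, y, p, q, r} with hR
  set W := G.comp R w with hW
  have hWR : W ⊆ R := comp_subset
  have hWU : W ⊆ U := fun a ha => (hWR ha).1
  have notMem : ∀ s ∈ ({x, y, p, q, r} : Set V), s ∉ W := fun s hs hsW => (hWR hsW).2 hs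
  have key : ∀ s t v, (({s, t, v} : Set V) = {p, q, r}) → ∃ a ∈ W, G.Adj a v := by
    intro s t v e
    by_contra! hcon
    have mem : ∀ z, z = s ∨ z = t ∨ z = v ↔ z = p ∨ z = q ∨ z = r := fun z => by
      simpa using Set.ext_iff.1 e z
    have hxs : x ∈ U \ {s, t} := by
      refine ⟨hx, fun hxs => ?_⟩
      rcases (mem x).1 (Or.imp id Or.inl hxs) with e | e | e
      exacts [hpx e.symm, hqx e.symm, hrx e.symm]
    refine notMem x (by simp) (h.2 s t W ?_ ⟨w, mem_comp_self hw⟩ ?_ hxs)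
    · intro z hz
      exact ⟨hWU hz, fun hzs => (hWR hz).2 (Or.inr (Or.inr ((mem z).1 (Or.imp id Or.inl hzs))))⟩
    · rintro a ha b ⟨hb, hb'⟩ hab
      have h1 := mem b
      have h2 := (hWR ha).2
      have h3 := hX a (hWU ha)
      have h4 := hY a (hWU ha)
      have h5 := hcon a ha
      simp only [Set.mem_insert_iff, Set.mem_singleton_iff, not_or] at h2 hb'
      refine comp_closed ha ⟨hb, ?_⟩ hab
      simp only [Set.mem_insert_iff, Set.mem_singleton_iff, not_or]
      have h6 : b ≠ v := by rintro rfl; exact h5 hab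
      refine ⟨?_, ?_, ?_⟩
      · rintro rfl
        rcases (h3 h2.2.1).1 hab.symm with e | e | e
        exacts [h2.2.2.1 e, h2.2.2.2.1 e, h2.2.2.2.2 e]
      · rintro rfl
        rcases (h4 h2.1).1 hab.symm with e | e | e
        exacts [h2.2.2.1 e, h2.2.2.2.1 e, h2.2.2.2.2 e]
      · have h7 : ¬ (b = s ∨ b = t ∨ b = v) := by simp [hb'.1, hb'.2, h6]
        simpa only [not_or] using mt h1.2 h7
  obtain ⟨a₁, ha₁, h₁⟩ := key q r p (by grind)
  obtain ⟨a₂, ha₂, h₂⟩ := key p r q (by grind)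
  obtain ⟨a₃, ha₃, h₃⟩ := key p q r (by grind)
  have n1 := notMem x (by simp)
  have n2 := notMem y (by simp)
  have n3 := notMem p (by simp)
  have n4 := notMem q (by simp)
  have n5 := notMem r (by simp)
  have cW : G.ConnOn W := connOn_comp
  have x1 := (hX p hp hpy).2 (by simp)
  have x2 := (hX q hq hqy).2 (by simp)
  have x3 := (hX r hr hry).2 (by simp)
  have y1 := (hY p hp hpx).2 (by simp)
  have y2 := (hY q hq hqx).2 (by simp)
  have y3 := (hY r hr hrx).2 (by simp)
  refine ⟨![{x}, {y}, W], ![{p}, {q}, {r}], ?_, ?_, ?_, ?_, ?_, ?_⟩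
  · simp [Fin.forall_fin_succ, hx, hy, hWU, cW, connOn_singleton]
  · simp [Fin.forall_fin_succ, hp, hq, hr, connOn_singleton]
  · simp [Fin.forall_fin_succ, n1, n2, hxy, hxy.symm]
  · simp [Fin.forall_fin_succ, hpq, hpr, hqr, hpq.symm, hpr.symm, hqr.symm]
  · simp [Fin.forall_fin_succ, n3, n4, n5, hpx, hqx, hrx, hpy, hqy, hry]
  · have e1 : ∃ a ∈ W, G.Adj a p := ⟨a₁, ha₁, h₁⟩
    have e2 : ∃ a ∈ W, G.Adj a q := ⟨a₂, ha₂, h₂⟩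
    have e3 : ∃ a ∈ W, G.Adj a r := ⟨a₃, ha₃, h₃⟩
    simp [Fin.forall_fin_succ, x1, x2, x3, y1, y2, y3, e1, e2, e3]

theorem StraightDrawing.exists_cycle_of_alternating [Finite V] {U : Set V} {x y a b c d : V}
    {p : V → ℂ} (h : (G.absorb x y).StraightDrawing (U \ {y}) p) (hx : x ∈ U) (hxy : x ≠ y)
    (hz : ∀ z, G.ConnOn (U \ {x, y, z})) (ha : a ∈ U \ {x, y}) (hb : b ∈ U \ {x, y})
    (hc : c ∈ U \ {x, y}) (hd : d ∈ U \ {x, y}) (hxa : (G.absorb x y).Adj x a)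
    (hxb : (G.absorb x y).Adj x b) (hxc : (G.absorb x y).Adj x c) (hxd : (G.absorb x y).Adj x d)
    (hab : (p a - p x).arg < (p b - p x).arg) (hbc : (p b - p x).arg < (p c - p x).arg)
    (hcd : (p c - p x).arg < (p d - p x).arg) :
    ∃ A B C D : Set V, A ⊆ U \ {x, y} ∧ B ⊆ U \ {x, y} ∧ C ⊆ U \ {x, y} ∧ D ⊆ U \ {x, y} ∧
      G.ConnOn A ∧ G.ConnOn B ∧ G.ConnOn C ∧ G.ConnOn D ∧ a ∈ A ∧ b ∈ B ∧ c ∈ C ∧ d ∈ D ∧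
      Disjoint A B ∧ Disjoint A C ∧ Disjoint A D ∧ Disjoint B C ∧ Disjoint B D ∧ Disjoint C D ∧
      (∃ x ∈ A, ∃ y ∈ B, G.Adj x y) ∧ (∃ x ∈ B, ∃ y ∈ C, G.Adj x y) ∧
      (∃ x ∈ C, ∃ y ∈ D, G.Adj x y) ∧ ∃ x ∈ D, ∃ y ∈ A, G.Adj x y := by
  refine exists_rooted_cycle (fun w => ?_) ha hb hc hd ?_ ?_ ?_ ?_ ?_
  · convert hz w using 1
    ext; simp; tauto
  · rintro rfl; exact lt_irrefl _ hab
  · rintro rfl; exact lt_asymm hab (hbc.trans hcd)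
  · rintro rfl; exact lt_irrefl _ hbc
  · rintro rfl; exact lt_irrefl _ hcd
  · intro S T hS hT cS cT haS hcS hbT hdT hST
    have sub : ∀ {S : Set V}, S ⊆ U \ {x, y} → S ⊆ U \ {y} ∧ x ∉ S := fun h =>
      ⟨fun w hw => ⟨(h hw).1, fun e => (h hw).2 (Or.inr e)⟩, fun hw => (h hw).2 (Or.inl rfl)⟩
    exact h.not_linked ⟨hx, hxy⟩ (sub hS).1 (sub hT).1 hST (sub hS).2 (sub hT).2
      (cS.mono fun _ _ _ _ => Adj.absorb) (cT.mono fun _ _ _ _ => Adj.absorb) haS hbT hcS hdT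
      hxa hxb hxc hxd hab hbc hcd

end SimpleGraph

/-- The corners and an inner point of a triangle. -/
def trianglePoints : Fin 4 → ℂ := ![0, 1, Complex.I, -1 - Complex.I]

theorem trianglePoints_notMem_segment : ∀ i j k : Fin 4, i ≠ j → k ≠ i → k ≠ j →
    trianglePoints k ∉ segment ℝ (trianglePoints i) (trianglePoints j) := by
  intro i j k hij hki hkj
  rintro ⟨s, t, hs, ht, hst, e⟩
  rw [Complex.ext_iff] at e
  fin_cases i <;> fin_cases j <;> first | exact hij rfl | skip
  all_goals fin_cases k <;> first | exact hki rfl | exact hkj rfl | skip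
  all_goals simp [trianglePoints] at e
  all_goals
    obtain ⟨e1, e2⟩ := e
    linarith

theorem disjoint_segment_trianglePoints : ∀ i j k l : Fin 4, i ≠ j → k ≠ l → i ≠ k → i ≠ l →
    j ≠ k → j ≠ l → Disjoint (segment ℝ (trianglePoints i) (trianglePoints j))
      (segment ℝ (trianglePoints k) (trianglePoints l)) := by
  intro i j k l hij hkl hik hil hjk hjl
  rw [Set.disjoint_left]
  rintro z ⟨s, t, hs, ht, hst, e⟩ ⟨s', t', hs', ht', hst', e'⟩
  rw [← e', Complex.ext_iff] at e
  fin_cases i <;> fin_cases j <;> first | exact hij rfl | skip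
  all_goals fin_cases k <;> first | exact hik rfl | exact hjk rfl | skip
  all_goals fin_cases l <;> first | exact hil rfl | exact hjl rfl | exact hkl rfl | skip
  all_goals simp [trianglePoints] at e
  all_goals
    obtain ⟨e1, e2⟩ := e
    linarith

namespace SimpleGraph
variable {G : SimpleGraph V}

theorem exists_straightDrawing_of_ncard_eq_four [Finite V] {U : Set V} (hU : U.ncard = 4) :
    ∃ p, G.StraightDrawing U p := by
  classical
  have e : U ≃ Fin 4 := Finite.equivFinOfCardEq hU
  let f : V → Fin 4 := fun v => if h : v ∈ U then e ⟨v, h⟩ else 0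
  have hf : ∀ a ∈ U, ∀ b ∈ U, a ≠ b → f a ≠ f b := by
    intro a ha b hb hab h
    simp only [f, ha, hb, dif_pos] at h
    exact hab (congrArg Subtype.val (e.injective h))
  refine ⟨fun v => trianglePoints (f v), ?_, ?_, ?_⟩
  · intro a ha b hb h
    by_contra hab
    obtain ⟨k, hka, hkb⟩ : ∃ k, k ≠ f a ∧ k ≠ f b := by
      generalize f a = i
      generalize f b = j
      revert i j
      decide
    refine trianglePoints_notMem_segment k (f a) (f b) hka hkb.symm (hf a ha b hb hab).symm ?_
    simp only at h
    rw [← h]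
    exact right_mem_segment ℝ _ _
  · intro a ha b hb c hc hab hca hcb
    exact trianglePoints_notMem_segment _ _ _ (hf a ha b hb hab.ne) (hf c hc a ha hca)
      (hf c hc b hb hcb)
  · intro a ha b hb c hc d hd hab hcd hac had hbc hbd
    exact disjoint_segment_trianglePoints _ _ _ _ (hf a ha b hb hab.ne) (hf c hc d hd hcd.ne)
      (hf a ha c hc hac) (hf a ha d hd had) (hf b hb c hc hbc) (hf b hb d hd hbd)

theorem hasK33Minor_of_absorb_complete [Finite V] {U : Set V} {x y : V} (h : G.ThreeConnOn U)
    (hx : x ∈ U) (hy : y ∈ U) (hxy : G.Adj x y) (hU : (U \ {y}).ncard = 5)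
    (hc : ∀ a ∈ U \ {y}, ∀ b ∈ U \ {y}, a ≠ b → (G.absorb x y).Adj a b) : G.HasK33Minor U := by
  set W := U \ {x, y} with hW
  have hW4 : W.ncard = 4 := by
    have e : W = (U \ {y}) \ {x} := by ext; simp [hW]; tauto
    rw [e, Set.ncard_sdiff_singleton_of_mem (Set.mem_sdiff_singleton.2 ⟨hx, hxy.ne⟩), hU]
  have memW : ∀ w, w ∈ W ↔ w ∈ U ∧ w ≠ x ∧ w ≠ y := fun w => by simp [hW]
  have adjW : ∀ a ∈ W, ∀ b ∈ W, a ≠ b → G.Adj a b := by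
    intro a ha b hb hab
    rw [memW] at ha hb
    rcases (absorb_adj.1 (hc a ⟨ha.1, ha.2.2⟩ b ⟨hb.1, hb.2.2⟩ hab)).2 with h | h | h
    · exact h
    · exact (ha.2.1 h.1).elim
    · exact (hb.2.1 h.1).elim
  set X := {w ∈ U | w ≠ y ∧ G.Adj x w} with hX
  set Y := {w ∈ U | w ≠ x ∧ G.Adj y w} with hY
  have hXW : X ⊆ W := fun w hw => (memW w).2 ⟨hw.1, hw.2.2.ne', hw.2.1⟩
  have hYW : Y ⊆ W := fun w hw => (memW w).2 ⟨hw.1, hw.2.1, hw.2.2.ne'⟩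
  have hXY : ∀ w ∈ W, w ∉ X → w ∈ Y := by
    intro w hw hwX
    rw [memW] at hw
    refine ⟨hw.1, hw.2.1, ?_⟩
    rcases (absorb_adj.1 (hc x ⟨hx, hxy.ne⟩ w ⟨hw.1, hw.2.2⟩ hw.2.1.symm)).2 with h | h | h
    · exact (hwX ⟨hw.1, hw.2.2, h⟩).elim
    · exact h.2
    · exact (hw.2.1 h.1).elim
  have hX2 : 1 < X.ncard :=
    (Set.one_lt_ncard_iff_nontrivial).2 (h.nontrivial_neighbors hx hxy.ne)
  have hY2 : 1 < Y.ncard :=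
    (Set.one_lt_ncard_iff_nontrivial).2 (h.nontrivial_neighbors hy hxy.ne')
  have hXd : (X \ Y).ncard ≤ 2 := by
    have h1 := Set.ncard_sdiff_add_ncard_of_subset hYW
    have h2 : (X \ Y).ncard ≤ (W \ Y).ncard := Set.ncard_le_ncard (Set.sdiff_subset_sdiff_left hXW)
    omega
  obtain ⟨A, hA1, hA2, hA⟩ := Set.exists_subsuperset_card_eq Set.sdiff_subset hXd hX2
  have hAW := hA2.trans hXW
  have hB : (W \ A).ncard = 2 := by
    have h1 := Set.ncard_sdiff_add_ncard_of_subset hAW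
    omega
  have hBY : W \ A ⊆ Y := fun w hw => by
    by_contra hwY
    by_cases hwX : w ∈ X
    · exact hw.2 (hA1 ⟨hwX, hwY⟩)
    · exact hwY (hXY w hw.1 hwX)
  obtain ⟨a, c, hac, eA⟩ := Set.ncard_eq_two.1 hA
  obtain ⟨b, d, hbd, eB⟩ := Set.ncard_eq_two.1 hB
  have ha : a ∈ A := eA ▸ Or.inl rfl
  have hc : c ∈ A := eA ▸ Or.inr rfl
  have hb : b ∈ W \ A := eB ▸ Or.inl rfl
  have hd : d ∈ W \ A := eB ▸ Or.inr rfl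
  have ne : ∀ {u v}, u ∈ A → v ∈ W \ A → u ≠ v := fun hu hv e => hv.2 (e ▸ hu)
  have adj : ∀ {u v}, u ∈ A → v ∈ W \ A → G.Adj u v := fun hu hv =>
    adjW _ (hAW hu) _ hv.1 (ne hu hv)
  refine hasK33Minor_of_cycle (A := {a}) (B := {b}) (C := {c}) (D := {d}) hx hy hxy
    (Set.singleton_subset_iff.2 (hAW ha)) (Set.singleton_subset_iff.2 hb.1)
    (Set.singleton_subset_iff.2 (hAW hc)) (Set.singleton_subset_iff.2 hd.1)
    (connOn_singleton _) (connOn_singleton _) (connOn_singleton _) (connOn_singleton _)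
    rfl rfl rfl rfl (by simpa using ne ha hb) (by simpa using hac) (by simpa using ne ha hd)
    (by simpa using (ne hc hb).symm) (by simpa using hbd) (by simpa using ne hc hd)
    ⟨a, rfl, b, rfl, adj ha hb⟩ ⟨b, rfl, c, rfl, (adj hc hb).symm⟩ ⟨c, rfl, d, rfl, adj hc hd⟩
    ⟨d, rfl, a, rfl, (adj ha hd).symm⟩ (hA2 ha).2.2 (hBY hb).2.2 (hA2 hc).2.2 (hBY hd).2.2

/-- A 3-connected graph without `K₃,₃` minor, other than `K₅`, has a straight-line drawing. -/
theorem ThreeConnOn.exists_straightDrawing [Finite V] {U : Set V} (h : G.ThreeConnOn U)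
    (hK : ¬ G.HasK33Minor U)
    (hK5 : ¬ (U.ncard = 5 ∧ ∀ a ∈ U, ∀ b ∈ U, a ≠ b → G.Adj a b)) :
    ∃ p, G.StraightDrawing U p := by
  induction hn : U.ncard generalizing G U with
  | zero => have := h.1; omega
  | succ n ih =>
  by_cases hU : U.ncard = 4
  · exact exists_straightDrawing_of_ncard_eq_four hU
  have hU5 : 5 ≤ U.ncard := by have := h.1; omega
  obtain ⟨x, hx, y, hy, hxy, hz⟩ := h.exists_contractible hU5
  obtain ⟨p, hp⟩ := ih (h.absorb hU5 hx hy hxy.ne hz) (fun hm => hK (hm.of_absorb hxy hy))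
    (fun hm => hK (hasK33Minor_of_absorb_complete h hx hy hxy hm.1 hm.2))
    (by rw [Set.ncard_sdiff_singleton_of_mem hy, hn]; omega)
  set X := {w ∈ U | w ≠ y ∧ G.Adj x w} with hX
  set Y := {w ∈ U | w ≠ x ∧ G.Adj y w} with hY
  have nX : X.Nontrivial := h.nontrivial_neighbors hx hxy.ne
  have nY : Y.Nontrivial := h.nontrivial_neighbors hy hxy.ne'
  have adjX : ∀ w ∈ X, (G.absorb x y).Adj x w := fun w hw => hw.2.2.absorb
  have adjY : ∀ w ∈ Y, (G.absorb x y).Adj x w := fun w hw =>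
    absorb_adj.2 ⟨hw.2.1.symm, Or.inr (Or.inl ⟨rfl, hw.2.2⟩)⟩
  have memX : ∀ w ∈ X, w ∈ U \ {x, y} := fun w hw => ⟨hw.1, by simp [hw.2.1, hw.2.2.ne']⟩
  have memY : ∀ w ∈ Y, w ∈ U \ {x, y} := fun w hw => ⟨hw.1, by simp [hw.2.1, hw.2.2.ne']⟩
  have inj : Set.InjOn (fun w => (p w - p x).arg) (X ∪ Y) := by
    refine (hp.injOn_arg ⟨hx, hxy.ne⟩).mono ?_
    rintro w (hw | hw)
    · exact ⟨⟨hw.1, hw.2.1⟩, adjX w hw⟩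
    · exact ⟨⟨hw.1, hw.2.2.ne'⟩, adjY w hw⟩
  have lt_of : ∀ {S : Set V}, S.Nontrivial → S ⊆ X ∪ Y → ∀ {l m : V},
      (∀ w ∈ S, (p l - p x).arg ≤ (p w - p x).arg ∧ (p w - p x).arg ≤ (p m - p x).arg) →
      (p l - p x).arg < (p m - p x).arg := by
    intro S nS hS l m hlm
    obtain ⟨s, hs, t, ht, hst⟩ := nS
    refine lt_of_le_of_ne ((hlm s hs).1.trans (hlm s hs).2) fun e => hst (inj (hS hs) (hS ht) ?_)
    have h1 := hlm s hs
    have h2 := hlm t ht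
    simp only
    linarith [h1.1, h1.2, h2.1, h2.2]
  have split := fun {u : ℂ} {k : ℝ} => hp.exists_split (G := G) (u := u) (k := k) hx hxy.ne
    (fun a b _ _ hab => hab.absorb)
    (fun w hwx hyw => absorb_adj.2 ⟨hwx.symm, Or.inr (Or.inl ⟨rfl, hyw⟩)⟩)
  have hXY : ∀ a ∈ X, ∀ b ∈ Y, ∀ c ∈ X, ∀ d ∈ Y, (p a - p x).arg < (p b - p x).arg →
      (p b - p x).arg < (p c - p x).arg → (p c - p x).arg < (p d - p x).arg → False := by
    intro a ha b hb c hc d hd h1 h2 h3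
    obtain ⟨A, B, C, D, hA, hB, hC, hD, cA, cB, cC, cD, aA, bB, cC', dD, AB, AC, AD, BC, BD, CD,
      eAB, eBC, eCD, eDA⟩ := hp.exists_cycle_of_alternating hx hxy.ne hz (memX a ha) (memY b hb)
      (memX c hc) (memY d hd) (adjX a ha) (adjY b hb) (adjX c hc) (adjY d hd) h1 h2 h3
    exact hK (hasK33Minor_of_cycle hx hy hxy hA hB hC hD cA cB cC cD aA bB cC' dD AB AC AD BC BD CD
      eAB eBC eCD eDA ha.2.2 hb.2.2 hc.2.2 hd.2.2)
  have hYX : ∀ a ∈ Y, ∀ b ∈ X, ∀ c ∈ Y, ∀ d ∈ X, (p a - p x).arg < (p b - p x).arg →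
      (p b - p x).arg < (p c - p x).arg → (p c - p x).arg < (p d - p x).arg → False := by
    intro a ha b hb c hc d hd h1 h2 h3
    obtain ⟨A, B, C, D, hA, hB, hC, hD, cA, cB, cC, cD, aA, bB, cC', dD, AB, AC, AD, BC, BD, CD,
      eAB, eBC, eCD, eDA⟩ := hp.exists_cycle_of_alternating hx hxy.ne hz (memY a ha) (memX b hb)
      (memY c hc) (memX d hd) (adjY a ha) (adjX b hb) (adjY c hc) (adjX d hd) h1 h2 h3
    rw [Set.pair_comm] at hA hB hC hD
    exact hK (hasK33Minor_of_cycle hy hx hxy.symm hA hB hC hD cA cB cC cD aA bB cC' dD AB AC AD BC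
      BD CD eAB eBC eCD eDA ha.2.2 hb.2.2 hc.2.2 hd.2.2)
  rcases eq_triple_or_gap_of_not_alternating (θ := fun w => (p w - p x).arg) X.toFinite Y.toFinite
    nX.nonempty nY.nonempty inj hXY hYX with
    ⟨a, b, c, hab, hac, hbc, eX, eY⟩ | ⟨l, -, m, -, hlm, hgap⟩ | ⟨l, -, m, -, hlm, hgap⟩
  · have ha : a ∈ X := by simp [eX]
    have hb : b ∈ X := by simp [eX]
    have hc : c ∈ X := by simp [eX]
    have eXY : X = Y := eX.trans eY.symm
    have ha' : a ∈ Y := eXY ▸ ha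
    have hb' : b ∈ Y := eXY ▸ hb
    have hc' : c ∈ Y := eXY ▸ hc
    have rest : U ⊆ {x, y, a, b, c} := by
      intro w hw
      by_contra hw'
      refine hK (h.hasK33Minor_of_triple hx hy hxy.ne ha.1 hb.1 hc.1 hab hac hbc ?_ ?_ ha.2.1
        hb.2.1 hc.2.1 ha'.2.1 hb'.2.1 hc'.2.1 ⟨hw, hw'⟩)
      · intro z hz hzy
        have := Set.ext_iff.1 eX z
        simp only [hX, Set.mem_ofPred_eq, Set.mem_insert_iff, Set.mem_singleton_iff] at this
        tauto
      · intro z hz hzx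
        have := Set.ext_iff.1 eY z
        simp only [hY, Set.mem_ofPred_eq, Set.mem_insert_iff, Set.mem_singleton_iff] at this
        tauto
    have pair : ∀ r s t : V, U ⊆ {x, y, r, s, t} → s ∈ X → t ∈ X → s ≠ t → r ≠ s → r ≠ t →
        G.Adj s t := by
      intro r s t hsub hs ht hst hrs hrt
      by_contra hcon
      have hs' := memX s hs
      have ht' := memX t ht
      simp only [Set.mem_sdiff, Set.mem_insert_iff, Set.mem_singleton_iff, not_or] at hs' ht'
      refine hst (hz r {s} ?_ ⟨s, rfl⟩ ?_ (?_ : t ∈ _)).symm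
      · simp [hs'.1, hs'.2.1, hs'.2.2, hrs.symm]
      · rintro v rfl w ⟨hw, hw'⟩ hvw
        have := hsub hw
        simp only [Set.mem_insert_iff, Set.mem_singleton_iff, not_or] at this hw' ⊢
        rcases this with e | e | e | e | e
        · exact (hw'.1 e).elim
        · exact (hw'.2.1 e).elim
        · exact (hw'.2.2 e).elim
        · exact e
        · exact (hcon (e ▸ hvw)).elim
      · simp [ht'.1, ht'.2.1, ht'.2.2, hrt.symm]
    have Aab := pair c a b (rest.trans fun w => by
      simp only [Set.mem_insert_iff, Set.mem_singleton_iff]; tauto) ha hb hab hac.symm hbc.symm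
    have Aac := pair b a c (rest.trans fun w => by
      simp only [Set.mem_insert_iff, Set.mem_singleton_iff]; tauto) ha hc hac hab.symm hbc
    have Abc := pair a b c rest hb hc hbc hab hac
    refine (hK5 ⟨?_, ?_⟩).elim
    · have h0 := Set.ncard_le_ncard rest
      have h1 := Set.ncard_insert_le x {y, a, b, c}
      have h2 := Set.ncard_insert_le y {a, b, c}
      have h3 := Set.ncard_insert_le a {b, c}
      have h4 := Set.ncard_insert_le b {c}
      have h5 := Set.ncard_singleton c
      omega
    · have Xa := ha.2.2
      have Xb := hb.2.2
      have Xc := hc.2.2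
      have Ya := ha'.2.2
      have Yb := hb'.2.2
      have Yc := hc'.2.2
      intro s hs t ht hst
      have sym : ∀ {u v}, G.Adj u v → G.Adj v u := fun h => h.symm
      rcases rest hs with rfl | rfl | rfl | rfl | rfl <;>
      rcases rest ht with rfl | rfl | rfl | rfl | rfl <;>
      first
      | exact (hst rfl).elim
      | assumption
      | (apply sym; assumption)
  · obtain ⟨u, k, hu, hk, hk', h1, h2⟩ := exists_cone (Complex.neg_pi_lt_arg (p l - p x))
      (Complex.arg_le_pi (p m - p x)) (lt_of nY Set.subset_union_right hlm)
    exact split hu hk hk'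
      (fun w hw hwx hyw => h1 _ (hlm w ⟨hw, hwx, hyw⟩).1 (hlm w ⟨hw, hwx, hyw⟩).2)
      (fun w hw hwy hxw => h2 _ (hgap w ⟨hw, hwy, hxw⟩))
  · obtain ⟨u, k, hu, hk, hk', h1, h2⟩ := exists_cone (Complex.neg_pi_lt_arg (p l - p x))
      (Complex.arg_le_pi (p m - p x)) (lt_of nX Set.subset_union_left hlm)
    refine split (u := -u) (k := -k) (by simpa using hu) (by linarith) (by linarith)
      (fun w hw hwx hyw => ?_) (fun w hw hwy hxw => ?_)
    · have := h2 _ (hgap w ⟨hw, hwx, hyw⟩)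
      rw [inner_neg_left]
      linarith
    · have := h1 _ (hlm w ⟨hw, hwy, hxw⟩).1 (hlm w ⟨hw, hwy, hxw⟩).2
      rw [inner_neg_left]
      linarith

theorem ThreeConnected.threeConnOn_univ [Fintype V] (h : G.ThreeConnected) :
    G.ThreeConnOn Set.univ := by
  refine ⟨by rw [Set.ncard_univ, Nat.card_eq_fintype_card]; exact h.1,
    fun s t T hT hT' hc v hv => ?_⟩
  have hcard : ({s, t} : Set V).ncard ≤ 2 := (Set.ncard_insert_le s {t}).trans (by simp)
  obtain ⟨a, ha⟩ := hT'
  have hv' : v ∈ ({s, t} : Set V)ᶜ := hv.2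
  have ha' : a ∈ ({s, t} : Set V)ᶜ := (hT ha).2
  obtain ⟨w⟩ := (h.2 {s, t} hcard).preconnected ⟨a, ha'⟩ ⟨v, hv'⟩
  have key : ∀ {c d : ({s, t} : Set V)ᶜ.Elem}, (G.induce ({s, t} : Set V)ᶜ).Walk c d →
      c.1 ∈ T → d.1 ∈ T := by
    intro c d w
    induction w with
    | nil => exact id
    | @cons c e d hce _ ih => exact fun hcT => ih (hc c.1 hcT e.1 ⟨trivial, e.2⟩ hce)
  exact key w ha

end SimpleGraph

/-- A 3-connected graph is non-planar iff it is isomorphic to `K₅` or contains a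
subdivision of `K_{3,3}`. -/
theorem stmt_1 {V : Type u} [Fintype V] (G : SimpleGraph V) (h3 : G.ThreeConnected) :
    ¬ G.IsPlanar ↔ Nonempty (G ≃g (⊤ : SimpleGraph (Fin 5))) ∨ Nonempty G.Hex := by
  constructor
  · intro hnp
    by_contra! hcon
    obtain ⟨hK5, hH⟩ := hcon
    obtain ⟨p, hp⟩ := h3.threeConnOn_univ.exists_straightDrawing
      (fun hm => hm.nonempty_hex.elim fun H => hH.false H) (fun ⟨hcard, hadj⟩ => by
        rw [Set.ncard_univ, Nat.card_eq_fintype_card] at hcard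
        refine hK5.false ⟨Fintype.equivFinOfCardEq hcard, fun {a b} => ?_⟩
        rw [top_adj, (Fintype.equivFinOfCardEq hcard).injective.ne_iff]
        exact ⟨fun hab => hadj a trivial b trivial hab, Adj.ne⟩)
    exact hnp hp.isPlanar
  · rintro (⟨⟨f⟩⟩ | ⟨⟨H⟩⟩)
    · exact not_isPlanar_of_iso_top f
    · exact H.not_isPlanar
end

section
/- Let G be a 3-connected bipartite graph. Then every optimal hex of G (a hex with the maximum possible number of odd segments among all hexes of G) has at least four odd segments. -/
open SimpleGraph

universe u

variable {V : Type u}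

namespace SimpleGraph

variable {G : SimpleGraph V}

/-- `S` is the vertex set of a path of `G` from `u` to `v`. -/
def IsPathSet (G : SimpleGraph V) (S : Set V) (u v : V) : Prop :=
  ∃ p : G.Walk u v, p.IsPath ∧ ∀ x, x ∈ S ↔ x ∈ p.support

namespace IsPathSet

variable {S T : Set V} {u v w : V}

lemma start_mem (h : G.IsPathSet S u v) : u ∈ S := by
  obtain ⟨p, -, hp⟩ := h
  simp [hp]

lemma end_mem (h : G.IsPathSet S u v) : v ∈ S := by
  obtain ⟨p, -, hp⟩ := h
  simp [hp]

lemma symm (h : G.IsPathSet S u v) : G.IsPathSet S v u := by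
  obtain ⟨p, hp, hS⟩ := h
  exact ⟨p.reverse, hp.reverse, by simpa using hS⟩

lemma append (h : G.IsPathSet S u v) (h' : G.IsPathSet T v w)
    (hd : ∀ x ∈ S, x ∈ T → x = v) : G.IsPathSet (S ∪ T) u w := by
  obtain ⟨p, hp, hS⟩ := h
  obtain ⟨q, hq, hT⟩ := h'
  refine ⟨p.append q, ?_, fun x => by simp [Walk.mem_support_append_iff, hS, hT]⟩
  rw [Walk.isPath_def, Walk.support_append, List.nodup_append]
  refine ⟨hp.support_nodup, hq.support_nodup.tail, ?_⟩
  rintro x hx y hy rfl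
  have hv := hd x ((hS x).2 hx) ((hT x).2 (List.mem_of_mem_tail hy))
  have hn := hq.support_nodup
  rw [← Walk.cons_tail_support, List.nodup_cons] at hn
  exact hn.1 (hv ▸ hy)

lemma split (h : G.IsPathSet S u v) (hw : w ∈ S) :
    ∃ S₁ S₂ : Set V, G.IsPathSet S₁ u w ∧ G.IsPathSet S₂ w v ∧
      (∀ x, x ∈ S ↔ x ∈ S₁ ∨ x ∈ S₂) ∧ ∀ x ∈ S₁, x ∈ S₂ → x = w := by
  classical
  obtain ⟨p, hp, hS⟩ := h
  have hw' := (hS w).1 hw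
  refine ⟨{x | x ∈ (p.takeUntil w hw').support}, {x | x ∈ (p.dropUntil w hw').support},
    ⟨_, hp.takeUntil hw', fun x => Iff.rfl⟩, ⟨_, hp.dropUntil hw', fun x => Iff.rfl⟩,
    fun x => ?_, fun x h₁ h₂ => ?_⟩
  · rw [hS, Set.mem_ofPred_eq, Set.mem_ofPred_eq, ← Walk.mem_support_append_iff, Walk.take_spec]
  · have hn := hp.support_nodup
    rw [← Walk.take_spec p hw', Walk.support_append, List.nodup_append] at hn
    by_contra hne
    have h₂' : x ∈ (p.dropUntil w hw').support := h₂
    rw [← Walk.cons_tail_support, List.mem_cons] at h₂'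
    exact hn.2.2 x h₁ x (h₂'.resolve_left hne) rfl

lemma adj_of_subset (h : G.IsPathSet S u v) (huv : u ≠ v)
    (hS : ∀ x ∈ S, x = u ∨ x = v) : G.Adj u v := by
  obtain ⟨p, hp, hpS⟩ := h
  cases p with
  | nil => exact absurd rfl huv
  | @cons _ w _ hadj q =>
    rw [Walk.cons_isPath_iff] at hp
    rcases hS w ((hpS w).2 (by simp)) with rfl | rfl
    · exact absurd q.start_mem_support hp.2
    · exact hadj

end IsPathSet

/-- In a connected graph obtained by deleting `D`, a shortest path joining two sets meets each of
them in one vertex only. -/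
lemma exists_isPathSet_of_connected_induce_compl {D X Y : Set V} (hD : (G.induce Dᶜ).Connected)
    (hX : X.Nonempty) (hY : Y.Nonempty) (hXD : ∀ x ∈ X, x ∉ D) (hYD : ∀ y ∈ Y, y ∉ D) :
    ∃ x ∈ X, ∃ y ∈ Y, ∃ R : Set V, G.IsPathSet R x y ∧ (∀ v ∈ R, v ∉ D) ∧
      (∀ v ∈ R, v ∈ X → v = x) ∧ ∀ v ∈ R, v ∈ Y → v = y := by
  classical
  have hex : ∃ n, ∃ x y, x ∈ X ∧ y ∈ Y ∧ ∃ p : G.Walk x y, (∀ v ∈ p.support, v ∉ D) ∧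
      p.length = n := by
    obtain ⟨x, hx⟩ := hX
    obtain ⟨y, hy⟩ := hY
    obtain ⟨p⟩ := hD.preconnected ⟨x, hXD x hx⟩ ⟨y, hYD y hy⟩
    refine ⟨_, x, y, hx, hy, p.map (Embedding.induce Dᶜ).toHom, fun v hv => ?_, rfl⟩
    obtain ⟨a, -, rfl⟩ := List.mem_map.1 (Walk.support_map _ p ▸ hv)
    exact a.2
  obtain ⟨x, y, hx, hy, p, hpD, hlen⟩ := Nat.find_spec hex
  have hmin : ∀ x' y', x' ∈ X → y' ∈ Y → ∀ q : G.Walk x' y', (∀ v ∈ q.support, v ∉ D) →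
      p.length ≤ q.length := fun x' y' hx' hy' q hq =>
    hlen ▸ Nat.find_min' hex ⟨x', y', hx', hy', q, hq, rfl⟩
  have hlt : ∀ {a b : V} (r : G.Walk a b), r.length = 0 → a = b := fun r hr =>
    Walk.eq_of_length_eq_zero hr
  refine ⟨x, hx, y, hy, {v | v ∈ p.bypass.support},
    ⟨p.bypass, p.bypass_isPath, fun _ => Iff.rfl⟩,
    fun v hv => hpD v (p.support_bypass_subset_support hv), fun v hv hvX => ?_, fun v hv hvY => ?_⟩
  · have hv' := p.support_bypass_subset_support hv
    have h := hmin v y hvX hy (p.dropUntil v hv')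
      fun a ha => hpD a (p.support_dropUntil_subset_support hv' ha)
    have hs := congrArg Walk.length (p.take_spec hv')
    rw [Walk.length_append] at hs
    exact (hlt (p.takeUntil v hv') (by omega)).symm
  · have hv' := p.support_bypass_subset_support hv
    have h := hmin x v hx hvY (p.takeUntil v hv')
      fun a ha => hpD a (p.support_takeUntil_subset_support hv' ha)
    have hs := congrArg Walk.length (p.take_spec hv')
    rw [Walk.length_append] at hs
    exact hlt (p.dropUntil v hv') (by omega)

/-- Three paths from `x ∉ C` to distinct vertices `a`, `b`, `y` of `C`, disjoint apart from `x`
and otherwise avoiding `C`. -/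
structure IsTripod (G : SimpleGraph V) (C : Set V) (a b x y : V) (P₁ P₂ Q : Set V) : Prop where
  path_left : G.IsPathSet P₁ a x
  path_right : G.IsPathSet P₂ x b
  path_jump : G.IsPathSet Q x y
  left_right : ∀ v ∈ P₁, v ∈ P₂ → v = x
  left_jump : ∀ v ∈ P₁, v ∈ Q → v = x
  right_jump : ∀ v ∈ P₂, v ∈ Q → v = x
  left_inter : ∀ v ∈ P₁, v ∈ C → v = a
  right_inter : ∀ v ∈ P₂, v ∈ C → v = b
  jump_inter : ∀ v ∈ Q, v ∈ C → v = y
  jump_mem : y ∈ C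
  jump_ne_left : y ≠ a
  jump_ne_right : y ≠ b
  center_notMem : x ∉ C

lemma IsTripod.symm {C : Set V} {a b x y : V} {P₁ P₂ Q : Set V}
    (h : G.IsTripod C a b x y P₁ P₂ Q) : G.IsTripod C b a x y P₂ P₁ Q where
  path_left := h.path_right.symm
  path_right := h.path_left.symm
  path_jump := h.path_jump
  left_right v hv hv' := h.left_right v hv' hv
  left_jump := h.right_jump
  right_jump := h.left_jump
  left_inter := h.right_inter
  right_inter := h.left_inter
  jump_inter := h.jump_inter
  jump_mem := h.jump_mem
  jump_ne_left := h.jump_ne_right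
  jump_ne_right := h.jump_ne_left
  center_notMem := h.center_notMem

/-- If the path from `a` to the centre of a tripod has an inner vertex, it can be shortened. -/
lemma IsTripod.exists_shorter [Fintype V] (h3 : G.ThreeConnected) {C : Set V} {a b x y : V}
    {P₁ P₂ Q : Set V} (h : G.IsTripod C a b x y P₁ P₂ Q) {w₀ : V}
    (hw₀ : w₀ ∈ P₁) (hw₀a : w₀ ≠ a) (hw₀x : w₀ ≠ x) :
    ∃ x' y' P₁' P₂' Q', G.IsTripod C a b x' y' P₁' P₂' Q' ∧ P₁' ⊂ P₁ := by
  obtain ⟨hP₁, hP₂, hQ, h12, h1Q, h2Q, h1C, h2C, hQC, hy, hya, hyb, hx⟩ := h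
  obtain ⟨w, ⟨hw, hwax⟩, t, ⟨ht, htax⟩, R, hR, hRD, hRX, hRY⟩ :=
    exists_isPathSet_of_connected_induce_compl (D := {a, x}) (X := P₁ \ {a, x})
      (Y := (C ∪ P₂ ∪ Q) \ {a, x}) (h3.2 {a, x} ((Set.ncard_insert_le _ _).trans (by simp)))
      ⟨w₀, hw₀, by simp [hw₀a, hw₀x]⟩
      ⟨y, by simp [hy], by
        simp only [Set.mem_insert_iff, Set.mem_singleton_iff, not_or]
        exact ⟨hya, fun e => hx (e ▸ hy)⟩⟩
      (fun v hv => hv.2) (fun v hv => hv.2)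
  obtain ⟨A₁, A₂, hA₁, hA₂, hA, hA12⟩ := hP₁.split hw
  have hAx := hA₂.end_mem
  have hAa := hA₁.start_mem
  have hAw := hA₁.end_mem
  have hbP := hP₂.end_mem
  have hxP := hP₂.start_mem
  have hxQ := hQ.start_mem
  have hyQ := hQ.end_mem
  have hRw := hR.start_mem
  have hRt := hR.end_mem
  simp only [Set.mem_sdiff, Set.mem_union, Set.mem_insert_iff, Set.mem_singleton_iff, not_or]
    at hwax htax hRX hRY hRD ht
  have hsub : A₁ ⊂ P₁ := by
    refine ⟨fun v hv => (hA v).2 (Or.inl hv), fun hle => ?_⟩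
    exact hwax.2 (hA12 x (hle hP₁.end_mem) hAx).symm
  by_cases htP : t ∈ P₂
  · obtain ⟨B₁, B₂, hB₁, hB₂, hB, hB12⟩ := hP₂.split htP
    have hBx := hB₁.start_mem
    refine ⟨w, y, A₁, R ∪ B₂, A₂ ∪ Q, ⟨hA₁, hR.append hB₂ ?_, hA₂.append hQ ?_,
      ?_, ?_, ?_, ?_, ?_, ?_, ?_, ?_, ?_, ?_⟩, hsub⟩ <;> grind
  · by_cases htQ : t ∈ Q
    · obtain ⟨B₁, B₂, hB₁, hB₂, hB, hB12⟩ := hQ.split htQ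
      have hBx := hB₁.start_mem
      refine ⟨w, y, A₁, A₂ ∪ P₂, R ∪ B₂, ⟨hA₁, hA₂.append hP₂ ?_, hR.append hB₂ ?_,
        ?_, ?_, ?_, ?_, ?_, ?_, ?_, ?_, ?_, ?_⟩, hsub⟩ <;> grind
    · refine ⟨w, t, A₁, A₂ ∪ P₂, R, ⟨hA₁, hA₂.append hP₂ ?_, hR,
        ?_, ?_, ?_, ?_, ?_, ?_, ?_, ?_, ?_, ?_⟩, hsub⟩ <;> grind

lemma IsTripod.exists_adj [Fintype V] (h3 : G.ThreeConnected) {C : Set V} {a b x y : V}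
    {P₁ P₂ Q : Set V} (ha : a ∈ C) (h : G.IsTripod C a b x y P₁ P₂ Q) :
    ∃ x' y' P₁' P₂' Q', G.IsTripod C a b x' y' P₁' P₂' Q' ∧ G.Adj a x' := by
  induction hn : P₁.ncard using Nat.strong_induction_on generalizing x y P₁ P₂ Q with
  | _ n ih =>
    subst hn
    by_cases hw : ∃ w ∈ P₁, w ≠ a ∧ w ≠ x
    · obtain ⟨w, hw, hwa, hwx⟩ := hw
      obtain ⟨x', y', P₁', P₂', Q', h', hlt⟩ := h.exists_shorter h3 hw hwa hwx
      exact ih _ (Set.ncard_lt_ncard hlt) h' rfl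
    · refine ⟨x, y, P₁, P₂, Q, h, h.path_left.adj_of_subset ?_ ?_⟩
      · rintro rfl
        exact h.center_notMem ha
      · grind

/-- A path with an inner vertex whose inner vertices avoid `C` extends to a tripod whose centre is
adjacent to the first end of the path. -/
lemma IsPathSet.exists_tripod [Fintype V] (h3 : G.ThreeConnected) {C P : Set V} {a b c w₀ : V}
    (hP : G.IsPathSet P a b) (ha : a ∈ C) (hPC : ∀ v ∈ P, v ∈ C → v = a ∨ v = b)
    (hc : c ∈ C) (hca : c ≠ a) (hcb : c ≠ b) (hw₀ : w₀ ∈ P) (hwa : w₀ ≠ a) (hwb : w₀ ≠ b) :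
    ∃ x y P₁ P₂ Q, G.IsTripod C a b x y P₁ P₂ Q ∧ G.Adj a x := by
  obtain ⟨w, ⟨hw, hwab⟩, t, ⟨ht, htab⟩, R, hR, hRD, hRX, hRY⟩ :=
    exists_isPathSet_of_connected_induce_compl (D := {a, b}) (X := P \ {a, b})
      (Y := C \ {a, b}) (h3.2 {a, b} ((Set.ncard_insert_le _ _).trans (by simp)))
      ⟨w₀, hw₀, by simp [hwa, hwb]⟩ ⟨c, hc, by simp [hca, hcb]⟩
      (fun v hv => hv.2) (fun v hv => hv.2)
  obtain ⟨A₁, A₂, hA₁, hA₂, hA, hA12⟩ := hP.split hw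
  have hAa := hA₁.start_mem
  have hAb := hA₂.end_mem
  simp only [Set.mem_sdiff, Set.mem_insert_iff, Set.mem_singleton_iff, not_or]
    at hwab htab hRX hRY hRD
  have h : G.IsTripod C a b w t A₁ A₂ R := by
    refine ⟨hA₁, hA₂, hR, hA12, ?_, ?_, ?_, ?_, ?_, ht, htab.1, htab.2, ?_⟩ <;> grind
  exact h.exists_adj h3 ha

/-- The feet `f`, `g` and the vertex sets `S i j` of the segments of a hex. -/
structure IsHexSets (G : SimpleGraph V) (f g : Fin 3 → V) (S : Fin 3 → Fin 3 → Set V) :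
    Prop where
  inj_left : Function.Injective f
  inj_right : Function.Injective g
  feet_ne : ∀ i j, f i ≠ g j
  path : ∀ i j, G.IsPathSet (S i j) (f i) (g j)
  meet : ∀ i j i' j', (i, j) ≠ (i', j') → ∀ x, x ∈ S i j → x ∈ S i' j' →
    (x = f i ∧ i = i') ∨ (x = g j ∧ j = j')

section IsHexSets

variable {f g : Fin 3 → V} {S : Fin 3 → Fin 3 → Set V}

lemma IsHexSets.eq_left (h : G.IsHexSets f g S) {i j j' : Fin 3} (hj : j ≠ j') {x : V}
    (hx : x ∈ S i j) (hx' : x ∈ S i j') : x = f i := by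
  grind [h.meet i j i j' (by grind) x hx hx']

lemma IsHexSets.eq_right (h : G.IsHexSets f g S) {i i' j : Fin 3} (hi : i ≠ i') {x : V}
    (hx : x ∈ S i j) (hx' : x ∈ S i' j) : x = g j := by
  grind [h.meet i j i' j (by grind) x hx hx']

lemma IsHexSets.notMem (h : G.IsHexSets f g S) {i i' j j' : Fin 3} (hi : i ≠ i') (hj : j ≠ j')
    {x : V} (hx : x ∈ S i j) : x ∉ S i' j' := fun hx' => by
  grind [h.meet i j i' j' (by grind) x hx hx']

lemma IsHexSets.right_notMem (h : G.IsHexSets f g S) (i : Fin 3) {j j' : Fin 3} (hj : j ≠ j') :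
    g j ∉ S i j' := fun hx =>
  h.feet_ne i j (h.eq_left hj (h.path i j).end_mem hx).symm

lemma IsHexSets.left_notMem (h : G.IsHexSets f g S) {i i' : Fin 3} (j : Fin 3) (hi : i ≠ i') :
    f i ∉ S i' j := fun hx =>
  h.feet_ne i j (h.eq_right hi (h.path i j).start_mem hx)

lemma meet_of_rows_of_columns
    (hrow : ∀ i j j', j ≠ j' → ∀ x, x ∈ S i j → x ∈ S i j' → x = f i)
    (hcol : ∀ i i' j, i ≠ i' → ∀ x, x ∈ S i j → x ∈ S i' j → x = g j)
    (hdisj : ∀ i i' j j', i ≠ i' → j ≠ j' → ∀ x, x ∈ S i j → x ∉ S i' j') (i j i' j' : Fin 3)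
    (hne : (i, j) ≠ (i', j')) (x : V) (hx : x ∈ S i j) (hx' : x ∈ S i' j') :
    (x = f i ∧ i = i') ∨ (x = g j ∧ j = j') := by
  by_cases hi : i = i'
  · subst hi
    exact Or.inl ⟨hrow i j j' (by grind) x hx hx', rfl⟩
  · by_cases hj : j = j'
    · subst hj
      exact Or.inr ⟨hcol i i' j hi x hx hx', rfl⟩
    · exact absurd hx' (hdisj i i' j j' hi hj x hx)

end IsHexSets

/-- `f` and `g` list the feet of some hex. -/
def IsHexFeet (G : SimpleGraph V) (f g : Fin 3 → V) : Prop :=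
  ∃ S, G.IsHexSets f g S

lemma IsHexSets.symm {f g : Fin 3 → V} {S : Fin 3 → Fin 3 → Set V} (h : G.IsHexSets f g S) :
    G.IsHexSets g f fun i j => S j i where
  inj_left := h.inj_right
  inj_right := h.inj_left
  feet_ne i j := (h.feet_ne j i).symm
  path i j := (h.path j i).symm
  meet i j i' j' hne x hx hx' :=
    (h.meet j i j' i' (by grind) x hx hx').symm

lemma IsHexFeet.symm {f g : Fin 3 → V} (h : G.IsHexFeet f g) : G.IsHexFeet g f :=
  let ⟨_, hS⟩ := h
  ⟨_, hS.symm⟩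

lemma Hex.isHexSets (H : G.Hex) :
    G.IsHexSets H.fA H.fB fun i j => {x | x ∈ (H.seg i j).support} where
  inj_left := H.injA
  inj_right := H.injB
  feet_ne := H.disjAB
  path i j := ⟨H.seg i j, H.seg_path i j, fun _ => Iff.rfl⟩
  meet := H.seg_meet

lemma IsHexFeet.exists_hex {f g : Fin 3 → V} (h : G.IsHexFeet f g) :
    ∃ H : G.Hex, H.fA = f ∧ H.fB = g := by
  obtain ⟨S, h⟩ := h
  choose p hp hS using h.path
  exact ⟨⟨f, g, h.inj_left, h.inj_right, h.feet_ne, p, hp, fun i j i' j' hne x hx hx' =>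
    h.meet i j i' j' hne x ((hS i j x).2 hx) ((hS i' j' x).2 hx')⟩, rfl, rfl⟩

lemma injective_update {ι : Type*} [DecidableEq ι] {f : ι → V} (hf : Function.Injective f) {i : ι}
    {x : V} (hx : ∀ m, x ≠ f m) : Function.Injective (Function.update f i x) := by
  intro m m' e
  have := hx m
  have := hx m'
  have := @hf m m'
  simp only [Function.update_apply] at e
  grind

/-- The vertices lying on a segment other than segment `i j`. -/
def otherSegments (S : Fin 3 → Fin 3 → Set V) (i j : Fin 3) : Set V :=
  {v | ∃ m n, (m, n) ≠ (i, j) ∧ v ∈ S m n}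

section Jump

variable {f g : Fin 3 → V} {S : Fin 3 → Fin 3 → Set V} {i i' j j' : Fin 3} {x y : V}
  {P₁ P₂ Q : Set V}

lemma IsHexSets.left_mem_otherSegments (h : G.IsHexSets f g S) (i j m : Fin 3) :
    f m ∈ otherSegments S i j := by
  obtain ⟨n, hn⟩ := exists_ne j
  exact ⟨m, n, by grind, (h.path m n).start_mem⟩

lemma IsHexSets.right_mem_otherSegments (h : G.IsHexSets f g S) (i j n : Fin 3) :
    g n ∈ otherSegments S i j := by
  obtain ⟨m, hm⟩ := exists_ne i
  exact ⟨m, n, by grind, (h.path m n).end_mem⟩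

/-- A jump from inside segment `i j` to a segment sharing the foot `f i` with it: its start can
replace that foot. -/
lemma IsHexSets.update_left (h : G.IsHexSets f g S) (hj : j' ≠ j)
    (hT : G.IsTripod (otherSegments S i j) (f i) (g j) x y P₁ P₂ Q) (hy : y ∈ S i j') :
    G.IsHexFeet (Function.update f i x) g := by
  have hxf : ∀ m, x ≠ f m := fun m e =>
    hT.center_notMem (e ▸ h.left_mem_otherSegments i j m)
  have hxg : ∀ n, x ≠ g n := fun n e =>
    hT.center_notMem (e ▸ h.right_mem_otherSegments i j n)
  obtain ⟨hP₁, hP₂, hQ, h12, h1Q, h2Q, h1C, h2C, hQC, hyC, hya, hyb, hx⟩ := hT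
  obtain ⟨Y₁, Y₂, hY₁, hY₂, hY, hY12⟩ := (h.path i j').split hy
  have hCrow : ∀ n v, n ≠ j → v ∈ S i n → v ∈ otherSegments S i j :=
    fun n v hne hv => ⟨i, n, by grind, hv⟩
  have hCcol : ∀ m n v, m ≠ i → v ∈ S m n → v ∈ otherSegments S i j :=
    fun m n v hne hv => ⟨m, n, by grind, hv⟩
  have hYf := hY₁.start_mem
  have hfg := h.feet_ne i
  have hgS := fun m n (hn : j ≠ n) => h.right_notMem m hn
  have hfS := fun m n (hm : i ≠ m) => h.left_notMem n hm
  have hrow := fun i j j' hj x => @IsHexSets.eq_left _ _ _ _ _ h i j j' hj x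
  have hcol := fun i i' j hi x => @IsHexSets.eq_right _ _ _ _ _ h i i' j hi x
  have hdisj := fun i i' j j' hi hj x => @IsHexSets.notMem _ _ _ _ _ h i i' j j' hi hj x
  refine ⟨fun m n => if m = i then (if n = j then P₂ else if n = j' then Q ∪ Y₂ else P₁ ∪ S i n)
    else S m n, injective_update h.inj_left hxf, h.inj_right, ?_, ?_,
    meet_of_rows_of_columns ?_ ?_ ?_⟩
  · intro m n
    have := h.feet_ne m n
    simp only [Function.update_apply]
    grind
  · intro m n
    by_cases hmi : m = i
    · subst hmi
      simp only [Function.update_self, if_true]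
      split_ifs with hnj hnj'
      · exact hnj ▸ hP₂
      · subst hnj'
        exact hQ.append hY₂ (by grind)
      · exact hP₁.symm.append (h.path m n) (by grind)
    · simpa only [hmi, if_false, Function.update_of_ne hmi] using h.path m n
  · intro m n n' hn v
    by_cases hmi : m = i
    · subst hmi
      simp only [Function.update_self, if_true]
      clear hP₁ hP₂ hQ hY₁ hY₂ h hdisj hcol
      grind
    · simpa only [hmi, if_false, Function.update_of_ne hmi] using hrow m n n' hn v
  · intro m m' n hm v
    by_cases hmi : m = i
    · subst hmi
      simp only [hm.symm, if_true, if_false]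
      clear hP₁ hP₂ hQ hY₁ hY₂ h hdisj
      grind
    · by_cases hmi' : m' = i
      · subst hmi'
        simp only [hmi, if_true, if_false]
        clear hP₁ hP₂ hQ hY₁ hY₂ h hdisj
        grind
      · simpa only [hmi, hmi', if_false] using hcol m m' n hm v
  · intro m m' n n' hm hn v
    by_cases hmi : m = i
    · subst hmi
      simp only [hm.symm, if_true, if_false]
      clear hP₁ hP₂ hQ hY₁ hY₂ h
      grind
    · by_cases hmi' : m' = i
      · subst hmi'
        simp only [hmi, if_true, if_false]
        clear hP₁ hP₂ hQ hY₁ hY₂ h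
        grind
      · simpa only [hmi, hmi', if_false] using hdisj m m' n n' hm hn v

/-- A jump from inside segment `i j` to the inside of a segment sharing no foot with it: its ends
can replace one foot of each of the two segments. -/
lemma IsHexSets.update_both (h : G.IsHexSets f g S) (hi : i' ≠ i) (hj : j' ≠ j)
    (hT : G.IsTripod (otherSegments S i j) (f i) (g j) x y P₁ P₂ Q) (hy : y ∈ S i' j')
    (hyf' : y ≠ f i') (hyg' : y ≠ g j') :
    G.IsHexFeet (Function.update f i x) (Function.update g j' y) := by
  have hxf : ∀ m, x ≠ f m := fun m e =>
    hT.center_notMem (e ▸ h.left_mem_otherSegments i j m)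
  have hxg : ∀ n, x ≠ g n := fun n e =>
    hT.center_notMem (e ▸ h.right_mem_otherSegments i j n)
  have hyf : ∀ m, y ≠ f m := fun m e => by
    by_cases hm : m = i'
    · exact hyf' (hm ▸ e)
    · exact h.left_notMem j' hm (e ▸ hy)
  have hyg : ∀ n, y ≠ g n := fun n e => by
    by_cases hn : n = j'
    · exact hyg' (hn ▸ e)
    · exact h.right_notMem i' hn (e ▸ hy)
  obtain ⟨hP₁, hP₂, hQ, h12, h1Q, h2Q, h1C, h2C, hQC, hyC, hya, hyb, hx⟩ := hT
  obtain ⟨Y₁, Y₂, hY₁, hY₂, hY, hY12⟩ := (h.path i' j').split hy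
  have hCrow : ∀ n v, n ≠ j → v ∈ S i n → v ∈ otherSegments S i j :=
    fun n v hne hv => ⟨i, n, by grind, hv⟩
  have hCcol : ∀ m n v, m ≠ i → v ∈ S m n → v ∈ otherSegments S i j :=
    fun m n v hne hv => ⟨m, n, by grind, hv⟩
  have hYf := hY₁.start_mem
  have hYg := hY₂.end_mem
  have hxy : x ≠ y := fun e => hx (e ▸ hyC)
  have hfg := h.feet_ne i
  have hgS := fun m n n' (hn : n' ≠ n) => h.right_notMem m hn
  have hfS := fun m m' n (hm : m' ≠ m) => h.left_notMem n hm
  have hrow := fun i j j' hj x => @IsHexSets.eq_left _ _ _ _ _ h i j j' hj x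
  have hcol := fun i i' j hi x => @IsHexSets.eq_right _ _ _ _ _ h i i' j hi x
  have hdisj := fun i i' j j' hi hj x => @IsHexSets.notMem _ _ _ _ _ h i i' j j' hi hj x
  refine ⟨fun m n => if m = i then (if n = j then P₂ else if n = j' then Q else P₁ ∪ S i n)
    else if n = j' then (if m = i' then Y₁ else S m j' ∪ Y₂) else S m n,
    injective_update h.inj_left hxf, injective_update h.inj_right hyg, ?_, ?_,
    meet_of_rows_of_columns ?_ ?_ ?_⟩
  · intro m n
    have := h.feet_ne m n
    simp only [Function.update_apply]
    grind
  · intro m n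
    by_cases hmi : m = i
    · subst hmi
      simp only [Function.update_self, if_true]
      split_ifs with hnj hnj'
      · subst hnj
        rwa [Function.update_of_ne hj.symm]
      · subst hnj'
        rwa [Function.update_self]
      · rw [Function.update_of_ne hnj']
        exact hP₁.symm.append (h.path m n) (by grind)
    · simp only [hmi, if_false, Function.update_of_ne hmi]
      split_ifs with hn hm
      · subst hn hm
        rwa [Function.update_self]
      · subst hn
        rw [Function.update_self]
        exact (h.path m n).append hY₂.symm (by grind)
      · rw [Function.update_of_ne hn]
        exact h.path m n
  · intro m n n' hn v
    clear hP₁ hP₂ hQ hY₁ hY₂ h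
    by_cases hmi : m = i
    · subst hmi
      simp only [Function.update_self, if_true]
      grind
    · simp only [hmi, if_false, Function.update_of_ne hmi]
      grind
  · intro m m' n hm v
    clear hP₁ hP₂ hQ hY₁ hY₂ h
    by_cases hmi : m = i
    · subst hmi
      simp only [hm.symm, if_true, if_false, Function.update_apply]
      grind
    · by_cases hmi' : m' = i
      · subst hmi'
        simp only [hmi, if_true, if_false, Function.update_apply]
        grind
      · simp only [hmi, hmi', if_false, Function.update_apply]
        grind
  · intro m m' n n' hm hn v
    clear hP₁ hP₂ hQ hY₁ hY₂ h
    by_cases hmi : m = i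
    · subst hmi
      simp only [hm.symm, if_true, if_false]
      grind
    · by_cases hmi' : m' = i
      · subst hmi'
        simp only [hmi, if_true, if_false]
        grind
      · simp only [hmi, hmi', if_false]
        grind

end Jump

lemma otherSegments_swap (S : Fin 3 → Fin 3 → Set V) (i j : Fin 3) :
    otherSegments (fun m n => S n m) j i = otherSegments S i j := by
  ext v
  simp only [otherSegments, Set.mem_ofPred_eq, ne_eq, Prod.mk.injEq]
  rw [exists_comm]
  simp only [and_comm (a := _ = j)]

/-- If segment `i j` has an inner vertex, some neighbour `x` of the foot `f i` can be made a foot. -/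
lemma IsHexSets.exists_feet [Fintype V] (h3 : G.ThreeConnected) {f g : Fin 3 → V}
    {S : Fin 3 → Fin 3 → Set V} (h : G.IsHexSets f g S) (i j : Fin 3) (hij : ¬ G.Adj (f i) (g j)) :
    ∃ x, G.Adj (f i) x ∧ (G.IsHexFeet (Function.update f i x) g ∨
      G.IsHexFeet f (Function.update g j x) ∨
      ∃ i' j' y, i' ≠ i ∧ j' ≠ j ∧
        G.IsHexFeet (Function.update f i x) (Function.update g j' y) ∧
        G.IsHexFeet (Function.update f i' y) (Function.update g j x)) := by
  have hw : ∃ w ∈ S i j, w ≠ f i ∧ w ≠ g j := by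
    by_contra hw
    exact hij ((h.path i j).adj_of_subset (h.feet_ne i j) (by grind))
  obtain ⟨w, hw, hwf, hwg⟩ := hw
  obtain ⟨m, hm⟩ := exists_ne i
  obtain ⟨x, y, P₁, P₂, Q, hT, hadj⟩ := (h.path i j).exists_tripod h3
    (h.left_mem_otherSegments i j i)
    (fun v hv ⟨m, n, hne, hv'⟩ => by grind [h.meet i j m n hne.symm v hv hv'])
    (h.left_mem_otherSegments i j m) (h.inj_left.ne hm) (h.feet_ne m j) hw hwf hwg
  have hT' := hT.symm
  rw [← otherSegments_swap] at hT'
  refine ⟨x, hadj, ?_⟩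
  obtain ⟨i', j', hne, hy⟩ := hT.jump_mem
  by_cases hi : i' = i
  · subst hi
    exact Or.inl (h.update_left (by grind) hT hy)
  by_cases hj : j' = j
  · subst hj
    exact Or.inr (Or.inl (h.symm.update_left hi hT' hy).symm)
  by_cases hyf : y = f i'
  · exact Or.inr (Or.inl (h.symm.update_left hi hT' (hyf ▸ (h.path i' j).start_mem)).symm)
  by_cases hyg : y = g j'
  · exact Or.inl (h.update_left hj hT (hyg ▸ (h.path i j').end_mem))
  exact Or.inr (Or.inr ⟨i', j', y, hi, hj, h.update_both hi hj hT hy hyf hyg,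
    (h.symm.update_both hj hi hT' hy hyg hyf).symm⟩)

/-- The number of pairs of different colours. -/
def bichromaticCount (α β : Fin 3 → Bool) : ℕ :=
  (Finset.univ.filter fun p : Fin 3 × Fin 3 => α p.1 ≠ β p.2).card

lemma exists_recoloring_increases (α β : Fin 3 → Bool) (h : bichromaticCount α β < 4) :
    ∃ i j, α i = β j ∧
      bichromaticCount α β < bichromaticCount (Function.update α i (!α i)) β ∧
      bichromaticCount α β < bichromaticCount α (Function.update β j (!α i)) ∧
      ∀ i' j' c, i' ≠ i → j' ≠ j →
        bichromaticCount α β <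
          bichromaticCount (Function.update α i (!α i)) (Function.update β j' c) ∨
        bichromaticCount α β <
          bichromaticCount (Function.update α i' c) (Function.update β j (!α i)) := by
  revert α β
  set_option maxRecDepth 100000 in decide

lemma Hex.oddCount_eq_bichromaticCount (c : G.Coloring Bool) (H : G.Hex) :
    H.oddCount = bichromaticCount (c ∘ H.fA) (c ∘ H.fB) := by
  unfold Hex.oddCount bichromaticCount
  congr 1
  ext p
  have := c.odd_length_iff_not_congr (H.seg p.1 p.2)
  simp only [Finset.mem_filter, Finset.mem_univ, true_and, this, Function.comp_apply]
  cases c (H.fA p.1) <;> cases c (H.fB p.2) <;> simp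

end SimpleGraph

/-- In a 3-connected bipartite graph, every optimal hex has at least four odd segments. -/
theorem stmt_8 {V : Type u} [Fintype V] (G : SimpleGraph V) (A B : Set V)
    (hbip : G.IsBipartition A B) (h3 : G.ThreeConnected)
    (H : G.Hex) (hopt : H.Optimal) :
    4 ≤ H.oddCount := by
  classical
  let c : G.Coloring Bool := Coloring.mk (fun v => decide (v ∈ A)) fun {x y} hxy => by
    have hdisj := fun v (hA : v ∈ A) (hB : v ∈ B) => Set.disjoint_left.1 hbip.1 hA hB
    grind [hbip.2.2 hxy]
  by_contra hlt
  have hmax : ∀ f g, G.IsHexFeet f g →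
      bichromaticCount (c ∘ f) (c ∘ g) ≤ bichromaticCount (c ∘ H.fA) (c ∘ H.fB) := by
    intro f g hfg
    obtain ⟨H', rfl, rfl⟩ := hfg.exists_hex
    simpa only [Hex.oddCount_eq_bichromaticCount c] using hopt H'
  rw [Hex.oddCount_eq_bichromaticCount c, not_le] at hlt
  obtain ⟨i, j, hij, hleft, hright, hboth⟩ := exists_recoloring_increases _ _ hlt
  obtain ⟨x, hadj, hcases⟩ := H.isHexSets.exists_feet h3 i j fun hadj => c.valid hadj hij
  have hx : (!(c ∘ H.fA) i) = c x := by
    have := c.valid hadj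
    simp only [Function.comp_apply]
    grind
  rw [hx] at hleft hright hboth
  rcases hcases with h | h | ⟨i', j', y, hi, hj, h, h'⟩
  · have := hmax _ _ h
    rw [Function.comp_update] at this
    omega
  · have := hmax _ _ h
    rw [Function.comp_update] at this
    omega
  · have h₁ := hmax _ _ h
    have h₂ := hmax _ _ h'
    rw [Function.comp_update, Function.comp_update] at h₁ h₂
    have := hboth i' j' (c y) hi hj
    omega
end
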